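/- arXiv:2004.05650 — 3 statements merged into one kernel-verified Lean document; each statement's English description precedes it below -/
import Mathlib

section
/- Let m>1, 0<p<1 with m+p>2. There exists σ₀∈(2(1−p)/(m−1),∞) such that for every σ∈(2(1−p)/(m−1),σ₀) there exists a good profile satisfying (P1) (that is, f(0)=a>0 and f'(0)=0) which has an interface of Type I at some ξ₀∈(0,∞). -/
open Real Filter Set Topology

/-- The function `f^m` (real power). -/
noncomputable def Fm (m : ℝ) (f : ℝ → ℝ) : ℝ → ℝ := fun ξ => f ξ ^ m

/-- `f` solves the self-similar profile ODE
`(f^m)'' - α f + β ξ f' + ξ^σ f^p = 0` on the set `S`. -/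
noncomputable def SolvesODE (m p σ α β : ℝ) (f : ℝ → ℝ) (S : Set ℝ) : Prop :=
  ∀ ξ ∈ S,
    deriv (deriv (Fm m f)) ξ - α * f ξ + β * ξ * deriv f ξ + ξ ^ σ * f ξ ^ p = 0

/-- A profile: continuous and nonnegative on `[0,∞)`, with `f^m` of class `C²`
on the (positive-space) positivity set, solving the profile ODE there. -/
noncomputable def IsProfile (m p σ α β : ℝ) (f : ℝ → ℝ) : Prop :=
  ContinuousOn f (Set.Ici 0) ∧ (∀ ξ ∈ Set.Ici (0 : ℝ), 0 ≤ f ξ) ∧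
    ContDiffOn ℝ 2 (Fm m f) {ξ : ℝ | 0 < ξ ∧ 0 < f ξ} ∧
    SolvesODE m p σ α β f {ξ : ℝ | 0 < ξ ∧ 0 < f ξ}

/-- Behavior (P1) at the origin: `f(0) = a > 0`, `f'(0) = 0`. -/
noncomputable def GoodP1 (f : ℝ → ℝ) : Prop :=
  0 < f 0 ∧ HasDerivWithinAt f 0 (Set.Ici 0) 0

/-- Behavior (P2) at the origin: `f(0) = 0`, `(f^m)'(0) = 0`. -/
noncomputable def GoodP2 (m : ℝ) (f : ℝ → ℝ) : Prop :=
  f 0 = 0 ∧ HasDerivWithinAt (Fm m f) 0 (Set.Ici 0) 0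

/-- `f` has an interface at `ξ₀ ∈ (0,∞)`: `f(ξ₀) = 0`, `(f^m)'(ξ₀) = 0`, and
`f > 0` on a left-neighborhood of `ξ₀`. -/
noncomputable def HasInterface (m : ℝ) (f : ℝ → ℝ) (ξ₀ : ℝ) : Prop :=
  0 < ξ₀ ∧ f ξ₀ = 0 ∧ HasDerivAt (Fm m f) 0 ξ₀ ∧
    ∃ δ > 0, ∀ ξ ∈ Set.Ioo (ξ₀ - δ) ξ₀, 0 < f ξ

/-- Type I interface behavior at `ξ₀`: `f(ξ)(ξ₀-ξ)^{-1/(m-1)}` has a finite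
positive limit as `ξ → ξ₀⁻`. -/
noncomputable def TypeI (m : ℝ) (f : ℝ → ℝ) (ξ₀ : ℝ) : Prop :=
  ∃ L > 0, Filter.Tendsto (fun ξ => f ξ * (ξ₀ - ξ) ^ (-(1 / (m - 1))))
    (nhdsWithin ξ₀ (Set.Iio ξ₀)) (nhds L)

/-- Type II interface behavior at `ξ₀`: `f(ξ)(ξ₀-ξ)^{-1/(1-p)}` has a finite
positive limit as `ξ → ξ₀⁻`. -/
noncomputable def TypeII (p : ℝ) (f : ℝ → ℝ) (ξ₀ : ℝ) : Prop :=
  ∃ L > 0, Filter.Tendsto (fun ξ => f ξ * (ξ₀ - ξ) ^ (-(1 / (1 - p))))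
    (nhdsWithin ξ₀ (Set.Iio ξ₀)) (nhds L)

open scoped NNReal

/-- The vector field of the first-order system satisfied by the pressure `P = x.1` and its
derivative `v = x.2`. -/
noncomputable def pressureField (n κ δ k y : ℝ) (x : ℝ × ℝ) : ℝ × ℝ :=
  (x.2, (2 * κ + 2 + δ) - x.2 * (n * (1 + κ) * y + x.2) / (n * x.1)
    - k * y ^ (2 * κ + δ) * x.1 ^ (-κ))

/-- Positive solutions on `[0, Y]` of the pressure system starting from `P = 1`, `P' = 0`. -/
def IsPressureSol (n κ δ k Y : ℝ) (x : ℝ → ℝ × ℝ) : Prop :=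
  x 0 = (1, 0) ∧ ∀ y ∈ Icc 0 Y, 0 < (x y).1 ∧
    HasDerivWithinAt x (pressureField n κ δ k y (x y)) (Icc 0 Y) y

/-- A compact box in the half plane of positive pressures. -/
def pressureBox (N : ℝ) : Set (ℝ × ℝ) := Icc N⁻¹ N ×ˢ Icc (-N) N

/-- The interior of `pressureBox`. -/
def pressureOpenBox (N : ℝ) : Set (ℝ × ℝ) := Ioo N⁻¹ N ×ˢ Ioo (-N) N

/-- The projection onto `pressureBox`. -/
noncomputable def pressureClamp (N : ℝ) (x : ℝ × ℝ) : ℝ × ℝ :=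
  (max N⁻¹ (min N x.1), max (-N) (min N x.2))

lemma pressureOpenBox_subset (N : ℝ) : pressureOpenBox N ⊆ pressureBox N :=
  prod_mono Ioo_subset_Icc_self Ioo_subset_Icc_self

lemma isOpen_pressureOpenBox (N : ℝ) : IsOpen (pressureOpenBox N) :=
  isOpen_Ioo.prod isOpen_Ioo

lemma isClosed_pressureBox (N : ℝ) : IsClosed (pressureBox N) :=
  isClosed_Icc.prod isClosed_Icc

lemma pressureClamp_mem {N : ℝ} (hN : 1 ≤ N) (x : ℝ × ℝ) :
    pressureClamp N x ∈ pressureBox N := by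
  have h : N⁻¹ ≤ N := (inv_le_one_of_one_le₀ hN).trans hN
  refine ⟨⟨le_max_left _ _, max_le h (min_le_left _ _)⟩,
    ⟨le_max_left _ _, max_le (by linarith) (min_le_left _ _)⟩⟩

lemma pressureClamp_of_mem {N : ℝ} {x : ℝ × ℝ} (hx : x ∈ pressureBox N) :
    pressureClamp N x = x := by
  obtain ⟨⟨h1, h2⟩, h3, h4⟩ := hx
  ext <;> simp [pressureClamp, *]

lemma lipschitzWith_pressureClamp (N : ℝ) : LipschitzWith 1 (pressureClamp N) := by
  have := ((LipschitzWith.prod_fst (α := ℝ) (β := ℝ)).const_min N).const_max N⁻¹ |>.prodMk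
    (((LipschitzWith.prod_snd (α := ℝ) (β := ℝ)).const_min N).const_max (-N))
  simpa using! this

lemma pos_of_mem_pressureBox {N : ℝ} (hN : 1 ≤ N) {x : ℝ × ℝ} (hx : x ∈ pressureBox N) :
    0 < x.1 := lt_of_lt_of_le (by positivity) hx.1.1

lemma exists_lipschitz_bound_pressureBox {N : ℝ} (hN : 1 ≤ N) {f : ℝ × ℝ → ℝ × ℝ}
    (hf : ContDiffOn ℝ 1 f {x | 0 < x.1}) :
    ∃ C : ℝ≥0, LipschitzOnWith C f (pressureBox N) ∧ ∀ x ∈ pressureBox N, ‖f x‖ ≤ C := by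
  have hc : IsCompact (pressureBox N) := isCompact_Icc.prod isCompact_Icc
  have hf' : ContDiffOn ℝ 1 f (pressureBox N) :=
    hf.mono fun x hx => pos_of_mem_pressureBox hN hx
  obtain ⟨C₁, h₁⟩ := hf'.exists_lipschitzOnWith one_ne_zero
    ((convex_Icc _ _).prod (convex_Icc _ _)) hc
  obtain ⟨C₂, h₂⟩ := hc.exists_bound_of_continuousOn hf'.continuousOn
  exact ⟨max C₁ C₂.toNNReal, h₁.weaken (le_max_left _ _), fun x hx =>
    (h₂ x hx).trans ((Real.le_coe_toNNReal _).trans (by exact_mod_cast le_max_right _ _))⟩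

lemma exists_lipschitz_bound_pressureField {n κ δ N : ℝ} (hn : 0 < n) (hσ : 0 ≤ 2 * κ + δ)
    (hN : 1 ≤ N) (Y K : ℝ) :
    ∃ C : ℝ≥0, ∀ y ∈ Icc 0 Y,
      (∀ k, |k| ≤ K → LipschitzOnWith C (pressureField n κ δ k y) (pressureBox N) ∧
        ∀ x ∈ pressureBox N, ‖pressureField n κ δ k y x‖ ≤ C) ∧
      ∀ x ∈ pressureBox N, ∀ k k',
        dist (pressureField n κ δ k y x) (pressureField n κ δ k' y x) ≤ C * |k - k'| := by
  obtain ⟨C₁, h₁, b₁⟩ := exists_lipschitz_bound_pressureBox hN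
    (f := fun x => (x.2, (2 * κ + 2 + δ) - x.2 * x.2 / (n * x.1))) (by
      refine ContDiffOn.prodMk (by fun_prop) (contDiffOn_const.sub (ContDiffOn.div (by fun_prop)
        (by fun_prop) fun x hx => ?_))
      exact (mul_pos hn hx).ne')
  obtain ⟨C₂, h₂, b₂⟩ := exists_lipschitz_bound_pressureBox hN
    (f := fun x => (0, - ((1 + κ) * x.2 / x.1))) (by
      refine ContDiffOn.prodMk (by fun_prop) (ContDiffOn.neg (ContDiffOn.div (by fun_prop)
        (by fun_prop) fun x hx => ?_))
      exact (ne_of_gt hx))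
  obtain ⟨C₃, h₃, b₃⟩ := exists_lipschitz_bound_pressureBox hN
    (f := fun x => (0, - x.1 ^ (-κ))) (by
      refine ContDiffOn.prodMk (by fun_prop) (ContDiffOn.neg (ContDiffOn.rpow_const_of_ne
        (by fun_prop) fun x hx => ?_))
      exact (ne_of_gt hx))
  have key : ∀ k y : ℝ, ∀ x ∈ pressureBox N, pressureField n κ δ k y x =
      (x.2, (2 * κ + 2 + δ) - x.2 * x.2 / (n * x.1)) +
      y • ((0, - ((1 + κ) * x.2 / x.1)) : ℝ × ℝ) +
      (k * y ^ (2 * κ + δ)) • ((0, - x.1 ^ (-κ)) : ℝ × ℝ) := by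
    intro k y x hx
    have hx := pos_of_mem_pressureBox hN hx
    ext
    · simp [pressureField]
    · simp only [pressureField, Prod.snd_add, Prod.smul_snd, smul_eq_mul]
      field_simp
      ring
  set Z : ℝ := (max Y 0) ^ (2 * κ + δ)
  have hZ : 0 ≤ Z := by positivity
  refine ⟨C₁ + Y.toNNReal * C₂ + (|K| * Z).toNNReal * C₃ + Z.toNNReal * C₃, fun y hy => ?_⟩
  have hy1 : |y| ≤ Y.toNNReal := by
    rw [abs_of_nonneg hy.1]; exact hy.2.trans (Real.le_coe_toNNReal _)
  have hy0 : 0 ≤ y ^ (2 * κ + δ) := rpow_nonneg hy.1 _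
  have hy2 : y ^ (2 * κ + δ) ≤ Z := rpow_le_rpow hy.1 (hy.2.trans (le_max_left _ _)) hσ
  have hZc : (Z.toNNReal : ℝ) = Z := Real.coe_toNNReal _ hZ
  have hKc : ((|K| * Z).toNNReal : ℝ) = |K| * Z := Real.coe_toNNReal _ (by positivity)
  have hk1 : ∀ k, |k| ≤ K → |k * y ^ (2 * κ + δ)| ≤ |K| * Z := fun k hk => by
    rw [abs_mul, abs_of_nonneg hy0]
    exact mul_le_mul (hk.trans (le_abs_self _)) hy2 hy0 (abs_nonneg _)
  refine ⟨fun k hk => ⟨?_, fun x hx => ?_⟩, fun x hx k k' => ?_⟩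
  · refine LipschitzOnWith.of_dist_le_mul fun a ha b hb => ?_
    rw [key k y a ha, key k y b hb]
    refine (dist_add_add_le _ _ _ _).trans ((add_le_add_left (dist_add_add_le _ _ _ _) _).trans ?_)
    rw [dist_smul₀, dist_smul₀, Real.norm_eq_abs, Real.norm_eq_abs]
    have e1 := h₁.dist_le_mul a ha b hb
    have e2 := h₂.dist_le_mul a ha b hb
    have e3 := h₃.dist_le_mul a ha b hb
    have e2' := mul_le_mul hy1 e2 dist_nonneg (by positivity)
    have e3' := mul_le_mul (hk1 k hk) e3 dist_nonneg (by positivity)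
    push_cast
    rw [hZc, hKc]
    have : 0 ≤ Z * C₃ * dist a b := by positivity
    linarith
  · rw [key k y x hx]
    refine (norm_add_le _ _).trans ((add_le_add_left (norm_add_le _ _) _).trans ?_)
    rw [norm_smul, norm_smul, Real.norm_eq_abs, Real.norm_eq_abs]
    have e2' := mul_le_mul hy1 (b₂ x hx) (norm_nonneg _) (by positivity)
    have e3' := mul_le_mul (hk1 k hk) (b₃ x hx) (norm_nonneg _) (by positivity)
    have e1 := b₁ x hx
    push_cast
    rw [hZc, hKc]
    have : 0 ≤ Z * C₃ := by positivity
    linarith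
  · rw [key k y x hx, key k' y x hx, dist_add_left, dist_eq_norm, ← sub_smul, ← sub_mul,
      norm_smul, Real.norm_eq_abs, abs_mul, abs_of_nonneg hy0]
    have e3 := b₃ x hx
    have := mul_le_mul hy2 e3 (norm_nonneg _) hZ
    have h4 := mul_le_mul_of_nonneg_left this (abs_nonneg (k - k'))
    push_cast
    rw [hZc, hKc]
    have : 0 ≤ (C₁ + Y.toNNReal * C₂ + |K| * Z * C₃) * |k - k'| := by positivity
    linarith

/-- Continuous induction on a compact interval. -/
lemma forall_mem_Icc_of_open_of_step {S : ℝ → Prop} {a b : ℝ} (ha : S a)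
    (hopen : ∀ y ∈ Ico a b, S y → ∀ᶠ t in 𝓝[>] y, S t)
    (hstep : ∀ y ∈ Ioc a b, (∀ t ∈ Ico a y, S t) → S y) :
    ∀ y ∈ Icc a b, S y := by
  by_contra! hcon
  obtain ⟨y₁, hy₁, hS₁⟩ := hcon
  set B : Set ℝ := {t | t ∈ Icc a b ∧ ¬ S t}
  have hne : B.Nonempty := ⟨y₁, hy₁, hS₁⟩
  have hbdd : BddBelow B := ⟨a, fun t ht => ht.1.1⟩
  have hay : a ≤ sInf B := le_csInf hne fun t ht => ht.1.1
  have hyb : sInf B ≤ b := (csInf_le hbdd ⟨hy₁, hS₁⟩).trans hy₁.2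
  have hbefore : ∀ t ∈ Ico a (sInf B), S t := fun t ht => by
    by_contra h
    exact absurd (csInf_le hbdd ⟨⟨ht.1, ht.2.le.trans hyb⟩, h⟩) (not_le.2 ht.2)
  have hS : S (sInf B) := by
    rcases hay.eq_or_lt with h | h
    · rwa [← h]
    · exact hstep _ ⟨h, hyb⟩ hbefore
  rcases hyb.eq_or_lt with h | h
  · have : y₁ = sInf B := le_antisymm (by rw [h]; exact hy₁.2) (csInf_le hbdd ⟨hy₁, hS₁⟩)
    exact hS₁ (this ▸ hS)
  · obtain ⟨u, hu, hu'⟩ := mem_nhdsGT_iff_exists_Ioo_subset.1 (hopen _ ⟨hay, h⟩ hS)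
    obtain ⟨t, ht, htu⟩ := exists_lt_of_csInf_lt hne (show sInf B < u from hu)
    rcases (csInf_le hbdd ht).eq_or_lt with h' | h'
    · exact ht.2 (h' ▸ hS)
    · exact ht.2 (hu' ⟨h', htu⟩)

section

variable {n κ δ k Y : ℝ}

/-- Solutions of the truncated system, with the vector field frozen outside `pressureBox N`. -/
def IsClampedSol (n κ δ N k Y : ℝ) (z : ℝ → ℝ × ℝ) : Prop :=
  z 0 = (1, 0) ∧ ∀ y ∈ Icc 0 Y,
    HasDerivWithinAt z (pressureField n κ δ k y (pressureClamp N (z y))) (Icc 0 Y) y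

lemma lipschitzOnWith_clamped {C : ℝ≥0} {N y : ℝ} (hN : 1 ≤ N)
    (h : LipschitzOnWith C (pressureField n κ δ k y) (pressureBox N)) :
    LipschitzOnWith C (fun x => pressureField n κ δ k y (pressureClamp N x)) univ := by
  have := h.comp ((lipschitzWith_pressureClamp N).lipschitzOnWith (s := univ))
    (fun x _ => pressureClamp_mem hN x)
  simpa using! this

lemma exists_isClampedSol {N : ℝ} (hn : 0 < n) (hσ : 0 ≤ 2 * κ + δ) (hN : 1 ≤ N) (k : ℝ)
    (hY : 0 ≤ Y) : ∃ z, IsClampedSol n κ δ N k Y z := by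
  obtain ⟨C, hC⟩ := exists_lipschitz_bound_pressureField (κ := κ) (δ := δ) hn hσ hN Y |k|
  have hPL : IsPicardLindelof (fun y x => pressureField n κ δ k y (pressureClamp N x))
      (tmin := 0) (tmax := Y) ⟨0, le_rfl, hY⟩ (1, 0) (C * Y.toNNReal) 0 C C := by
    refine ⟨fun t ht => ?_, fun x _ => ?_, fun t ht x _ => ?_, ?_⟩
    · exact (lipschitzOnWith_clamped hN ((hC t ht).1 k le_rfl).1).mono (subset_univ _)
    · unfold pressureField
      have : Continuous fun y : ℝ => y ^ (2 * κ + δ) := continuous_id.rpow_const fun _ => .inr hσ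
      fun_prop
    · exact ((hC t ht).1 k le_rfl).2 _ (pressureClamp_mem hN x)
    · simp [hY]
  exact hPL.exists_eq_forall_mem_Icc_hasDerivWithinAt₀

lemma HasDerivWithinAt.Ici_of_mem_Ico {E : Type*} [NormedAddCommGroup E] [NormedSpace ℝ E]
    {f : ℝ → E} {f' : E} {a b t : ℝ} (h : HasDerivWithinAt f f' (Icc a b) t) (ht : t ∈ Ico a b) :
    HasDerivWithinAt f f' (Ici t) t :=
  h.mono_of_mem_nhdsWithin (mem_of_superset (Icc_mem_nhdsGE ht.2) (Icc_subset_Icc_left ht.1))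

lemma IsClampedSol.mono {N Y' : ℝ} {z : ℝ → ℝ × ℝ} (h : IsClampedSol n κ δ N k Y z)
    (hY : Y' ≤ Y) : IsClampedSol n κ δ N k Y' z :=
  ⟨h.1, fun y hy => (h.2 y ⟨hy.1, hy.2.trans hY⟩).mono (Icc_subset_Icc_right hY)⟩

lemma IsPressureSol.mono {Y' : ℝ} {z : ℝ → ℝ × ℝ} (h : IsPressureSol n κ δ k Y z)
    (hY : Y' ≤ Y) : IsPressureSol n κ δ k Y' z :=
  ⟨h.1, fun y hy => ⟨(h.2 y ⟨hy.1, hy.2.trans hY⟩).1,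
    (h.2 y ⟨hy.1, hy.2.trans hY⟩).2.mono (Icc_subset_Icc_right hY)⟩⟩

lemma IsPressureSol.continuousOn {z : ℝ → ℝ × ℝ} (h : IsPressureSol n κ δ k Y z) :
    ContinuousOn z (Icc 0 Y) := fun y hy => (h.2 y hy).2.continuousWithinAt

lemma IsClampedSol.continuousOn {N : ℝ} {z : ℝ → ℝ × ℝ} (h : IsClampedSol n κ δ N k Y z) :
    ContinuousOn z (Icc 0 Y) := fun y hy => (h.2 y hy).continuousWithinAt

lemma IsClampedSol.isPressureSol {N : ℝ} {z : ℝ → ℝ × ℝ} (h : IsClampedSol n κ δ N k Y z)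
    (hN : 1 ≤ N) (hz : ∀ y ∈ Icc 0 Y, z y ∈ pressureBox N) : IsPressureSol n κ δ k Y z :=
  ⟨h.1, fun y hy => ⟨pos_of_mem_pressureBox hN (hz y hy), by
    have := h.2 y hy
    rwa [pressureClamp_of_mem (hz y hy)] at this⟩⟩

lemma IsPressureSol.isClampedSol {N : ℝ} {z : ℝ → ℝ × ℝ} (h : IsPressureSol n κ δ k Y z)
    (hz : ∀ y ∈ Icc 0 Y, z y ∈ pressureBox N) : IsClampedSol n κ δ N k Y z :=
  ⟨h.1, fun y hy => by
    have := (h.2 y hy).2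
    rwa [pressureClamp_of_mem (hz y hy)]⟩

lemma IsClampedSol.dist_le {N : ℝ} (hn : 0 < n) (hσ : 0 ≤ 2 * κ + δ) (hN : 1 ≤ N)
    (k Y : ℝ) : ∃ C : ℝ≥0, ∀ k' z z', IsClampedSol n κ δ N k Y z →
      IsClampedSol n κ δ N k' Y z' → ∀ y ∈ Icc 0 Y, dist (z y) (z' y) ≤ C * |k - k'| := by
  obtain ⟨C, hC⟩ := exists_lipschitz_bound_pressureField (κ := κ) (δ := δ) hn hσ hN Y |k|
  refine ⟨C * (gronwallBound 0 C 1 Y).toNNReal, fun k' z z' hz hz' y hy => ?_⟩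
  have := dist_le_of_approx_trajectories_ODE_of_mem (δ := 0) (εf := 0) (εg := C * |k - k'|)
    (s := fun _ => univ) (f := z) (g := z')
    (fun t ht => lipschitzOnWith_clamped hN ((hC t (Ico_subset_Icc_self ht)).1 k le_rfl).1)
    hz.continuousOn (fun t ht => (hz.2 t (Ico_subset_Icc_self ht)).Ici_of_mem_Ico ht)
    (fun t ht => by simp) (fun _ _ => trivial)
    hz'.continuousOn (fun t ht => (hz'.2 t (Ico_subset_Icc_self ht)).Ici_of_mem_Ico ht)
    (fun t ht => by
      rw [dist_comm]
      exact (hC t (Ico_subset_Icc_self ht)).2 _ (pressureClamp_mem hN _) k k')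
    (fun _ _ => trivial) (by rw [hz.1, hz'.1, dist_self]) y hy
  have hlin : ∀ ε x : ℝ, gronwallBound 0 C ε x = ε * gronwallBound 0 C 1 x := by
    intro ε x
    unfold gronwallBound
    split_ifs <;> ring
  rw [hlin, zero_add, sub_zero] at this
  have hmono : gronwallBound 0 C 1 y ≤ gronwallBound 0 C 1 Y :=
    gronwallBound_mono le_rfl zero_le_one C.2 hy.2
  calc _ ≤ _ := this
    _ ≤ C * |k - k'| * (gronwallBound 0 C 1 Y).toNNReal := by
      gcongr
      exact hmono.trans (Real.le_coe_toNNReal _)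
    _ = _ := by push_cast; ring

lemma IsPressureSol.exists_box {x : ℝ → ℝ × ℝ} (h : IsPressureSol n κ δ k Y x) :
    ∃ N, 1 ≤ N ∧ ∀ y ∈ Icc 0 Y, x y ∈ pressureOpenBox N := by
  have h1 : ContinuousOn (fun y => (x y).1) (Icc 0 Y) := h.continuousOn.fst
  obtain ⟨C₁, hC₁⟩ := isCompact_Icc.exists_bound_of_continuousOn h.continuousOn
  obtain ⟨C₂, hC₂⟩ := isCompact_Icc.exists_bound_of_continuousOn
    (h1.inv₀ fun y hy => (h.2 y hy).1.ne')
  set N := |C₁| + |C₂| + 1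
  have hN : 1 ≤ N := by have := abs_nonneg C₁; have := abs_nonneg C₂; linarith
  refine ⟨N, hN, fun y hy => ?_⟩
  have hp := (h.2 y hy).1
  have e1 : ‖x y‖ < N := by
    have := hC₁ y hy; have := abs_nonneg C₂; have := le_abs_self C₁; linarith
  have e2 : ((x y).1)⁻¹ < N := by
    have := hC₂ y hy; have := abs_nonneg C₁; have := le_abs_self C₂
    have := le_abs_self ((x y).1)⁻¹
    simp only [Pi.inv_apply, Real.norm_eq_abs] at *
    linarith
  have e3 := abs_lt.1 ((norm_fst_le (x y)).trans_lt e1)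
  have e4 := abs_lt.1 ((norm_snd_le (x y)).trans_lt e1)
  exact ⟨⟨inv_lt_of_inv_lt₀ hp e2, e3.2⟩, e4.1, e4.2⟩

lemma IsClampedSol.eqOn {N : ℝ} (hn : 0 < n) (hσ : 0 ≤ 2 * κ + δ) (hN : 1 ≤ N)
    {z z' : ℝ → ℝ × ℝ} (h : IsClampedSol n κ δ N k Y z) (h' : IsClampedSol n κ δ N k Y z') :
    EqOn z z' (Icc 0 Y) := by
  obtain ⟨C, hC⟩ := IsClampedSol.dist_le hn hσ hN k Y
  intro y hy
  have := hC k z z' h h' y hy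
  simpa using this

lemma pressureOpenBox_mono {N N' : ℝ} (hN : 1 ≤ N) (h : N ≤ N') :
    pressureOpenBox N ⊆ pressureOpenBox N' :=
  prod_mono (Ioo_subset_Ioo (inv_anti₀ (by linarith) h) h) (Ioo_subset_Ioo (by linarith) h)

lemma IsPressureSol.eqOn (hn : 0 < n) (hσ : 0 ≤ 2 * κ + δ)
    {x x' : ℝ → ℝ × ℝ} (h : IsPressureSol n κ δ k Y x) (h' : IsPressureSol n κ δ k Y x') :
    EqOn x x' (Icc 0 Y) := by
  obtain ⟨N, hN, hb⟩ := h.exists_box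
  obtain ⟨N', hN', hb'⟩ := h'.exists_box
  refine IsClampedSol.eqOn hn hσ (hN.trans (le_max_left N N'))
    (h.isClampedSol fun y hy => ?_) (h'.isClampedSol fun y hy => ?_)
  · exact pressureOpenBox_subset _ (pressureOpenBox_mono hN (le_max_left _ _) (hb y hy))
  · exact pressureOpenBox_subset _ (pressureOpenBox_mono hN' (le_max_right _ _) (hb' y hy))

/-- A priori bounds imply existence. -/
lemma exists_isPressureSol_of_bounds {N : ℝ} (hn : 0 < n) (hσ : 0 ≤ 2 * κ + δ) (hN : 1 < N)
    (hY : 0 ≤ Y) (hb : ∀ Y' ∈ Icc 0 Y, ∀ x, IsPressureSol n κ δ k Y' x →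
      x Y' ∈ pressureOpenBox N) : ∃ x, IsPressureSol n κ δ k Y x := by
  obtain ⟨z, hz⟩ := exists_isClampedSol (κ := κ) (δ := δ) hn hσ hN.le k hY
  refine ⟨z, hz.isPressureSol hN.le fun y hy => pressureOpenBox_subset _ ?_⟩
  refine forall_mem_Icc_of_open_of_step (S := fun y => z y ∈ pressureOpenBox N) ?_ ?_ ?_ y hy
  · rw [hz.1]
    exact ⟨⟨inv_lt_one_of_one_lt₀ hN, hN⟩, by constructor <;> simp <;> linarith⟩
  · intro y hy hS
    have := (hz.2 y (Ico_subset_Icc_self hy)).Ici_of_mem_Ico hy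
    exact (this.continuousWithinAt.mono Ioi_subset_Ici_self).eventually
      ((isOpen_pressureOpenBox N).mem_nhds hS)
  · intro y hy hS
    refine hb y ⟨hy.1.le, hy.2⟩ z ((hz.mono hy.2).isPressureSol hN.le ?_)
    have hcl : IsClosed (Icc 0 y ∩ z ⁻¹' pressureBox N) :=
      (hz.mono hy.2).continuousOn.preimage_isClosed_of_isClosed isClosed_Icc
        (isClosed_pressureBox N)
    have hsub : Ico 0 y ⊆ Icc 0 y ∩ z ⁻¹' pressureBox N := fun t ht =>
      ⟨Ico_subset_Icc_self ht, pressureOpenBox_subset _ (hS t ht)⟩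
    have := hcl.closure_subset_iff.2 hsub
    rw [closure_Ico hy.1.ne] at this
    exact fun t ht => (this ht).2

lemma IsPressureSol.exists_extension (hn : 0 < n) (hσ : 0 ≤ 2 * κ + δ) (hY : 0 < Y)
    {x : ℝ → ℝ × ℝ} (h : IsPressureSol n κ δ k Y x) :
    ∃ Y' > Y, ∃ x', IsPressureSol n κ δ k Y' x' := by
  obtain ⟨N, hN, hb⟩ := h.exists_box
  obtain ⟨z, hz⟩ := exists_isClampedSol (κ := κ) (δ := δ) hn hσ hN k (Y := Y + 1) (by linarith)
  have heq := IsClampedSol.eqOn hn hσ hN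
    (h.isClampedSol fun y hy => pressureOpenBox_subset _ (hb y hy)) (hz.mono (by linarith))
  have hzY : z Y ∈ pressureOpenBox N := heq ⟨hY.le, le_rfl⟩ ▸ hb Y ⟨hY.le, le_rfl⟩
  have hc : ContinuousAt z Y :=
    hz.continuousOn.continuousAt (Icc_mem_nhds hY (by linarith))
  have hev : ∀ᶠ y in 𝓝[>] Y, z y ∈ pressureOpenBox N :=
    (hc.eventually ((isOpen_pressureOpenBox N).mem_nhds hzY)).filter_mono nhdsWithin_le_nhds
  obtain ⟨u, hu, hu'⟩ := mem_nhdsGT_iff_exists_Ioc_subset.1 hev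
  have hu : Y < u := hu
  refine ⟨min u (Y + 1), lt_min hu (by linarith), z,
    (hz.mono (min_le_right _ _)).isPressureSol hN fun y hy => pressureOpenBox_subset _ ?_⟩
  rcases le_or_gt y Y with h1 | h1
  · exact heq ⟨hy.1, h1⟩ ▸ hb y ⟨hy.1, h1⟩
  · exact hu' ⟨h1, hy.2.trans (min_le_left _ _)⟩

/-- Continuous dependence on the parameter `k`. -/
lemma IsPressureSol.eventually_nhds (hn : 0 < n) (hσ : 0 ≤ 2 * κ + δ) (hY : 0 ≤ Y)
    {x : ℝ → ℝ × ℝ} (h : IsPressureSol n κ δ k Y x) {p : ℝ → ℝ × ℝ → Prop}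
    (hp : ∀ᶠ q in 𝓝 (k, x Y), p q.1 q.2) :
    ∀ᶠ k' in 𝓝 k, ∃ x', IsPressureSol n κ δ k' Y x' ∧ p k' (x' Y) := by
  obtain ⟨N, hN, hb⟩ := h.exists_box
  have hcomp : IsCompact (x '' Icc 0 Y) := isCompact_Icc.image_of_continuousOn h.continuousOn
  obtain ⟨e, he, hsub⟩ := hcomp.exists_thickening_subset_open (isOpen_pressureOpenBox N)
    (image_subset_iff.2 hb)
  obtain ⟨r, hr, hball⟩ := Metric.eventually_nhds_iff_ball.1 hp
  obtain ⟨C, hC⟩ := IsClampedSol.dist_le hn hσ hN k Y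
  have ht : Tendsto (fun k' => C * |k - k'|) (𝓝 k) (𝓝 0) := by
    have : Continuous fun k' => C * |k - k'| := by fun_prop
    simpa using this.tendsto k
  filter_upwards [ht.eventually_lt_const (lt_min he hr), Metric.ball_mem_nhds k hr] with k' hk' hkr
  obtain ⟨z, hz⟩ := exists_isClampedSol (κ := κ) (δ := δ) hn hσ hN k' hY
  have hd := hC k' x z (h.isClampedSol fun y hy => pressureOpenBox_subset _ (hb y hy)) hz
  have hk1 := hk'.trans_le (min_le_left _ _)
  have hk2 := hk'.trans_le (min_le_right _ _)
  refine ⟨z, hz.isPressureSol hN fun y hy => pressureOpenBox_subset _ (hsub ?_), ?_⟩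
  · exact Metric.mem_thickening_iff.2 ⟨x y, mem_image_of_mem _ hy, by
      rw [dist_comm]; exact (hd y hy).trans_lt hk1⟩
  · refine hball (k', z Y) ?_
    rw [← ball_prod_same]
    exact ⟨hkr, by rw [Metric.mem_ball, dist_comm]; exact (hd Y ⟨hY, le_rfl⟩).trans_lt hk2⟩

end

lemma HasDerivWithinAt.nonneg_of_forall_Ico_le {φ : ℝ → ℝ} {d a y Y : ℝ}
    (h : HasDerivWithinAt φ d (Icc 0 Y) y) (ha : 0 ≤ a) (hay : a < y) (hy : y ≤ Y)
    (hφ : ∀ t ∈ Ico a y, φ t ≤ φ y) : 0 ≤ d := by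
  have h' : HasDerivWithinAt φ d (Ico a y) y :=
    h.mono fun t ht => ⟨ha.trans ht.1, ht.2.le.trans hy⟩
  rw [hasDerivWithinAt_iff_tendsto_slope' (fun h => lt_irrefl _ h.2)] at h'
  have : (𝓝[Ico a y] y).NeBot := by rw [nhdsWithin_Ico_eq_nhdsLT hay]; infer_instance
  refine ge_of_tendsto h' (eventually_nhdsWithin_of_forall fun t ht => ?_)
  rw [slope_def_field]
  exact div_nonneg_of_nonpos (by linarith [hφ t ht]) (by linarith [ht.2])

lemma HasDerivWithinAt.nonpos_of_forall_Ioc_le {φ : ℝ → ℝ} {d b y Y : ℝ}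
    (h : HasDerivWithinAt φ d (Icc 0 Y) y) (hy : 0 ≤ y) (hyb : y < b) (hb : b ≤ Y)
    (hφ : ∀ t ∈ Ioc y b, φ t ≤ φ y) : d ≤ 0 := by
  have h' : HasDerivWithinAt φ d (Ioc y b) y :=
    h.mono fun t ht => ⟨hy.trans ht.1.le, ht.2.trans hb⟩
  rw [hasDerivWithinAt_iff_tendsto_slope' (fun h => lt_irrefl _ h.1)] at h'
  have : (𝓝[Ioc y b] y).NeBot := by rw [nhdsWithin_Ioc_eq_nhdsGT hyb]; infer_instance
  refine le_of_tendsto h' (eventually_nhdsWithin_of_forall fun t ht => ?_)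
  rw [slope_def_field]
  exact div_nonpos_of_nonpos_of_nonneg (by linarith [hφ t ht]) (by linarith [ht.1])

/-- The last zero of a continuous function that becomes negative. -/
lemma exists_last_zero {φ : ℝ → ℝ} {y : ℝ} (hy : 0 ≤ y) (hc : ContinuousOn φ (Icc 0 y))
    (h0 : 0 ≤ φ 0) (hneg : φ y < 0) :
    ∃ y₀ ∈ Ico 0 y, φ y₀ = 0 ∧ ∀ t ∈ Ioc y₀ y, φ t < 0 := by
  have hcl : IsClosed (Icc 0 y ∩ φ ⁻¹' Ici 0) :=
    hc.preimage_isClosed_of_isClosed isClosed_Icc isClosed_Ici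
  set B := Icc 0 y ∩ φ ⁻¹' Ici 0
  have hbdd : BddAbove B := ⟨y, fun t ht => ht.1.2⟩
  have hmem : sSup B ∈ B := hcl.csSup_mem ⟨0, ⟨le_rfl, hy⟩, h0⟩ hbdd
  have hlt : sSup B < y := lt_of_le_of_ne hmem.1.2 fun h => by
    have : 0 ≤ φ (sSup B) := hmem.2
    rw [h] at this; linarith
  have hafter : ∀ t ∈ Ioc (sSup B) y, φ t < 0 := fun t ht => by
    by_contra! h
    exact absurd (le_csSup hbdd (show t ∈ B from ⟨⟨hmem.1.1.trans ht.1.le, ht.2⟩, h⟩))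
      (not_le.2 ht.1)
  refine ⟨sSup B, ⟨hmem.1.1, hlt⟩, le_antisymm ?_ hmem.2, hafter⟩
  have hcw : ContinuousWithinAt φ (Ioc (sSup B) y) (sSup B) :=
    (hc _ hmem.1).mono fun t ht => ⟨hmem.1.1.trans ht.1.le, ht.2⟩
  have : (𝓝[Ioc (sSup B) y] sSup B).NeBot := by
    rw [nhdsWithin_Ioc_eq_nhdsGT hlt]; infer_instance
  exact le_of_tendsto hcw (eventually_nhdsWithin_of_forall fun t ht => (hafter t ht).le)

/-- The reaction term in the equation for the pressure. -/
noncomputable def pressureReaction (κ δ k y P : ℝ) : ℝ := k * y ^ (2 * κ + δ) * P ^ (-κ)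

/-- The reaction term multiplied by `P / y ^ 2`. -/
noncomputable def scaledReaction (κ δ k y P : ℝ) : ℝ := k * y ^ (2 * κ + δ - 2) * P ^ (1 - κ)

section

variable {n κ δ k Y : ℝ} {x : ℝ → ℝ × ℝ}

lemma pressureReaction_mul {y P : ℝ} (hy : 0 < y) (hP : 0 < P) :
    pressureReaction κ δ k y P * P = scaledReaction κ δ k y P * y ^ 2 := by
  unfold pressureReaction scaledReaction
  rw [rpow_sub hy, sub_eq_add_neg 1 κ, rpow_add hP, rpow_one, rpow_two]
  field_simp

lemma pressureReaction_lt {a b P P' : ℝ} (hκ : 0 < κ) (hδ : 0 < δ) (hk : 0 < k) (ha : 0 ≤ a)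
    (hab : a < b) (hP' : 0 < P') (hPP : P' ≤ P) :
    pressureReaction κ δ k a P < pressureReaction κ δ k b P' := by
  unfold pressureReaction
  have h1 : a ^ (2 * κ + δ) < b ^ (2 * κ + δ) := rpow_lt_rpow ha hab (by positivity)
  have h2 : P ^ (-κ) ≤ P' ^ (-κ) := rpow_le_rpow_of_nonpos hP' hPP (by linarith)
  have h3 : 0 < P ^ (-κ) := rpow_pos_of_pos (hP'.trans_le hPP) _
  have h4 : 0 ≤ a ^ (2 * κ + δ) := rpow_nonneg ha _
  have h5 : 0 ≤ k * b ^ (2 * κ + δ) := mul_nonneg hk.le (h4.trans h1.le)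
  calc k * a ^ (2 * κ + δ) * P ^ (-κ) < k * b ^ (2 * κ + δ) * P ^ (-κ) := by gcongr
    _ ≤ _ := by gcongr

lemma scaledReaction_le {a b P P' : ℝ} (hκ : κ < 1) (hδ : δ < 2 * (1 - κ)) (hk : 0 < k)
    (ha : 0 < a) (hab : a ≤ b) (hP' : 0 < P') (hPP : P' ≤ P) :
    scaledReaction κ δ k b P' ≤ scaledReaction κ δ k a P := by
  unfold scaledReaction
  have h1 : b ^ (2 * κ + δ - 2) ≤ a ^ (2 * κ + δ - 2) :=
    rpow_le_rpow_of_nonpos ha hab (by linarith)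
  have h2 : P' ^ (1 - κ) ≤ P ^ (1 - κ) := rpow_le_rpow hP'.le hPP (by linarith)
  have : 0 < b := ha.trans_le hab
  gcongr

namespace IsPressureSol

lemma hasDerivWithinAt_fst (h : IsPressureSol n κ δ k Y x) {y : ℝ} (hy : y ∈ Icc 0 Y) :
    HasDerivWithinAt (fun t => (x t).1) (x y).2 (Icc 0 Y) y := (h.2 y hy).2.fst

lemma hasDerivWithinAt_snd (h : IsPressureSol n κ δ k Y x) {y : ℝ} (hy : y ∈ Icc 0 Y) :
    HasDerivWithinAt (fun t => (x t).2) ((2 * κ + 2 + δ)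
      - (x y).2 * (n * (1 + κ) * y + (x y).2) / (n * (x y).1)
      - pressureReaction κ δ k y (x y).1) (Icc 0 Y) y := (h.2 y hy).2.snd

lemma hasDerivAt_fst (h : IsPressureSol n κ δ k Y x) {y : ℝ} (hy : y ∈ Ioo 0 Y) :
    HasDerivAt (fun t => (x t).1) (x y).2 y :=
  (h.hasDerivWithinAt_fst (Ioo_subset_Icc_self hy)).hasDerivAt (Icc_mem_nhds hy.1 hy.2)

lemma hasDerivAt_snd (h : IsPressureSol n κ δ k Y x) {y : ℝ} (hy : y ∈ Ioo 0 Y) :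
    HasDerivAt (fun t => (x t).2) ((2 * κ + 2 + δ)
      - (x y).2 * (n * (1 + κ) * y + (x y).2) / (n * (x y).1)
      - pressureReaction κ δ k y (x y).1) y :=
  (h.hasDerivWithinAt_snd (Ioo_subset_Icc_self hy)).hasDerivAt (Icc_mem_nhds hy.1 hy.2)

lemma fst_le_of_snd_nonpos (h : IsPressureSol n κ δ k Y x) {a b : ℝ} (ha : 0 ≤ a) (hab : a ≤ b)
    (hb : b ≤ Y) (hv : ∀ t ∈ Ioo a b, (x t).2 ≤ 0) : (x b).1 ≤ (x a).1 := by
  have hsub : Icc a b ⊆ Icc 0 Y := Icc_subset_Icc ha hb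
  refine antitoneOn_of_deriv_nonpos (convex_Icc a b) (h.continuousOn.fst.mono hsub) ?_ ?_
    (left_mem_Icc.2 hab) (right_mem_Icc.2 hab) hab
  · rw [interior_Icc]
    exact fun t ht => (h.hasDerivAt_fst ⟨ha.trans_lt ht.1, ht.2.trans_le hb⟩
      ).differentiableAt.differentiableWithinAt
  · rw [interior_Icc]
    exact fun t ht => by
      rw [(h.hasDerivAt_fst ⟨ha.trans_lt ht.1, ht.2.trans_le hb⟩).deriv]; exact hv t ht

lemma hasDerivWithinAt_tilt (h : IsPressureSol n κ δ k Y x) {y : ℝ} (hy : y ∈ Icc 0 Y) (θ : ℝ) :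
    HasDerivWithinAt (fun t => (x t).2 + θ * t) ((2 * κ + 2 + δ)
      - (x y).2 * (n * (1 + κ) * y + (x y).2) / (n * (x y).1)
      - pressureReaction κ δ k y (x y).1 + θ) (Icc 0 Y) y := by
  simpa using! (h.hasDerivWithinAt_snd hy).add ((hasDerivWithinAt_id y _).const_mul θ)

lemma continuousOn_tilt (h : IsPressureSol n κ δ k Y x) (θ : ℝ) :
    ContinuousOn (fun t => (x t).2 + θ * t) (Icc 0 Y) :=
  h.continuousOn.snd.add (by fun_prop)

/-- Where `v + θ y` vanishes, for `θ = 0` or `θ = n (1 + κ)`, its derivative is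
`α + θ - pressureReaction`. -/
lemma hasDerivWithinAt_tilt_of_eq_zero (h : IsPressureSol n κ δ k Y x) {y θ : ℝ}
    (hθ : θ * (n * (1 + κ) - θ) = 0) (hy : y ∈ Icc 0 Y) (h0 : (x y).2 + θ * y = 0) :
    HasDerivWithinAt (fun t => (x t).2 + θ * t) ((2 * κ + 2 + δ) + θ
      - pressureReaction κ δ k y (x y).1) (Icc 0 Y) y := by
  convert h.hasDerivWithinAt_tilt hy θ using 1
  have hv : (x y).2 = - θ * y := by linarith
  have : (x y).2 * (n * (1 + κ) * y + (x y).2) = 0 := by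
    rw [hv]; linear_combination (-y ^ 2) * hθ
  rw [this]; ring

lemma lt_pressureReaction (hκ : 0 < κ) (hδ : 0 < δ) (hk : 0 < k)
    (h : IsPressureSol n κ δ k Y x) {θ : ℝ} (hθ0 : 0 ≤ θ) (hθ : θ * (n * (1 + κ) - θ) = 0)
    {y : ℝ} (hy : y ∈ Icc 0 Y) (hneg : (x y).2 + θ * y < 0) :
    (2 * κ + 2 + δ) + θ < pressureReaction κ δ k y (x y).1 := by
  obtain ⟨y₀, hy₀, hz, hlt⟩ := exists_last_zero (φ := fun t => (x t).2 + θ * t) hy.1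
    ((h.continuousOn_tilt θ).mono (Icc_subset_Icc_right hy.2)) (by simp [h.1]) hneg
  have hy₀' : y₀ ∈ Icc 0 Y := ⟨hy₀.1, hy₀.2.le.trans hy.2⟩
  have hd := (h.hasDerivWithinAt_tilt_of_eq_zero hθ hy₀' hz).nonpos_of_forall_Ioc_le
    hy₀.1 hy₀.2 hy.2 fun t ht => by rw [hz]; exact (hlt t ht).le
  have hP := h.fst_le_of_snd_nonpos hy₀.1 hy₀.2.le hy.2 fun t ht => by
    have h1 := hlt t (Ioo_subset_Ioc_self ht)
    have h2 : 0 ≤ θ * t := mul_nonneg hθ0 (hy₀.1.trans ht.1.le)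
    linarith
  have := pressureReaction_lt hκ hδ hk hy₀.1 hy₀.2 (h.2 y hy).1 hP
  linarith

lemma tilt_neg_of_le (hκ : 0 < κ) (hδ : 0 < δ) (hk : 0 < k)
    (h : IsPressureSol n κ δ k Y x) {θ : ℝ} (hθ0 : 0 ≤ θ) (hθ : θ * (n * (1 + κ) - θ) = 0)
    {y₁ : ℝ} (hy₁ : 0 ≤ y₁) (hneg : (x y₁).2 + θ * y₁ < 0) :
    ∀ y ∈ Icc y₁ Y, (x y).2 + θ * y < 0 := by
  have hc := h.continuousOn_tilt θ
  refine forall_mem_Icc_of_open_of_step (S := fun y => (x y).2 + θ * y < 0) hneg ?_ ?_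
  · intro y hy hS
    have hd := (h.hasDerivWithinAt_tilt ⟨hy₁.trans hy.1, hy.2.le⟩ θ).Ici_of_mem_Ico
      ⟨hy₁.trans hy.1, hy.2⟩
    exact (hd.continuousWithinAt.mono Ioi_subset_Ici_self).eventually_lt_const hS
  · intro y hy hS
    have hy' : y ∈ Icc 0 Y := ⟨hy₁.trans hy.1.le, hy.2⟩
    by_contra! hge
    have hle : (x y).2 + θ * y ≤ 0 := by
      have : (𝓝[Ico y₁ y] y).NeBot := by rw [nhdsWithin_Ico_eq_nhdsLT hy.1]; infer_instance
      exact le_of_tendsto ((hc y hy').mono fun t ht => ⟨hy₁.trans ht.1, ht.2.le.trans hy.2⟩)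
        (eventually_nhdsWithin_of_forall fun t ht => (hS t ht).le)
    have hz := le_antisymm hle hge
    have hd := (h.hasDerivWithinAt_tilt_of_eq_zero hθ hy' hz).nonneg_of_forall_Ico_le
      hy₁ hy.1 hy.2 fun t ht => by rw [hz]; exact (hS t ht).le
    have hr := h.lt_pressureReaction hκ hδ hk hθ0 hθ ⟨hy₁, hy.1.le.trans hy.2⟩ hneg
    have hP := h.fst_le_of_snd_nonpos hy₁ hy.1.le hy.2 fun t ht => by
      have h1 := hS t (Ioo_subset_Ico_self ht)
      have h2 : 0 ≤ θ * t := mul_nonneg hθ0 (hy₁.trans ht.1.le)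
      linarith
    have := pressureReaction_lt hκ hδ hk hy₁ hy.1 (h.2 y hy').1 hP
    linarith

lemma snd_neg_of_le (hκ : 0 < κ) (hδ : 0 < δ) (hk : 0 < k)
    (h : IsPressureSol n κ δ k Y x) {y₁ : ℝ} (hy₁ : 0 ≤ y₁) (hneg : (x y₁).2 < 0) :
    ∀ y ∈ Icc y₁ Y, (x y).2 < 0 := by
  have := h.tilt_neg_of_le hκ hδ hk (θ := 0) le_rfl (by ring) hy₁ (by simpa using hneg)
  simpa using this

lemma snd_le (hn : 0 < n) (hκ : 0 < κ) (hδ : 0 < δ) (hk : 0 < k)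
    (h : IsPressureSol n κ δ k Y x) {y : ℝ} (hy : y ∈ Icc 0 Y) :
    (x y).2 ≤ (2 * κ + 2 + δ) * y := by
  by_contra! hcon
  obtain ⟨y₀, hy₀, hz, hlt⟩ := exists_last_zero
    (φ := fun t => - ((x t).2 + (-(2 * κ + 2 + δ)) * t)) hy.1
    ((h.continuousOn_tilt _).neg.mono (Icc_subset_Icc_right hy.2)) (by simp [h.1])
    (by linarith)
  have hsub : Icc y₀ y ⊆ Icc 0 Y := Icc_subset_Icc hy₀.1 hy.2
  have := antitoneOn_of_deriv_nonpos (convex_Icc y₀ y)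
    ((h.continuousOn_tilt (-(2 * κ + 2 + δ))).mono hsub) ?_ ?_
    (left_mem_Icc.2 hy₀.2.le) (right_mem_Icc.2 hy₀.2.le) hy₀.2.le
  · have h1 := hlt y ⟨hy₀.2, le_rfl⟩
    linarith
  · rw [interior_Icc]
    exact fun t ht => ((h.hasDerivWithinAt_tilt (hsub (Ioo_subset_Icc_self ht)) _).hasDerivAt
      (Icc_mem_nhds (hy₀.1.trans_lt ht.1) (ht.2.trans_le hy.2))
      ).differentiableAt.differentiableWithinAt
  · rw [interior_Icc]
    intro t ht
    have ht' := hsub (Ioo_subset_Icc_self ht)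
    have ht0 : 0 < t := hy₀.1.trans_lt ht.1
    rw [((h.hasDerivWithinAt_tilt ht' _).hasDerivAt
      (Icc_mem_nhds ht0 (ht.2.trans_le hy.2))).deriv]
    have h1 := hlt t (Ioo_subset_Ioc_self ht)
    have h2 : 0 < (2 * κ + 2 + δ) * t := by positivity
    have h3 : 0 < (x t).2 := by linarith
    have hP := (h.2 t ht').1
    have h4 : 0 ≤ (x t).2 * (n * (1 + κ) * t + (x t).2) / (n * (x t).1) := by positivity
    have h5 : 0 ≤ pressureReaction κ δ k t (x t).1 := by unfold pressureReaction; positivity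
    linarith

lemma le_fst_of_le_snd (h : IsPressureSol n κ δ k Y x) {a b c : ℝ} (ha : 0 ≤ a) (hab : a ≤ b)
    (hb : b ≤ Y) (hv : ∀ t ∈ Ioo a b, c ≤ (x t).2) : (x a).1 + c * (b - a) ≤ (x b).1 := by
  have hsub : Icc a b ⊆ Icc 0 Y := Icc_subset_Icc ha hb
  have := (convex_Icc a b).mul_sub_le_image_sub_of_le_deriv (h.continuousOn.fst.mono hsub)
    (by
      rw [interior_Icc]
      exact fun t ht => (h.hasDerivAt_fst ⟨ha.trans_lt ht.1, ht.2.trans_le hb⟩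
        ).differentiableAt.differentiableWithinAt) (C := c) (by
      rw [interior_Icc]
      exact fun t ht => by
        rw [(h.hasDerivAt_fst ⟨ha.trans_lt ht.1, ht.2.trans_le hb⟩).deriv]; exact hv t ht)
    a (left_mem_Icc.2 hab) b (right_mem_Icc.2 hab) hab
  linarith

lemma fst_le_of_snd_le (h : IsPressureSol n κ δ k Y x) {a b c : ℝ} (ha : 0 ≤ a) (hab : a ≤ b)
    (hb : b ≤ Y) (hv : ∀ t ∈ Ioo a b, (x t).2 ≤ c) : (x b).1 ≤ (x a).1 + c * (b - a) := by
  have hsub : Icc a b ⊆ Icc 0 Y := Icc_subset_Icc ha hb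
  have := (convex_Icc a b).image_sub_le_mul_sub_of_deriv_le (h.continuousOn.fst.mono hsub)
    (by
      rw [interior_Icc]
      exact fun t ht => (h.hasDerivAt_fst ⟨ha.trans_lt ht.1, ht.2.trans_le hb⟩
        ).differentiableAt.differentiableWithinAt) (C := c) (by
      rw [interior_Icc]
      exact fun t ht => by
        rw [(h.hasDerivAt_fst ⟨ha.trans_lt ht.1, ht.2.trans_le hb⟩).deriv]; exact hv t ht)
    a (left_mem_Icc.2 hab) b (right_mem_Icc.2 hab) hab
  linarith

lemma fst_le (hn : 0 < n) (hκ : 0 < κ) (hδ : 0 < δ) (hk : 0 < k)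
    (h : IsPressureSol n κ δ k Y x) {y : ℝ} (hy : y ∈ Icc 0 Y) :
    (x y).1 ≤ 1 + (2 * κ + 2 + δ) * y ^ 2 := by
  have := h.fst_le_of_snd_le le_rfl hy.1 hy.2 (c := (2 * κ + 2 + δ) * y) fun t ht =>
    (h.snd_le hn hκ hδ hk ⟨ht.1.le, ht.2.le.trans hy.2⟩).trans (by have := ht.2; gcongr)
  rw [h.1] at this
  simp only at this
  linarith

end IsPressureSol

/-- The trapping region of solutions for which diffusion becomes negligible. -/
def IsTrapped (n κ δ k y : ℝ) (q : ℝ × ℝ) : Prop :=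
  0 < q.2 + n * (1 + κ) / 2 * y ∧ q.2 < 0 ∧ scaledReaction κ δ k y q.1 < n * (1 + κ) ^ 2 / 4

lemma IsPressureSol.isTrapped_of_le (hn : 0 < n) (hκ : 0 < κ) (hκ1 : κ < 1) (hδ : 0 < δ)
    (hδ1 : δ < 2 * (1 - κ)) (hk : 0 < k) (h : IsPressureSol n κ δ k Y x) {y₁ : ℝ} (hy₁ : 0 < y₁)
    (hQ : IsTrapped n κ δ k y₁ (x y₁)) : ∀ y ∈ Icc y₁ Y, IsTrapped n κ δ k y (x y) := by
  have hv := h.snd_neg_of_le hκ hδ hk hy₁.le hQ.2.1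
  have hJ : ∀ y ∈ Icc y₁ Y, scaledReaction κ δ k y (x y).1 < n * (1 + κ) ^ 2 / 4 := fun y hy =>
    (scaledReaction_le hκ1 hδ1 hk hy₁ hy.1 (h.2 y ⟨hy₁.le.trans hy.1, hy.2⟩).1
      (h.fst_le_of_snd_nonpos hy₁.le hy.1 hy.2 fun t ht =>
        (hv t ⟨ht.1.le, ht.2.le.trans hy.2⟩).le)).trans_lt hQ.2.2
  suffices ∀ y ∈ Icc y₁ Y, 0 < (x y).2 + n * (1 + κ) / 2 * y from
    fun y hy => ⟨this y hy, hv y hy, hJ y hy⟩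
  set θ := n * (1 + κ) / 2 with hθ
  refine forall_mem_Icc_of_open_of_step (S := fun y => 0 < (x y).2 + θ * y) hQ.1 ?_ ?_
  · intro y hy hS
    have hd := (h.hasDerivWithinAt_tilt ⟨hy₁.le.trans hy.1, hy.2.le⟩ θ).Ici_of_mem_Ico
      ⟨hy₁.le.trans hy.1, hy.2⟩
    exact (hd.continuousWithinAt.mono Ioi_subset_Ici_self).eventually_const_lt hS
  · intro y hy hS
    have hy' : y ∈ Icc 0 Y := ⟨hy₁.le.trans hy.1.le, hy.2⟩
    have hy0 : 0 < y := hy₁.trans hy.1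
    by_contra! hle
    have hge : 0 ≤ (x y).2 + θ * y := by
      have : (𝓝[Ico y₁ y] y).NeBot := by rw [nhdsWithin_Ico_eq_nhdsLT hy.1]; infer_instance
      exact ge_of_tendsto ((h.continuousOn_tilt θ y hy').mono
        fun t ht => ⟨hy₁.le.trans ht.1, ht.2.le.trans hy.2⟩)
        (eventually_nhdsWithin_of_forall fun t ht => (hS t ht).le)
    have hz := le_antisymm hle hge
    have hd := (h.hasDerivWithinAt_tilt hy' θ).fun_neg.nonneg_of_forall_Ico_le
      hy₁.le hy.1 hy.2 fun t ht => by have := hS t ht; rw [hz]; linarith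
    have hP := (h.2 y hy').1
    have hr := pressureReaction_mul (κ := κ) (δ := δ) (k := k) hy0 hP
    have hJy := hJ y ⟨hy.1.le, hy.2⟩
    have hveq : (x y).2 = - θ * y := by linarith
    have e1 : (x y).2 * (n * (1 + κ) * y + (x y).2) / (n * (x y).1)
        = - (n * (1 + κ) ^ 2 / 4 * y ^ 2 / (x y).1) := by
      rw [hveq, hθ]; field_simp; ring
    have e2 : pressureReaction κ δ k y (x y).1
        < n * (1 + κ) ^ 2 / 4 * y ^ 2 / (x y).1 := by
      rw [lt_div_iff₀ hP, hr]; gcongr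
    rw [e1] at hd
    have : 0 < θ := by positivity
    linarith

end

section

variable {n κ δ k Y : ℝ} {x : ℝ → ℝ × ℝ}

lemma exists_isPressureSol_of_lower_bounds {c M : ℝ} (hn : 0 < n) (hκ : 0 < κ) (hδ : 0 < δ)
    (hk : 0 < k) (hc : 0 < c) (hY : 0 ≤ Y) (hb : ∀ Y' ∈ Icc 0 Y, ∀ x,
      IsPressureSol n κ δ k Y' x → c ≤ (x Y').1 ∧ -M ≤ (x Y').2) :
    ∃ x, IsPressureSol n κ δ k Y x := by
  set N := c⁻¹ + |M| + (2 * κ + 2 + δ) * Y + (2 * κ + 2 + δ) * Y ^ 2 + 2 with hN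
  have h1 : 0 < c⁻¹ := inv_pos.2 hc
  have h2 : 0 ≤ |M| := abs_nonneg M
  have h3 : 0 ≤ (2 * κ + 2 + δ) * Y := by positivity
  have h4 : 0 ≤ (2 * κ + 2 + δ) * Y ^ 2 := by positivity
  refine exists_isPressureSol_of_bounds (N := N) hn (by positivity) (by linarith) hY
    fun Y' hY' x h => ?_
  obtain ⟨hP, hv⟩ := hb Y' hY' x h
  have hv' := h.snd_le hn hκ hδ hk (right_mem_Icc.2 hY'.1)
  have hP' := h.fst_le hn hκ hδ hk (right_mem_Icc.2 hY'.1)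
  have h5 : (2 * κ + 2 + δ) * Y' ≤ (2 * κ + 2 + δ) * Y := by have := hY'.2; gcongr
  have h6 : (2 * κ + 2 + δ) * Y' ^ 2 ≤ (2 * κ + 2 + δ) * Y ^ 2 := by
    have := hY'.1; have := hY'.2; gcongr
  have h7 := le_abs_self M
  refine ⟨⟨lt_of_lt_of_le ?_ hP, by linarith⟩, by linarith, by linarith⟩
  exact inv_lt_of_inv_lt₀ hc (by linarith)

lemma pressureReaction_eq_exp {y P : ℝ} (hy : 0 < y) (hP : 0 < P) :
    pressureReaction κ δ k y P = k * exp (δ * log y - κ * (log P - 2 * log y)) := by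
  unfold pressureReaction
  rw [rpow_def_of_pos hy, rpow_def_of_pos hP, mul_assoc, ← exp_add]
  ring_nf

namespace IsPressureSol

lemma energy_le {c : ℝ} (hn : 0 < n) (h : IsPressureSol n κ δ k Y x)
    (hv : ∀ t ∈ Icc 1 Y, 0 ≤ (x t).2)
    (hH : ∀ t ∈ Icc 1 Y, c ≤ pressureReaction κ δ k t (x t).1) {y : ℝ} (hy : y ∈ Icc 1 Y) :
    (x y).2 / y + (1 + κ) * (log (x y).1 - 2 * log y)
      ≤ (x 1).2 + (1 + κ) * log (x 1).1 + (δ - c) * log y := by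
  have hsub : Icc 1 Y ⊆ Icc 0 Y := Icc_subset_Icc_left zero_le_one
  have hd : ∀ t ∈ Icc 1 Y, HasDerivWithinAt (fun t => (x t).2 / t +
      (1 + κ) * (log (x t).1 - 2 * log t) - (δ - c) * log t)
      ((c - pressureReaction κ δ k t (x t).1) / t - (x t).2 ^ 2 / (n * (x t).1 * t)
        - (x t).2 / t ^ 2) (Icc 0 Y) t := fun t ht => by
    have ht0 : 0 < t := zero_lt_one.trans_le ht.1
    have hP := (h.2 t (hsub ht)).1
    have h1 := (h.hasDerivWithinAt_snd (hsub ht)).div (hasDerivWithinAt_id t _) ht0.ne'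
    have h2 := (h.hasDerivWithinAt_fst (hsub ht)).log hP.ne'
    have h3 := (hasDerivAt_log ht0.ne').hasDerivWithinAt (s := Icc 0 Y)
    refine ((h1.add ((h2.sub (h3.const_mul 2)).const_mul (1 + κ))).sub
      (h3.const_mul (δ - c))).congr_deriv ?_
    simp only [id]
    field_simp
    ring
  have := antitoneOn_of_deriv_nonpos (convex_Icc 1 Y)
    (fun t ht => (hd t ht).continuousWithinAt.mono hsub) ?_ ?_
    (left_mem_Icc.2 (hy.1.trans hy.2)) hy hy.1
  · simp at this
    linarith
  · rw [interior_Icc]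
    exact fun t ht => ((hd t (Ioo_subset_Icc_self ht)).hasDerivAt
      (Icc_mem_nhds (zero_lt_one.trans ht.1) ht.2)).differentiableAt.differentiableWithinAt
  · rw [interior_Icc]
    intro t ht
    have ht' := Ioo_subset_Icc_self ht
    have ht0 : 0 < t := zero_lt_one.trans ht.1
    rw [((hd t ht').hasDerivAt (Icc_mem_nhds ht0 ht.2)).deriv]
    have hP := (h.2 t (hsub ht')).1
    have h1 : 0 ≤ (x t).2 ^ 2 / (n * (x t).1 * t) := by positivity
    have h2 : 0 ≤ (x t).2 / t ^ 2 := div_nonneg (hv t ht') (by positivity)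
    have h3 : (c - pressureReaction κ δ k t (x t).1) / t ≤ 0 :=
      div_nonpos_of_nonpos_of_nonneg (by linarith [hH t ht']) ht0.le
    linarith

end IsPressureSol

/-- If `δ` is small, the pressure stops increasing before a time that depends only on a lower
bound for `k`. -/
lemma exists_uniform_snd_neg {k₁ : ℝ} (hn : 0 < n) (hκ : 0 < κ) (hκ1 : κ < 1) (hk₁ : 0 < k₁) :
    ∃ Y₁ ≥ 1, ∃ δ₁ > 0, ∀ δ, 0 < δ → δ ≤ δ₁ → δ < 2 * (1 - κ) → ∀ k ≥ k₁, ∀ x,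
      IsPressureSol n κ δ k Y₁ x → ∃ y ∈ Icc 0 Y₁, (x y).2 < 0 := by
  set C := 4 + 2 * log 5 with hC
  have hlog5 : 0 < log 5 := log_pos (by norm_num)
  set η := k₁ * exp (-C) / 2 with hη
  have hη0 : 0 < η := by positivity
  set M := (1 + κ) / κ * |log (5 / k₁)| with hM
  have hM0 : 0 ≤ M := by positivity
  set Ya := exp ((C + M) / η) with hYa
  have hYa1 : 1 ≤ Ya := one_le_exp (by positivity)
  refine ⟨5 * Ya + 1, by linarith, η, hη0, fun δ hδ hδη hδκ k hk x h => ?_⟩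
  have hk0 : 0 < k := hk₁.trans_le hk
  by_contra! hv
  have hv1 : ∀ t ∈ Icc 1 (5 * Ya + 1), 0 ≤ (x t).2 := fun t ht => hv t ⟨by linarith [ht.1], ht.2⟩
  have hpos : ∀ t ∈ Icc 1 (5 * Ya + 1), 0 < (x t).1 := fun t ht =>
    (h.2 t ⟨by linarith [ht.1], ht.2⟩).1
  have hinit : (x 1).2 + (1 + κ) * log (x 1).1 ≤ C := by
    have hm : (1:ℝ) ∈ Icc 0 (5 * Ya + 1) := ⟨by norm_num, by linarith⟩
    have h1 := h.snd_le hn hκ hδ hk0 hm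
    have h2 := h.fst_le hn hκ hδ hk0 hm
    have h3 : log (x 1).1 ≤ log 5 := log_le_log (h.2 1 hm).1 (by linarith)
    have h4 : (1 + κ) * log (x 1).1 ≤ (1 + κ) * log 5 := by gcongr
    have h5 : (1 + κ) * log 5 ≤ 2 * log 5 := by gcongr; linarith
    linarith
  have hreact : ∀ t ∈ Icc 1 (5 * Ya + 1), ∀ R : ℝ,
      κ * (log (x t).1 - 2 * log t) ≤ δ * log t + R →
      k₁ * exp (-R) ≤ pressureReaction κ δ k t (x t).1 := fun t ht R hR => by
    rw [pressureReaction_eq_exp (zero_lt_one.trans_le ht.1) (hpos t ht)]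
    have : exp (-R) ≤ exp (δ * log t - κ * (log (x t).1 - 2 * log t)) :=
      exp_le_exp.2 (by linarith)
    gcongr
  have hdiv : ∀ t ∈ Icc 1 (5 * Ya + 1), 0 ≤ (x t).2 / t := fun t ht =>
    div_nonneg (hv1 t ht) (by linarith [ht.1])
  have hH1 : ∀ t ∈ Icc 1 (5 * Ya + 1), 2 * η ≤ pressureReaction κ δ k t (x t).1 := by
    intro t ht
    have he := h.energy_le (c := 0) hn hv1 (fun s hs => by
      have := hpos s hs
      have : 0 < s := zero_lt_one.trans_le hs.1
      unfold pressureReaction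
      positivity) ht
    have hl : 0 ≤ log t := log_nonneg ht.1
    have hd := hdiv t ht
    have h1 : (1 + κ) * (log (x t).1 - 2 * log t) ≤ C + δ * log t := by linarith
    have h2 : 0 ≤ C + δ * log t := by positivity
    have := hreact t ht C (by nlinarith)
    rw [hη]; linarith
  have hH2 : ∀ t ∈ Icc Ya (5 * Ya + 1), 5 ≤ pressureReaction κ δ k t (x t).1 := by
    intro t ht
    have ht1 : t ∈ Icc 1 (5 * Ya + 1) := ⟨hYa1.trans ht.1, ht.2⟩
    have he := h.energy_le hn hv1 hH1 ht1
    have hd := hdiv t ht1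
    have hl : (C + M) / η ≤ log t := (le_log_iff_exp_le (by linarith [ht1.1])).2 ht.1
    have hl' : C + M ≤ η * log t := by rwa [div_le_iff₀' hη0] at hl
    have hl0 : 0 ≤ log t := log_nonneg ht1.1
    have h1 : (1 + κ) * (log (x t).1 - 2 * log t) ≤ -M := by nlinarith
    have h2 : κ * (log (x t).1 - 2 * log t) ≤ -|log (5 / k₁)| := by
      have h3 : log (x t).1 - 2 * log t ≤ -M / (1 + κ) := by
        rw [le_div_iff₀ (by positivity)]; linarith
      have h4 : κ * (-M / (1 + κ)) = -|log (5 / k₁)| := by rw [hM]; field_simp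
      rw [← h4]
      gcongr
    have h5 := hreact t ht1 (-log (5 / k₁)) (by
      have := le_abs_self (log (5 / k₁))
      have : 0 ≤ δ * log t := by positivity
      linarith)
    rw [neg_neg, exp_log (by positivity)] at h5
    calc (5:ℝ) = k₁ * (5 / k₁) := by field_simp
      _ ≤ _ := h5
  have hsub : Icc Ya (5 * Ya + 1) ⊆ Icc 0 (5 * Ya + 1) := Icc_subset_Icc_left (by linarith)
  have hfin := (convex_Icc Ya (5 * Ya + 1)).image_sub_le_mul_sub_of_deriv_le
    (h.continuousOn.snd.mono hsub) (C := -1) (by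
      rw [interior_Icc]
      exact fun t ht => (h.hasDerivAt_snd ⟨by linarith [ht.1], ht.2⟩
        ).differentiableAt.differentiableWithinAt) (by
      rw [interior_Icc]
      intro t ht
      have ht0 : 0 < t := by linarith [ht.1]
      rw [(h.hasDerivAt_snd ⟨ht0, ht.2⟩).deriv]
      have ht' := Ioo_subset_Icc_self ht
      have h1 := hH2 t ht'
      have h2 := hv t (hsub ht')
      have h3 := (h.2 t (hsub ht')).1
      have : 0 ≤ (x t).2 * (n * (1 + κ) * t + (x t).2) / (n * (x t).1) := by positivity
      linarith) Ya (left_mem_Icc.2 (by linarith)) (5 * Ya + 1) (right_mem_Icc.2 (by linarith))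
    (by linarith)
  have h1 := hv (5 * Ya + 1) (right_mem_Icc.2 (by linarith))
  have h2 := h.snd_le hn hκ hδ hk0 (y := Ya) ⟨by linarith, by linarith⟩
  nlinarith

/-- The pressure starts to decrease before the time `Y`. -/
def DecreasesBefore (n κ δ k Y : ℝ) : Prop :=
  ∃ y ∈ Ioc 0 Y, ∃ x, IsPressureSol n κ δ k y x ∧ (x y).2 < 0

lemma decreasesBefore_of_forall {Y₁ : ℝ} (hn : 0 < n) (hκ : 0 < κ) (hδ : 0 < δ) (hk : 0 < k)
    (hY₁ : 0 ≤ Y₁) (h : ∀ x, IsPressureSol n κ δ k Y₁ x → ∃ y ∈ Icc 0 Y₁, (x y).2 < 0) :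
    DecreasesBefore n κ δ k Y₁ := by
  have hcase : ∀ Y' ∈ Icc 0 Y₁, ∀ x, IsPressureSol n κ δ k Y' x → ∀ y ∈ Icc 0 Y', (x y).2 < 0 →
      DecreasesBefore n κ δ k Y₁ := fun Y' hY' x hx y hy hneg => by
    refine ⟨y, ⟨lt_of_le_of_ne hy.1 ?_, hy.2.trans hY'.2⟩, x, hx.mono hy.2, hneg⟩
    rintro rfl
    simp [hx.1] at hneg
  by_contra hcon
  have hv : ∀ Y' ∈ Icc 0 Y₁, ∀ x, IsPressureSol n κ δ k Y' x → ∀ y ∈ Icc 0 Y', 0 ≤ (x y).2 :=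
    fun Y' hY' x hx y hy => by
      by_contra! hneg
      exact hcon (hcase Y' hY' x hx y hy hneg)
  obtain ⟨x, hx⟩ := exists_isPressureSol_of_lower_bounds (c := 1) (M := 0) hn hκ hδ hk one_pos hY₁
    fun Y' hY' x hx => by
      refine ⟨?_, by simpa using hv Y' hY' x hx Y' (right_mem_Icc.2 hY'.1)⟩
      have := hx.le_fst_of_le_snd le_rfl hY'.1 le_rfl (c := 0)
        fun t ht => hv Y' hY' x hx t (Ioo_subset_Icc_self ht)
      simpa [hx.1] using this
  obtain ⟨y, hy, hneg⟩ := h x hx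
  exact hcon (hcase Y₁ (right_mem_Icc.2 hY₁) x hx y hy hneg)

end

/-- The solution crosses the line `v = -n (1 + κ) y`. -/
def Crosses (n κ δ k : ℝ) : Prop :=
  ∃ Y > 0, ∃ x, IsPressureSol n κ δ k Y x ∧ (x Y).2 + n * (1 + κ) * Y < 0

/-- The solution enters the trapping region. -/
def GetsTrapped (n κ δ k : ℝ) : Prop :=
  ∃ Y > 0, ∃ x, IsPressureSol n κ δ k Y x ∧ IsTrapped n κ δ k Y (x Y)

section

variable {n κ δ k Y : ℝ} {x : ℝ → ℝ × ℝ}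

lemma isOpen_crosses (hn : 0 < n) (hκ : 0 < κ) (hδ : 0 < δ) : IsOpen {k | Crosses n κ δ k} := by
  refine isOpen_iff_mem_nhds.2 fun k ⟨Y, hY, x, hx, hlt⟩ => ?_
  have hev : ∀ᶠ q : ℝ × ℝ × ℝ in 𝓝 (k, x Y), q.2.2 + n * (1 + κ) * Y < 0 :=
    (ContinuousAt.tendsto (f := fun q : ℝ × ℝ × ℝ => q.2.2 + n * (1 + κ) * Y)
      (by fun_prop)).eventually_lt_const hlt
  filter_upwards [hx.eventually_nhds hn (by positivity) hY.le
    (p := fun _ q => q.2 + n * (1 + κ) * Y < 0) hev] with k' ⟨x', hx', h'⟩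
  exact ⟨Y, hY, x', hx', h'⟩

lemma isOpen_getsTrapped (hn : 0 < n) (hκ : 0 < κ) (hδ : 0 < δ) :
    IsOpen {k | GetsTrapped n κ δ k} := by
  refine isOpen_iff_mem_nhds.2 fun k ⟨Y, hY, x, hx, hlt⟩ => ?_
  have hP := (hx.2 Y (right_mem_Icc.2 hY.le)).1
  have hev : ∀ᶠ q : ℝ × ℝ × ℝ in 𝓝 (k, x Y), IsTrapped n κ δ q.1 Y q.2 := by
    refine Filter.Eventually.and ?_ (Filter.Eventually.and ?_ ?_)
    · exact (ContinuousAt.tendsto (f := fun q : ℝ × ℝ × ℝ => q.2.2 + n * (1 + κ) / 2 * Y)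
        (by fun_prop)).eventually_const_lt hlt.1
    · exact (ContinuousAt.tendsto (f := fun q : ℝ × ℝ × ℝ => q.2.2)
        (by fun_prop)).eventually_lt_const hlt.2.1
    · refine (ContinuousAt.tendsto (f := fun q : ℝ × ℝ × ℝ => scaledReaction κ δ q.1 Y q.2.1)
        ?_).eventually_lt_const hlt.2.2
      unfold scaledReaction
      refine ContinuousAt.mul (by fun_prop) (ContinuousAt.rpow_const (by fun_prop) (Or.inl ?_))
      exact hP.ne'
  filter_upwards [hx.eventually_nhds hn (by positivity) hY.le
    (p := fun k' q => IsTrapped n κ δ k' Y q) hev] with k' ⟨x', hx', h'⟩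
  exact ⟨Y, hY, x', hx', h'⟩

lemma Crosses.not_getsTrapped (hn : 0 < n) (hκ : 0 < κ) (hκ1 : κ < 1) (hδ : 0 < δ)
    (hδ1 : δ < 2 * (1 - κ)) (hk : 0 < k) (h : Crosses n κ δ k) : ¬ GetsTrapped n κ δ k := by
  rintro ⟨Y', hY', x', hx', htr⟩
  obtain ⟨Y, hY, x, hx, hcr⟩ := h
  have hθ : n * (1 + κ) * (n * (1 + κ) - n * (1 + κ)) = 0 := by ring
  have hβ : 0 < n * (1 + κ) := by positivity
  have key : ∀ T > 0, ∀ q : ℝ × ℝ, q.2 + n * (1 + κ) * T < 0 → ¬ IsTrapped n κ δ k T q := by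
    rintro T hT q h1 ⟨h2, -⟩
    have : 0 < n * (1 + κ) * T := by positivity
    linarith
  rcases le_total Y Y' with hle | hle
  · have heq : x Y = x' Y := hx.eqOn hn (by positivity) (hx'.mono hle) (right_mem_Icc.2 hY.le)
    rw [heq] at hcr
    exact key Y' hY' _ (hx'.tilt_neg_of_le hκ hδ hk hβ.le hθ hY.le hcr Y' ⟨hle, le_rfl⟩) htr
  · have heq : x' Y' = x Y' := hx'.eqOn hn (by positivity) (hx.mono hle) (right_mem_Icc.2 hY'.le)
    rw [heq] at htr
    exact key Y hY _ hcr (hx.isTrapped_of_le hn hκ hκ1 hδ hδ1 hk hY' htr Y ⟨hle, le_rfl⟩)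

/-- A solution that decreases early enough, for `k` and `δ` small, gets trapped. -/
lemma DecreasesBefore.getsTrapped (hn : 0 < n) (hκ : 0 < κ) (hκ1 : κ < 1) (hδ : 0 < δ)
    (hk : 0 < k) (h : DecreasesBefore n κ δ k Y)
    (hkY : (k * Y ^ δ) ^ κ⁻¹ < n * (1 + κ) ^ 2 / 4) : GetsTrapped n κ δ k := by
  obtain ⟨Y', ⟨hY', hYY⟩, x, hx, hneg⟩ := h
  obtain ⟨y₀, hy₀, hz, hlt⟩ := exists_last_zero (φ := fun t => (x t).2) hY'.le
    hx.continuousOn.snd (by simp [hx.1]) hneg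
  have hy₀pos : 0 < y₀ := by
    refine lt_of_le_of_ne hy₀.1 fun h0 => ?_
    subst h0
    have hm : (0:ℝ) ∈ Icc 0 Y' := left_mem_Icc.2 hY'.le
    have hd := (hx.hasDerivWithinAt_snd hm).nonpos_of_forall_Ioc_le le_rfl hY' le_rfl
      fun t ht => by rw [hz]; exact (hlt t ht).le
    have h0 : pressureReaction κ δ k 0 (x 0).1 = 0 := by
      unfold pressureReaction
      rw [zero_rpow (by positivity)]; ring
    rw [h0, hx.1] at hd
    simp at hd
    linarith
  have hy₀' : y₀ ∈ Icc 0 Y' := Ico_subset_Icc_self hy₀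
  have hev : ∀ᶠ t in 𝓝[>] y₀, 0 < (x t).2 + n * (1 + κ) / 2 * t := by
    have hc := (hx.hasDerivWithinAt_tilt hy₀' (n * (1 + κ) / 2)).Ici_of_mem_Ico hy₀
    refine (hc.continuousWithinAt.mono Ioi_subset_Ici_self).eventually_const_lt ?_
    simp only [hz]; positivity
  obtain ⟨y, hy, hyv⟩ := (Filter.Eventually.and (Ioo_mem_nhdsGT hy₀.2) hev).exists
  have hy0 : 0 < y := hy₀pos.trans hy.1
  have hym : y ∈ Icc 0 Y' := ⟨hy0.le, hy.2.le⟩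
  have hv := hlt y (Ioo_subset_Ioc_self hy)
  refine ⟨y, hy0, x, hx.mono hy.2.le, hyv, hv, lt_of_le_of_lt ?_ hkY⟩
  have hP := (hx.2 y hym).1
  have hH := hx.lt_pressureReaction hκ hδ hk (θ := 0) le_rfl (by ring) hym (by simpa using hv)
  have hP1 : (x y).1 ^ κ ≤ k * y ^ (2 * κ + δ) := by
    unfold pressureReaction at hH
    rw [rpow_neg hP.le, ← div_eq_mul_inv, lt_div_iff₀ (by positivity)] at hH
    have : 0 < (x y).1 ^ κ := by positivity
    nlinarith
  set W := (k * y ^ δ) ^ κ⁻¹ with hW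
  have hWκ : W ^ κ = k * y ^ δ := rpow_inv_rpow (by positivity) hκ.ne'
  have hW0 : 0 < W := by positivity
  have hP2 : (x y).1 ≤ W * y ^ 2 := by
    rw [← rpow_le_rpow_iff hP.le (by positivity) hκ, mul_rpow hW0.le (by positivity), hWκ,
      ← rpow_natCast_mul hy0.le, mul_assoc, ← rpow_add hy0]
    convert hP1 using 3
    push_cast; ring
  have hJ : scaledReaction κ δ k y (x y).1 ≤ W := by
    unfold scaledReaction
    calc k * y ^ (2 * κ + δ - 2) * (x y).1 ^ (1 - κ)
        ≤ k * y ^ (2 * κ + δ - 2) * (W * y ^ 2) ^ (1 - κ) := by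
          have : 0 ≤ 1 - κ := by linarith
          gcongr
      _ = (k * y ^ δ) * (W ^ κ)⁻¹ * W := by
          rw [mul_rpow hW0.le (by positivity), ← rpow_natCast_mul hy0.le, sub_eq_add_neg 1 κ,
            rpow_add hW0, rpow_one, rpow_neg hW0.le,
            show δ = (2 * κ + δ - 2) + ((2 : ℕ) : ℝ) * (1 + -κ) by push_cast; ring,
            rpow_add hy0]
          ring_nf
      _ = W := by rw [hWκ, mul_inv_cancel₀ (by positivity), one_mul]
  refine hJ.trans ?_
  have hyY : y ≤ Y := hy.2.le.trans hYY
  rw [hW]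
  gcongr
end

section

variable {n κ δ k Y : ℝ} {x : ℝ → ℝ × ℝ}

lemma exists_forall_crosses (hn : 0 < n) (hκ : 0 < κ) (hδ : 0 < δ) :
    ∃ K > 0, ∀ k ≥ K, Crosses n κ δ k := by
  set β := n * (1 + κ) with hβ
  have hβ0 : 0 < β := by positivity
  set y₀ := min 1 (1 / (2 * β)) with hy₀
  have hy₀0 : 0 < y₀ := lt_min one_pos (by positivity)
  have hy₀1 : y₀ ≤ 1 := min_le_left _ _
  have hβy : β * y₀ ≤ 1 / 2 := by
    have : y₀ ≤ 1 / (2 * β) := min_le_right _ _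
    rw [le_div_iff₀ (by positivity)] at this
    linarith
  set α := 2 * κ + 2 + δ with hα
  have hα0 : 0 < α := by positivity
  set c := pressureReaction κ δ 1 (y₀ / 2) (1 + α) with hc
  have hc0 : 0 < c := by rw [hc]; unfold pressureReaction; positivity
  set C := 2 * α + β ^ 2 / (2 * n) + 2 * β + 1 with hC
  have hC0 : 0 < C := by positivity
  refine ⟨C / c, by positivity, fun k hk => ?_⟩
  have hk0 : 0 < k := lt_of_lt_of_le (by positivity) hk
  have hkc : C ≤ k * c := by rwa [ge_iff_le, div_le_iff₀ hc0] at hk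
  by_contra hcon
  have hv : ∀ Y' ∈ Icc 0 y₀, ∀ x, IsPressureSol n κ δ k Y' x →
      ∀ t ∈ Icc 0 Y', -(β * t) ≤ (x t).2 := fun Y' hY' x hx t ht => by
    rcases ht.1.eq_or_lt with rfl | h0
    · simp [hx.1]
    · by_contra! hlt
      exact hcon ⟨t, h0, x, hx.mono ht.2, by linarith⟩
  have hP : ∀ Y' ∈ Icc 0 y₀, ∀ x, IsPressureSol n κ δ k Y' x → 1 / 2 ≤ (x Y').1 :=
    fun Y' hY' x hx => by
    have := hx.le_fst_of_le_snd le_rfl hY'.1 le_rfl (c := -(1 / 2)) fun t ht => by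
      have h1 := hv Y' hY' x hx t (Ioo_subset_Icc_self ht)
      have h2 : β * t ≤ β * y₀ := by have := ht.2.le.trans hY'.2; gcongr
      linarith
    rw [hx.1] at this
    have h3 := hY'.2
    simp only at this
    linarith
  obtain ⟨x, hx⟩ := exists_isPressureSol_of_lower_bounds (c := 1 / 2) (M := 1) hn hκ hδ hk0
    (by norm_num) hy₀0.le fun Y' hY' x hx => by
      refine ⟨hP Y' hY' x hx, ?_⟩
      have h1 := hv Y' hY' x hx Y' (right_mem_Icc.2 hY'.1)
      have h2 : β * Y' ≤ β * y₀ := by have := hY'.2; gcongr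
      linarith
  have hsub : Icc (y₀ / 2) y₀ ⊆ Icc 0 y₀ := Icc_subset_Icc_left (by positivity)
  have hfin := (convex_Icc (y₀ / 2) y₀).image_sub_le_mul_sub_of_deriv_le
    (hx.continuousOn.snd.mono hsub) (C := α + β ^ 2 / (2 * n) - k * c) (by
      rw [interior_Icc]
      exact fun t ht => (hx.hasDerivAt_snd ⟨by linarith [ht.1], ht.2⟩
        ).differentiableAt.differentiableWithinAt) (by
      rw [interior_Icc]
      intro t ht
      have ht0 : 0 < t := by linarith [ht.1]
      have ht' := hsub (Ioo_subset_Icc_self ht)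
      rw [(hx.hasDerivAt_snd ⟨ht0, ht.2⟩).deriv]
      have hPt := hP t ht' x (hx.mono ht'.2)
      have hPα : (x t).1 ≤ 1 + α := by
        have h1 := hx.fst_le hn hκ hδ hk0 ht'
        have h2 : α * t ^ 2 ≤ α * 1 := by
          have : t ^ 2 ≤ 1 := pow_le_one₀ ht0.le (ht'.2.trans hy₀1)
          gcongr
        linarith
      have h1 := pressureReaction_lt hκ hδ hk0 (by positivity) ht.1
        (lt_of_lt_of_le (by norm_num) hPt) hPα
      have h2 : pressureReaction κ δ k (y₀ / 2) (1 + α) = k * c := by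
        rw [hc]; unfold pressureReaction; ring
      have h3 : -(β ^ 2 / (2 * n)) ≤ (x t).2 * (β * t + (x t).2) / (n * (x t).1) := by
        have hden : 0 < n * (x t).1 := mul_pos hn (lt_of_lt_of_le (by norm_num) hPt)
        rw [le_div_iff₀ hden]
        have h4 : β ^ 2 / 4 ≤ β ^ 2 / (2 * n) * (n * (x t).1) := by
          calc β ^ 2 / 4 = β ^ 2 / (2 * n) * (n * (1 / 2)) := by field_simp; norm_num
            _ ≤ _ := by gcongr
        have h5 : t ^ 2 ≤ 1 := pow_le_one₀ ht0.le (ht'.2.trans hy₀1)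
        nlinarith [sq_nonneg ((x t).2 + β * t / 2), sq_nonneg β]
      linarith) (y₀ / 2) (left_mem_Icc.2 (by linarith)) y₀ (right_mem_Icc.2 (by linarith))
    (by linarith)
  have h1 := hv y₀ (right_mem_Icc.2 hy₀0.le) x hx y₀ (right_mem_Icc.2 hy₀0.le)
  have h2 := hx.snd_le hn hκ hδ hk0 (y := y₀ / 2) ⟨by linarith, by linarith⟩
  have h3 : (α + β ^ 2 / (2 * n) - k * c) * (y₀ - y₀ / 2) ≤ (-(α + 2 * β + 1)) * (y₀ - y₀ / 2) :=
    mul_le_mul_of_nonneg_right (by linarith) (by linarith)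
  nlinarith

/-- For small `δ` there is a value of `k` whose solution decreases eventually, but neither
crosses nor gets trapped. -/
lemma exists_critical (hn : 0 < n) (hκ : 0 < κ) (hκ1 : κ < 1) :
    ∃ δ₀ > 0, ∀ δ, 0 < δ → δ < δ₀ → δ < 2 * (1 - κ) ∧ ∃ k > 0, ¬ Crosses n κ δ k ∧
      ¬ GetsTrapped n κ δ k ∧ ∃ Y, DecreasesBefore n κ δ k Y := by
  set b := n * (1 + κ) ^ 2 / 4 with hb
  have hb0 : 0 < b := by positivity
  set k₁ := (b / 3) ^ κ with hk₁
  have hk₁0 : 0 < k₁ := by positivity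
  obtain ⟨Y₁, hY₁, δ₁, hδ₁, hneg⟩ := exists_uniform_snd_neg hn hκ hκ1 hk₁0
  have hY₁0 : 0 < Y₁ := by linarith
  have htend : Tendsto (fun δ : ℝ => (k₁ * Y₁ ^ δ) ^ κ⁻¹) (𝓝[>] 0) (𝓝 (b / 3)) := by
    have hc : Continuous fun δ : ℝ => (k₁ * Y₁ ^ δ) ^ κ⁻¹ :=
      ((continuous_const_rpow hY₁0.ne').const_mul k₁).rpow_const
        fun δ => Or.inr (inv_nonneg.2 hκ.le)
    have := (hc.tendsto 0).mono_left (nhdsWithin_le_nhds (s := Ioi 0))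
    rwa [rpow_zero, mul_one, hk₁, rpow_rpow_inv (by positivity) hκ.ne'] at this
  have hev : ∀ᶠ δ : ℝ in 𝓝[>] 0, (k₁ * Y₁ ^ δ) ^ κ⁻¹ < b ∧ δ < min δ₁ (2 * (1 - κ)) :=
    (htend.eventually_lt_const (by linarith)).and
      ((tendsto_id.mono_left nhdsWithin_le_nhds).eventually_lt_const
        (lt_min hδ₁ (by linarith)))
  obtain ⟨δ₀, hδ₀, hsub⟩ := mem_nhdsGT_iff_exists_Ioo_subset.1 hev
  refine ⟨δ₀, hδ₀, fun δ hδ hδδ => ?_⟩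
  obtain ⟨hsmall, hlt⟩ := hsub ⟨hδ, hδδ⟩
  have hδκ : δ < 2 * (1 - κ) := hlt.trans_le (min_le_right _ _)
  refine ⟨hδκ, ?_⟩
  have hdec : ∀ k ≥ k₁, DecreasesBefore n κ δ k Y₁ := fun k hk =>
    decreasesBefore_of_forall hn hκ hδ (hk₁0.trans_le hk) hY₁0.le
      (hneg δ hδ (hlt.le.trans (min_le_left _ _)) hδκ k hk)
  obtain ⟨K, hK, hcr⟩ := exists_forall_crosses (n := n) hn hκ hδ
  by_contra! hcon
  obtain ⟨k, hk, hk1, hk2⟩ := isPreconnected_Icc (a := k₁) (b := max k₁ K)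
    {k | Crosses n κ δ k} {k | GetsTrapped n κ δ k} (isOpen_crosses hn hκ hδ)
    (isOpen_getsTrapped hn hκ hδ)
    (fun k hk => by
      by_contra hnot
      rw [mem_union, not_or] at hnot
      exact hcon k (hk₁0.trans_le hk.1) hnot.1 hnot.2 Y₁ (hdec k hk.1))
    ⟨max k₁ K, right_mem_Icc.2 (le_max_left _ _), hcr _ (le_max_right _ _)⟩
    ⟨k₁, left_mem_Icc.2 (le_max_left _ _), (hdec k₁ le_rfl).getsTrapped hn hκ hκ1 hδ hk₁0 hsmall⟩
  exact hk1.not_getsTrapped hn hκ hκ1 hδ hδκ (hk₁0.trans_le hk.1) hk2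

end

section

variable {n κ δ k Y : ℝ} {x : ℝ → ℝ × ℝ}

lemma IsPressureSol.congr {x' : ℝ → ℝ × ℝ} (hY : 0 ≤ Y) (h : IsPressureSol n κ δ k Y x)
    (he : EqOn x' x (Icc 0 Y)) : IsPressureSol n κ δ k Y x' := by
  refine ⟨(he (left_mem_Icc.2 hY)).trans h.1, fun y hy => ?_⟩
  rw [he hy]
  exact ⟨(h.2 y hy).1, (h.2 y hy).2.congr he (he hy)⟩

lemma exists_global_representative (hn : 0 < n) (hσ : 0 ≤ 2 * κ + δ) :
    ∃ x, ∀ Y, 0 ≤ Y → (∃ x', IsPressureSol n κ δ k Y x') → IsPressureSol n κ δ k Y x := by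
  classical
  refine ⟨fun y => if h : ∃ x', IsPressureSol n κ δ k y x' then h.choose y else 0,
    fun Y hY ⟨x', hx'⟩ => hx'.congr hY fun y hy => ?_⟩
  have hex : ∃ x', IsPressureSol n κ δ k y x' := ⟨x', hx'.mono hy.2⟩
  simp only [dif_pos hex]
  exact hex.choose_spec.eqOn hn hσ (hx'.mono hy.2) (right_mem_Icc.2 hy.1)

lemma snd_le_of_not_getsTrapped (htr : ¬ GetsTrapped n κ δ k) (h : IsPressureSol n κ δ k Y x)
    {y : ℝ} (hy : y ∈ Ioc 0 Y) (hv : (x y).2 < 0)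
    (hJ : scaledReaction κ δ k y (x y).1 < n * (1 + κ) ^ 2 / 4) :
    (x y).2 ≤ -(n * (1 + κ) / 2 * y) := by
  by_contra! hlt
  exact htr ⟨y, hy.1, x, h.mono hy.2, by linarith, hv, hJ⟩

lemma neg_le_snd_of_not_crosses (hcr : ¬ Crosses n κ δ k) (h : IsPressureSol n κ δ k Y x)
    {y : ℝ} (hy : y ∈ Icc 0 Y) : 0 ≤ (x y).2 + n * (1 + κ) * y := by
  rcases hy.1.eq_or_lt with rfl | h0
  · simp [h.1]
  · by_contra! hlt
    exact hcr ⟨y, h0, x, h.mono hy.2, hlt⟩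

lemma bddAbove_of_decreasesBefore (hn : 0 < n) (hκ : 0 < κ) (hκ1 : κ < 1) (hδ : 0 < δ)
    (hδ1 : δ < 2 * (1 - κ)) (hk : 0 < k) (htr : ¬ GetsTrapped n κ δ k)
    (hdec : DecreasesBefore n κ δ k Y) :
    BddAbove {Y | 0 < Y ∧ ∃ x, IsPressureSol n κ δ k Y x} := by
  have hσ : 0 ≤ 2 * κ + δ := by positivity
  obtain ⟨y₁, hy₁, x, hx, hneg⟩ := hdec
  have hP₁ := (hx.2 y₁ (right_mem_Icc.2 hy₁.1.le)).1
  have hJ : Tendsto (fun y => scaledReaction κ δ k y (x y₁).1) atTop (𝓝 0) := by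
    have h1 := tendsto_rpow_neg_atTop (y := 2 - (2 * κ + δ)) (by linarith)
    have h2 := (h1.const_mul k).mul_const ((x y₁).1 ^ (1 - κ))
    simp only [mul_zero, zero_mul, neg_sub] at h2
    exact h2
  obtain ⟨y₂, hy₂⟩ := eventually_atTop.1
    (hJ.eventually_lt_const (u := n * (1 + κ) ^ 2 / 4) (by positivity))
  set Z := max y₁ y₂ with hZ
  have hZ0 : 0 < Z := hy₁.1.trans_le (le_max_left _ _)
  have hβ : 0 < n * (1 + κ) / 2 * Z := by positivity
  refine ⟨Z + (x y₁).1 / (n * (1 + κ) / 2 * Z), fun Y ⟨hY, x', hx'⟩ => ?_⟩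
  rcases le_total Y Z with hle | hle
  · have : 0 ≤ (x y₁).1 / (n * (1 + κ) / 2 * Z) := by positivity
    linarith
  · have hy₁Z : y₁ ≤ Z := le_max_left _ _
    have heq : x y₁ = x' y₁ := hx.eqOn hn hσ (hx'.mono (hy₁Z.trans hle)) (right_mem_Icc.2 hy₁.1.le)
    rw [heq] at hneg hP₁ hy₂ ⊢
    have hv := hx'.snd_neg_of_le hκ hδ hk hy₁.1.le hneg
    have hPle : ∀ t ∈ Icc y₁ Y, (x' t).1 ≤ (x' y₁).1 := fun t ht =>
      hx'.fst_le_of_snd_nonpos hy₁.1.le ht.1 ht.2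
        fun s hs => (hv s ⟨hs.1.le, hs.2.le.trans ht.2⟩).le
    have hslope := hx'.fst_le_of_snd_le hZ0.le hle le_rfl (c := -(n * (1 + κ) / 2 * Z))
      fun t ht => by
        have ht0 : 0 < t := hZ0.trans ht.1
        have ht1 : t ∈ Icc y₁ Y := ⟨hy₁Z.trans ht.1.le, ht.2.le⟩
        have hPt := (hx'.2 t ⟨ht0.le, ht.2.le⟩).1
        have h1 := snd_le_of_not_getsTrapped htr hx' ⟨ht0, ht.2.le⟩ (hv t ht1)
          ((scaledReaction_le hκ1 hδ1 hk ht0 le_rfl hPt (hPle t ht1)).trans_lt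
            (hy₂ t ((le_max_right _ _).trans ht.1.le)))
        have h2 : n * (1 + κ) / 2 * Z ≤ n * (1 + κ) / 2 * t := by have := ht.1.le; gcongr
        linarith
    have h1 := hPle Z ⟨hy₁Z, hle⟩
    have h2 := (hx'.2 Y (right_mem_Icc.2 hY.le)).1
    have : Y - Z ≤ (x' y₁).1 / (n * (1 + κ) / 2 * Z) := by
      rw [le_div_iff₀ hβ]; linarith
    linarith

/-- The maximal solution. -/
lemma exists_maximal (hn : 0 < n) (hκ : 0 < κ) (hκ1 : κ < 1) (hδ : 0 < δ)
    (hδ1 : δ < 2 * (1 - κ)) (hk : 0 < k) (htr : ¬ GetsTrapped n κ δ k)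
    (hdec : DecreasesBefore n κ δ k Y) :
    ∃ T x, (∀ Y ∈ Ico 0 T, IsPressureSol n κ δ k Y x) ∧ (∀ x', ¬ IsPressureSol n κ δ k T x') ∧
      ∃ y ∈ Ioo 0 T, (x y).2 < 0 := by
  have hσ : 0 ≤ 2 * κ + δ := by positivity
  have hbdd := bddAbove_of_decreasesBefore hn hκ hκ1 hδ hδ1 hk htr hdec
  obtain ⟨x, hx⟩ := exists_global_representative (k := k) hn hσ
  obtain ⟨y₁, hy₁, x₁, hx₁, hneg⟩ := hdec
  set S := {Y | 0 < Y ∧ ∃ x, IsPressureSol n κ δ k Y x} with hS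
  have hext : ∀ Y ∈ S, Y < sSup S := fun Y ⟨hY, x', hx'⟩ => by
    obtain ⟨Y', hY', hex⟩ := hx'.exists_extension hn hσ hY
    exact lt_of_lt_of_le hY' (le_csSup hbdd ⟨hY.trans hY', hex⟩)
  have hy₁S : y₁ ∈ S := ⟨hy₁.1, x₁, hx₁⟩
  have hT : 0 < sSup S := hy₁.1.trans (hext y₁ hy₁S)
  refine ⟨sSup S, x, fun Y hY => hx Y hY.1 ?_, fun x' hx' => lt_irrefl _ (hext _ ⟨hT, x', hx'⟩),
    y₁, ⟨hy₁.1, hext y₁ hy₁S⟩, ?_⟩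
  · obtain ⟨Y', ⟨-, x', hx'⟩, hlt⟩ := exists_lt_of_lt_csSup ⟨y₁, hy₁S⟩ hY.2
    exact ⟨x', hx'.mono hlt.le⟩
  · rwa [(hx y₁ hy₁.1.le ⟨x₁, hx₁⟩).eqOn hn hσ hx₁ (right_mem_Icc.2 hy₁.1.le)]

variable {T : ℝ}

lemma tendsto_fst_of_maximal (hn : 0 < n) (hκ : 0 < κ) (hδ : 0 < δ)
    (hk : 0 < k) (hcr : ¬ Crosses n κ δ k)
    (hx : ∀ Y ∈ Ico 0 T, IsPressureSol n κ δ k Y x) (hT : ∀ x', ¬ IsPressureSol n κ δ k T x')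
    {y₁ : ℝ} (hy₁ : y₁ ∈ Ioo 0 T) (hneg : (x y₁).2 < 0) :
    Tendsto (fun y => (x y).1) (𝓝[<] T) (𝓝 0) := by
  have hσ : 0 ≤ 2 * κ + δ := by positivity
  have hT0 : 0 < T := hy₁.1.trans hy₁.2
  have hanti : ∀ y ∈ Ico y₁ T, ∀ t ∈ Icc y₁ y, (x y).1 ≤ (x t).1 := fun y hy t ht => by
    have h := hx y ⟨hy₁.1.le.trans hy.1, hy.2⟩
    exact h.fst_le_of_snd_nonpos (hy₁.1.le.trans ht.1) ht.2 le_rfl fun s hs =>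
      (h.snd_neg_of_le hκ hδ hk hy₁.1.le hneg s ⟨ht.1.trans hs.1.le, hs.2.le⟩).le
  have hpos : ∀ y ∈ Ico 0 T, 0 < (x y).1 := fun y hy => ((hx y hy).2 y (right_mem_Icc.2 hy.1)).1
  have hsmall : ∀ c > 0, ∃ y ∈ Ico y₁ T, (x y).1 < c := by
    by_contra! ⟨c, hc, hlow⟩
    obtain ⟨N, hN, hbox⟩ := (hx y₁ ⟨hy₁.1.le, hy₁.2⟩).exists_box
    obtain ⟨x', hx'⟩ := exists_isPressureSol_of_lower_bounds (c := min c N⁻¹)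
      (M := n * (1 + κ) * T) hn hκ hδ hk (lt_min hc (by positivity)) hT0.le
      fun Y' hY' x' hx' => by
        rcases hY'.2.eq_or_lt with rfl | hlt
        · exact absurd hx' (hT x')
        rw [hx'.eqOn hn hσ (hx Y' ⟨hY'.1, hlt⟩) (right_mem_Icc.2 hY'.1)]
        constructor
        · rcases le_total y₁ Y' with h | h
          · exact (min_le_left _ _).trans (hlow Y' ⟨h, hlt⟩)
          · exact (min_le_right _ _).trans (hbox Y' ⟨hY'.1, h⟩).1.1.le
        · have h1 := neg_le_snd_of_not_crosses hcr (hx Y' ⟨hY'.1, hlt⟩) (right_mem_Icc.2 hY'.1)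
          have h2 : n * (1 + κ) * Y' ≤ n * (1 + κ) * T := by gcongr
          linarith
    exact hT x' hx'
  refine tendsto_order.2 ⟨fun a ha => ?_, fun a ha => ?_⟩
  · filter_upwards [Ioo_mem_nhdsLT hT0] with y hy
    exact ha.trans (hpos y ⟨hy.1.le, hy.2⟩)
  · obtain ⟨y, hy, hlt⟩ := hsmall a ha
    filter_upwards [Ioo_mem_nhdsLT hy.2] with t ht
    exact (hanti t ⟨hy.1.trans ht.1.le, ht.2⟩ y ⟨hy.1, ht.1.le⟩).trans_lt hlt

end

section

variable {n κ δ k T : ℝ} {x : ℝ → ℝ × ℝ}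

/-- Near the end point a solution that stays above the line `v = -n (1 + κ) y` cannot stay away
from it. -/
lemma tilt_lt_of_tendsto_fst {c ε y₁ : ℝ} (hn : 0 < n) (hκ : 0 < κ) (hc : 0 < c) (hε : 0 < ε)
    (hx : ∀ Y ∈ Ico 0 T, IsPressureSol n κ δ k Y x)
    (hP : Tendsto (fun y => (x y).1) (𝓝[<] T) (𝓝 0)) (hcr : ¬ Crosses n κ δ k) (hy₁ : 0 < y₁)
    (hα : 0 < 2 * κ + 2 + δ)
    (hv : ∀ y ∈ Ico y₁ T, (x y).2 ≤ 0)
    (hz : ∀ y ∈ Ico y₁ T, ε / 2 ≤ (x y).2 + n * (1 + κ) * y →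
      c ≤ -((x y).2 * (n * (1 + κ) * y + (x y).2) / n) - scaledReaction κ δ k y (x y).1 * y ^ 2)
    {y : ℝ} (hy : y ∈ Ico y₁ T) : (x y).2 + n * (1 + κ) * y < ε := by
  by_contra! hge
  set β := n * (1 + κ) with hβ
  have hβ0 : 0 < β := by positivity
  have hy0 : 0 < y := hy₁.trans_le hy.1
  have hT0 : 0 < T := hy0.trans hy.2
  have hpos : ∀ t ∈ Ico 0 T, 0 < (x t).1 := fun t ht => ((hx t ht).2 t (right_mem_Icc.2 ht.1)).1
  have hderiv : ∀ t ∈ Ioo y T, ∃ d, HasDerivAt (fun t => (x t).2 + β * t) d t ∧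
      (ε / 2 ≤ (x t).2 + β * t → c / (x t).1 ≤ d) := fun t ht => by
    have ht0 : 0 < t := hy0.trans ht.1
    obtain ⟨Y, hY⟩ := exists_between ht.2
    have h := hx Y ⟨ht0.le.trans hY.1.le, hY.2⟩
    have hPt := hpos t ⟨ht0.le, ht.2⟩
    refine ⟨_, (h.hasDerivWithinAt_tilt ⟨ht0.le, hY.1.le⟩ β).hasDerivAt
      (Icc_mem_nhds ht0 hY.1), fun hzt => ?_⟩
    have h1 := hz t ⟨hy.1.trans ht.1.le, ht.2⟩ hzt
    have h2 := pressureReaction_mul (κ := κ) (δ := δ) (k := k) ht0 hPt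
    have h3 : (x t).2 * (n * (1 + κ) * t + (x t).2) / (n * (x t).1)
        = ((x t).2 * (n * (1 + κ) * t + (x t).2) / n) / (x t).1 := by rw [div_div]
    have h4 : pressureReaction κ δ k t (x t).1
        = scaledReaction κ δ k t (x t).1 * t ^ 2 / (x t).1 := by rw [← h2]; field_simp
    rw [h3, h4]
    have h5 := div_le_div_of_nonneg_right h1 hPt.le
    rw [sub_div, neg_div] at h5
    linarith
  have hcont : ∀ Y ∈ Ico 0 T, ContinuousOn (fun t => (x t).2 + β * t) (Icc 0 Y) := fun Y hY =>
    (hx Y hY).continuousOn_tilt β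
  have hlow : ∀ Y ∈ Ico y T, ∀ t ∈ Icc y Y, ε / 2 < (x t).2 + β * t := fun Y hY => by
    have hYm : Y ∈ Ico 0 T := ⟨hy0.le.trans hY.1, hY.2⟩
    refine forall_mem_Icc_of_open_of_step (S := fun t => ε / 2 < (x t).2 + β * t)
      (by linarith) (fun t ht hS => ?_) fun t ht hS => ?_
    · have ht0 : t ∈ Ico 0 Y := ⟨hy0.le.trans ht.1, ht.2⟩
      have := ((hx Y hYm).hasDerivWithinAt_tilt (Ico_subset_Icc_self ht0) β).Ici_of_mem_Ico ht0
      exact (this.continuousWithinAt.mono Ioi_subset_Ici_self).eventually_const_lt hS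
    · have hmono := monotoneOn_of_deriv_nonneg (convex_Icc y t)
        ((hcont Y hYm).mono (Icc_subset_Icc hy0.le ht.2)) ?_ ?_
        (left_mem_Icc.2 ht.1.le) (right_mem_Icc.2 ht.1.le) ht.1.le
      · linarith
      · rw [interior_Icc]
        intro s hs
        obtain ⟨d, hd, -⟩ := hderiv s ⟨hs.1, hs.2.trans_le (ht.2.trans hY.2.le)⟩
        exact hd.differentiableAt.differentiableWithinAt
      · rw [interior_Icc]
        intro s hs
        have hsT : s < T := hs.2.trans_le (ht.2.trans hY.2.le)
        obtain ⟨d, hd, hd'⟩ := hderiv s ⟨hs.1, hsT⟩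
        rw [hd.deriv]
        have := hpos s ⟨hy0.le.trans hs.1.le, hsT⟩
        exact le_trans (by positivity) (hd' (hS s ⟨hs.1.le, hs.2⟩).le)
  set a := c / (β * T) with ha
  have ha0 : 0 < a := by positivity
  have hgrow : ∀ Y ∈ Ico y T, ((x y).2 + β * y) + a * log (x y).1
      ≤ ((x Y).2 + β * Y) + a * log (x Y).1 := fun Y hY => by
    have hYm : Y ∈ Ico 0 T := ⟨hy0.le.trans hY.1, hY.2⟩
    have hd : ∀ s ∈ Ioo y Y, ∃ d, 0 ≤ d ∧
        HasDerivAt (fun t => (x t).2 + β * t + a * log (x t).1) d s := fun s hs => by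
      have hsT : s < T := hs.2.trans hY.2
      have hs0 : 0 < s := hy0.trans hs.1
      obtain ⟨d, hd, hd'⟩ := hderiv s ⟨hs.1, hsT⟩
      have hPs := hpos s ⟨hs0.le, hsT⟩
      refine ⟨_, ?_, hd.add ((((hx Y hYm).hasDerivAt_fst ⟨hs0, hs.2⟩).log hPs.ne').const_mul a)⟩
      have h1 := hd' (hlow Y hY s (Ioo_subset_Icc_self hs)).le
      have h2 : -(β * T) ≤ (x s).2 := by
        have h3 := neg_le_snd_of_not_crosses hcr (hx Y hYm) ⟨hs0.le, hs.2.le⟩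
        have h4 : β * s ≤ β * T := by gcongr
        linarith
      have h3 : -c ≤ a * (x s).2 := by
        calc -c = a * (-(β * T)) := by rw [ha]; field_simp
          _ ≤ _ := by gcongr
      have h4 := div_le_div_of_nonneg_right h3 hPs.le
      rw [neg_div, mul_div_assoc] at h4
      linarith
    refine monotoneOn_of_deriv_nonneg (f := fun t => (x t).2 + β * t + a * log (x t).1)
      (convex_Icc y Y) ?_ ?_ ?_
      (left_mem_Icc.2 hY.1) (right_mem_Icc.2 hY.1) hY.1
    · have hsub : Icc y Y ⊆ Icc 0 Y := Icc_subset_Icc_left hy0.le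
      exact ((hcont Y hYm).mono hsub).add (continuousOn_const.mul
        (((hx Y hYm).continuousOn.fst.mono hsub).log
          fun s hs => ((hx Y hYm).2 s (hsub hs)).1.ne'))
    · rw [interior_Icc]
      intro s hs
      obtain ⟨d, -, hd'⟩ := hd s hs
      exact hd'.differentiableAt.differentiableWithinAt
    · rw [interior_Icc]
      intro s hs
      obtain ⟨d, hd0, hd'⟩ := hd s hs
      rwa [hd'.deriv]
  have hP' : Tendsto (fun t => (x t).1) (𝓝[<] T) (𝓝[>] 0) := by
    refine tendsto_nhdsWithin_iff.2 ⟨hP, ?_⟩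
    filter_upwards [Ioo_mem_nhdsLT hT0] with t ht
    exact hpos t (Ioo_subset_Ico_self ht)
  have hlog := (tendsto_log_nhdsGT_zero.comp hP').const_mul_atBot ha0
  obtain ⟨Y, hYbot, hY⟩ := ((hlog.eventually_lt_atBot
    (((x y).2 + β * y) + a * log (x y).1 - β * T)).and (Ioo_mem_nhdsLT hy.2)).exists
  have h1 := hgrow Y ⟨hY.1.le, hY.2⟩
  have h2 := hv Y ⟨hy.1.trans hY.1.le, hY.2⟩
  have h3 : β * Y ≤ β * T := by have := hY.2.le; gcongr
  simp only [Function.comp] at hYbot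
  linarith

lemma tendsto_snd_of_maximal (hn : 0 < n) (hκ : 0 < κ) (hκ1 : κ < 1) (hδ : 0 < δ)
    (hk : 0 < k) (hcr : ¬ Crosses n κ δ k) (htr : ¬ GetsTrapped n κ δ k)
    (hx : ∀ Y ∈ Ico 0 T, IsPressureSol n κ δ k Y x)
    {y₁ : ℝ} (hy₁ : y₁ ∈ Ioo 0 T) (hneg : (x y₁).2 < 0)
    (hP : Tendsto (fun y => (x y).1) (𝓝[<] T) (𝓝 0)) :
    Tendsto (fun y => (x y).2) (𝓝[<] T) (𝓝 (-(n * (1 + κ) * T))) := by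
  have hT0 : 0 < T := hy₁.1.trans hy₁.2
  set β := n * (1 + κ) with hβ
  have hβ0 : 0 < β := by positivity
  have hid : Tendsto (fun y : ℝ => y) (𝓝[<] T) (𝓝 T) := tendsto_id.mono_left nhdsWithin_le_nhds
  have hJ : Tendsto (fun y => scaledReaction κ δ k y (x y).1) (𝓝[<] T) (𝓝 0) := by
    have h1 := hid.rpow_const (p := 2 * κ + δ - 2) (Or.inl hT0.ne')
    have h2 := hP.rpow_const (p := 1 - κ) (Or.inr (by linarith))
    rw [zero_rpow (by linarith)] at h2
    simpa using! (h1.const_mul k).mul h2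
  have hJ2 : Tendsto (fun y => scaledReaction κ δ k y (x y).1 * y ^ 2) (𝓝[<] T) (𝓝 0) := by
    simpa using hJ.mul (hid.pow 2)
  have hv : ∀ y ∈ Ico y₁ T, (x y).2 < 0 := fun y hy =>
    (hx y ⟨hy₁.1.le.trans hy.1, hy.2⟩).snd_neg_of_le hκ hδ hk hy₁.1.le hneg y ⟨hy.1, le_rfl⟩
  have hzero : Tendsto (fun y => (x y).2 + β * y) (𝓝[<] T) (𝓝 0) := by
    refine tendsto_order.2 ⟨fun a ha => ?_, fun ε hε => ?_⟩
    · filter_upwards [Ioo_mem_nhdsLT hT0] with y hy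
      exact ha.trans_le (neg_le_snd_of_not_crosses hcr (hx y (Ioo_subset_Ico_self hy))
        (right_mem_Icc.2 hy.1.le))
    · set c := β * y₁ / 2 * (ε / 2) / (2 * n) with hc
      have hy₁0 := hy₁.1
      have hc0 : 0 < c := by positivity
      obtain ⟨y₂, hy₂, hsub⟩ := (mem_nhdsLT_iff_exists_Ico_subset).1
        (((hJ.eventually_lt_const (u := n * (1 + κ) ^ 2 / 4) (by positivity)).and
          (hJ2.eventually_lt_const hc0)).and (Ico_mem_nhdsLT hy₁.2))
      have hy₂T : y₂ < T := hy₂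
      have hy₂m : y₂ ∈ Ico y₁ T := (hsub ⟨le_rfl, hy₂T⟩).2
      filter_upwards [Ico_mem_nhdsLT hy₂T] with y hy
      refine tilt_lt_of_tendsto_fst hn hκ hc0 hε hx hP hcr (hy₁.1.trans_le hy₂m.1)
        (by positivity) (fun t ht => (hv t (hsub ht).2).le) (fun t ht hzt => ?_) hy
      obtain ⟨⟨hJ1, hJc⟩, ht'⟩ := hsub ht
      have ht0 : 0 < t := hy₁.1.trans_le ht'.1
      have h1 := snd_le_of_not_getsTrapped htr (hx t ⟨ht0.le, ht'.2⟩) ⟨ht0, le_rfl⟩ (hv t ht') hJ1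
      have h2 : n * (1 + κ) / 2 * y₁ ≤ n * (1 + κ) / 2 * t := by have := ht'.1; gcongr
      have h3 : β * y₁ / 2 ≤ -(x t).2 := by rw [hβ]; linarith
      have h4 : β * y₁ / 2 * (ε / 2) ≤ -(x t).2 * ((x t).2 + β * t) :=
        mul_le_mul h3 hzt (by positivity) (by linarith [hv t ht'])
      have h5 : 2 * c ≤ -((x t).2 * (n * (1 + κ) * t + (x t).2) / n) := by
        have : 2 * c = β * y₁ / 2 * (ε / 2) / n := by rw [hc]; field_simp
        rw [this, ← neg_div]
        gcongr
        linarith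
      linarith
  have := hzero.sub (hid.const_mul β)
  simpa using this

end

/-- A pressure with compact support `[0, T]` that meets the end of its support with the slope
given by Darcy's law. -/
structure IsCompactPressure (n κ δ k T : ℝ) (Q v : ℝ → ℝ) : Prop where
  pos_end : 0 < T
  continuousOn : ContinuousOn Q (Ici 0)
  pos : ∀ y ∈ Ico 0 T, 0 < Q y
  eq_zero : ∀ y, T ≤ y → Q y = 0
  hasDerivWithinAt_zero : HasDerivWithinAt Q 0 (Ici 0) 0
  hasDerivAt : ∀ y ∈ Ioo 0 T, HasDerivAt Q (v y) y
  hasDerivAt_snd : ∀ y ∈ Ioo 0 T, HasDerivAt v ((2 * κ + 2 + δ)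
    - v y * (n * (1 + κ) * y + v y) / (n * Q y) - pressureReaction κ δ k y (Q y)) y
  contDiffOn : ContDiffOn ℝ 2 Q (Ioo 0 T)
  hasDerivWithinAt_end : HasDerivWithinAt Q (-(n * (1 + κ) * T)) (Iic T) T

section

variable {n κ δ k T : ℝ} {x : ℝ → ℝ × ℝ}

lemma isCompactPressure_of_maximal (hn : 0 < n) (hT : 0 < T)
    (hx : ∀ Y ∈ Ico 0 T, IsPressureSol n κ δ k Y x)
    (hP : Tendsto (fun y => (x y).1) (𝓝[<] T) (𝓝 0))
    (hv : Tendsto (fun y => (x y).2) (𝓝[<] T) (𝓝 (-(n * (1 + κ) * T)))) :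
    IsCompactPressure n κ δ k T (fun y => if y < T then (x y).1 else 0) fun y => (x y).2 := by
  set Q : ℝ → ℝ := fun y => if y < T then (x y).1 else 0 with hQ
  have hQlt : ∀ y < T, Q y = (x y).1 := fun y hy => if_pos hy
  have hQge : ∀ y, T ≤ y → Q y = 0 := fun y hy => if_neg (not_lt.2 hy)
  have hQev : ∀ y < T, Q =ᶠ[𝓝 y] fun t => (x t).1 := fun y hy => by
    filter_upwards [Iio_mem_nhds hy] with t ht using hQlt t ht
  have hpos : ∀ y ∈ Ico 0 T, 0 < Q y := fun y hy => by
    rw [hQlt y hy.2]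
    exact ((hx y hy).2 y (right_mem_Icc.2 hy.1)).1
  have hd1 : ∀ y ∈ Ico 0 T, HasDerivWithinAt Q (x y).2 (Ici 0) y := fun y hy => by
    obtain ⟨Y, hY⟩ := exists_between hy.2
    have hm : Icc 0 Y ∈ 𝓝[Ici 0] y := inter_mem_nhdsWithin _ (Iic_mem_nhds hY.1)
    exact (((hx Y ⟨hy.1.trans hY.1.le, hY.2⟩).hasDerivWithinAt_fst ⟨hy.1, hY.1.le⟩
      ).mono_of_mem_nhdsWithin hm).congr_of_eventuallyEq
        ((hQev y hy.2).filter_mono nhdsWithin_le_nhds) (hQlt y hy.2)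
  have hd1' : ∀ y ∈ Ioo 0 T, HasDerivAt Q (x y).2 y := fun y hy =>
    (hd1 y (Ioo_subset_Ico_self hy)).hasDerivAt (Ici_mem_nhds hy.1)
  have hd2 : ∀ y ∈ Ioo 0 T, HasDerivAt (fun t => (x t).2) ((2 * κ + 2 + δ)
      - (x y).2 * (n * (1 + κ) * y + (x y).2) / (n * Q y)
      - pressureReaction κ δ k y (Q y)) y := fun y hy => by
    obtain ⟨Y, hY⟩ := exists_between hy.2
    rw [hQlt y hy.2]
    exact (hx Y ⟨hy.1.le.trans hY.1.le, hY.2⟩).hasDerivAt_snd ⟨hy.1, hY.1⟩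
  have hcQ : ContinuousOn Q (Ioo 0 T) := fun y hy =>
    (hd1' y hy).continuousAt.continuousWithinAt
  have hcv : ContinuousOn (fun t => (x t).2) (Ioo 0 T) := fun y hy =>
    (hd2 y hy).continuousAt.continuousWithinAt
  have hC1 : ContDiffOn ℝ 1 (fun t => (x t).2) (Ioo 0 T) := by
    rw [show (1 : WithTop ℕ∞) = 0 + 1 by norm_num, contDiffOn_succ_iff_deriv_of_isOpen isOpen_Ioo]
    refine ⟨fun y hy => (hd2 y hy).differentiableAt.differentiableWithinAt, by simp, ?_⟩
    rw [contDiffOn_zero]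
    refine ContinuousOn.congr ?_ fun y hy => (hd2 y hy).deriv
    unfold pressureReaction
    refine (continuousOn_const.sub ((hcv.mul ((continuousOn_const.mul continuousOn_id).add
      hcv)).div (continuousOn_const.mul hcQ) fun y hy =>
        (mul_pos hn (hpos y (Ioo_subset_Ico_self hy))).ne')).sub
      ((continuousOn_const.mul (continuousOn_id.rpow_const fun y hy => Or.inl hy.1.ne')).mul
        (hcQ.rpow_const fun y hy => Or.inl (hpos y (Ioo_subset_Ico_self hy)).ne'))
  have hleft : Tendsto Q (𝓝[<] T) (𝓝 (Q T)) := by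
    rw [hQge T le_rfl]
    refine hP.congr' ?_
    filter_upwards [self_mem_nhdsWithin] with y hy using (hQlt y hy).symm
  refine ⟨hT, fun y hy => ?_, hpos, hQge, ?_, hd1', hd2, ?_, ?_⟩
  · rcases lt_trichotomy y T with h | rfl | h
    · exact (hd1 y ⟨hy, h⟩).continuousWithinAt
    · refine ContinuousAt.continuousWithinAt (continuousAt_iff_continuous_left'_right'.2
        ⟨hleft, ?_⟩)
      refine tendsto_const_nhds.congr' ?_
      filter_upwards [self_mem_nhdsWithin] with t ht
      rw [hQge y le_rfl, hQge t (le_of_lt ht)]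
    · refine ContinuousAt.continuousWithinAt (continuousAt_const (y := (0 : ℝ)) |>.congr ?_)
      filter_upwards [Ioi_mem_nhds h] with t ht using (hQge t (le_of_lt ht)).symm
  · have := hd1 0 ⟨le_rfl, hT⟩
    rwa [(hx 0 ⟨le_rfl, hT⟩).1] at this
  · rw [show (2 : WithTop ℕ∞) = 1 + 1 by norm_num, contDiffOn_succ_iff_deriv_of_isOpen isOpen_Ioo]
    exact ⟨fun y hy => (hd1' y hy).differentiableAt.differentiableWithinAt, by simp,
      hC1.congr fun y hy => (hd1' y hy).deriv⟩
  · refine hasDerivWithinAt_Iic_of_tendsto_deriv (s := Ioo 0 T)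
      (fun y hy => (hd1' y hy).differentiableAt.differentiableWithinAt)
      (hleft.mono_left (nhdsWithin_mono _ fun y hy => hy.2)) (Ioo_mem_nhdsLT hT) (hv.congr' ?_)
    filter_upwards [Ioo_mem_nhdsLT hT] with y hy using (hd1' y hy).deriv.symm

lemma exists_isCompactPressure (hn : 0 < n) (hκ : 0 < κ) (hκ1 : κ < 1) :
    ∃ δ₀ > 0, ∀ δ, 0 < δ → δ < δ₀ → ∃ k > 0, ∃ T Q v, IsCompactPressure n κ δ k T Q v := by
  obtain ⟨δ₀, hδ₀, h⟩ := exists_critical hn hκ hκ1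
  refine ⟨δ₀, hδ₀, fun δ hδ hδδ => ?_⟩
  obtain ⟨hδ1, k, hk, hcr, htr, Y, hdec⟩ := h δ hδ hδδ
  obtain ⟨T, x, hx, hT, y, hy, hneg⟩ := exists_maximal hn hκ hκ1 hδ hδ1 hk htr hdec
  have hP := tendsto_fst_of_maximal hn hκ hδ hk hcr hx hT hy hneg
  exact ⟨k, hk, T, _, _, isCompactPressure_of_maximal hn (hy.1.trans hy.2) hx hP
    (tendsto_snd_of_maximal hn hκ hκ1 hδ hk hcr htr hx hy hneg hP)⟩

end

/-- The profile whose pressure is a rescaling of `Q`. -/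
noncomputable def profileOfPressure (m A μ : ℝ) (Q : ℝ → ℝ) (ξ : ℝ) : ℝ :=
  (A * Q (ξ / μ)) ^ (1 / (m - 1))

namespace IsCompactPressure

section

variable {m p σ D A μ κ δ k T : ℝ} {Q v : ℝ → ℝ}

lemma nonneg {n : ℝ} (h : IsCompactPressure n κ δ k T Q v) {y : ℝ} (hy : 0 ≤ y) : 0 ≤ Q y := by
  rcases lt_or_ge y T with h1 | h1
  · exact (h.pos y ⟨hy, h1⟩).le
  · exact (h.eq_zero y h1).ge

lemma scaled_pos {n : ℝ} (h : IsCompactPressure n κ δ k T Q v) (hA : 0 < A) (hμ : 0 < μ) {ξ : ℝ}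
    (hξ : ξ ∈ Ico 0 (μ * T)) : 0 < A * Q (ξ / μ) :=
  mul_pos hA (h.pos _ ⟨div_nonneg hξ.1 hμ.le, (div_lt_iff₀' hμ).2 hξ.2⟩)

lemma scaled_nonneg {n : ℝ} (h : IsCompactPressure n κ δ k T Q v) (hA : 0 < A) (hμ : 0 < μ)
    {ξ : ℝ} (hξ : 0 ≤ ξ) : 0 ≤ A * Q (ξ / μ) :=
  mul_nonneg hA.le (h.nonneg (div_nonneg hξ hμ.le))

lemma profile_pos {n : ℝ} (h : IsCompactPressure n κ δ k T Q v) (hA : 0 < A) (hμ : 0 < μ) {ξ : ℝ}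
    (hξ : ξ ∈ Ico 0 (μ * T)) : 0 < profileOfPressure m A μ Q ξ :=
  rpow_pos_of_pos (h.scaled_pos hA hμ hξ) _

lemma profile_eq_zero {n : ℝ} (h : IsCompactPressure n κ δ k T Q v) (hm : 1 < m) (hμ : 0 < μ)
    {ξ : ℝ} (hξ : μ * T ≤ ξ) : profileOfPressure m A μ Q ξ = 0 := by
  have hm' : 0 < m - 1 := by linarith
  unfold profileOfPressure
  rw [h.eq_zero _ ((le_div_iff₀' hμ).2 hξ), mul_zero, zero_rpow (by positivity)]

lemma positivitySet_profile {n : ℝ} (h : IsCompactPressure n κ δ k T Q v) (hm : 1 < m)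
    (hA : 0 < A) (hμ : 0 < μ) :
    {ξ : ℝ | 0 < ξ ∧ 0 < profileOfPressure m A μ Q ξ} = Ioo 0 (μ * T) := by
  ext ξ
  refine ⟨fun hξ => ⟨hξ.1, ?_⟩, fun hξ => ⟨hξ.1, h.profile_pos hA hμ (Ioo_subset_Ico_self hξ)⟩⟩
  by_contra! hle
  exact hξ.2.ne' (h.profile_eq_zero hm hμ hle)

lemma Fm_profile {n : ℝ} (h : IsCompactPressure n κ δ k T Q v) (hA : 0 < A) (hμ : 0 < μ) {ξ : ℝ}
    (hξ : 0 ≤ ξ) :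
    Fm m (profileOfPressure m A μ Q) ξ = (A * Q (ξ / μ)) ^ (m / (m - 1)) := by
  unfold Fm profileOfPressure
  rw [← rpow_mul (h.scaled_nonneg hA hμ hξ)]
  ring_nf

lemma div_mem_Ioo (hμ : 0 < μ) {ξ : ℝ} (hξ : ξ ∈ Ioo 0 (μ * T)) : ξ / μ ∈ Ioo 0 T :=
  ⟨div_pos hξ.1 hμ, (div_lt_iff₀' hμ).2 hξ.2⟩

lemma hasDerivAt_profile (h : IsCompactPressure (m - 1) κ δ k T Q v)
    (hA : 0 < A) (hμ : 0 < μ) {ξ : ℝ} (hξ : ξ ∈ Ioo 0 (μ * T)) :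
    HasDerivAt (profileOfPressure m A μ Q)
      (profileOfPressure m A μ Q ξ * v (ξ / μ) / ((m - 1) * μ * Q (ξ / μ))) ξ := by
  have hpos := h.scaled_pos hA hμ (Ioo_subset_Ico_self hξ)
  have hQ := h.pos _ (Ioo_subset_Ico_self (div_mem_Ioo hμ hξ))
  have h1 : HasDerivAt (fun ξ => A * Q (ξ / μ)) (A * (v (ξ / μ) * (1 / μ))) ξ :=
    ((h.hasDerivAt _ (div_mem_Ioo hμ hξ)).comp ξ ((hasDerivAt_id ξ).div_const μ)).const_mul A
  refine (h1.rpow_const (p := 1 / (m - 1)) (Or.inl hpos.ne')).congr_deriv ?_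
  unfold profileOfPressure
  rw [rpow_sub hpos, rpow_one]
  field_simp

lemma hasDerivAt_Fm_profile (h : IsCompactPressure (m - 1) κ δ k T Q v) (hm : 1 < m)
    (hA : 0 < A) (hμ : 0 < μ) {ξ : ℝ} (hξ : ξ ∈ Ioo 0 (μ * T)) :
    HasDerivAt (Fm m (profileOfPressure m A μ Q))
      (m * A / ((m - 1) * μ) * (profileOfPressure m A μ Q ξ * v (ξ / μ))) ξ := by
  have hpos := h.scaled_pos hA hμ (Ioo_subset_Ico_self hξ)
  have hQ := h.pos _ (Ioo_subset_Ico_self (div_mem_Ioo hμ hξ))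
  have hm' : 0 < m - 1 := by linarith
  have hf := h.profile_pos (m := m) hA hμ (Ioo_subset_Ico_self hξ)
  refine ((h.hasDerivAt_profile hA hμ hξ).rpow_const (p := m) (Or.inl hf.ne')).congr_deriv ?_
  have hpow : profileOfPressure m A μ Q ξ ^ (m - 1) = A * Q (ξ / μ) := by
    unfold profileOfPressure
    rw [one_div, rpow_inv_rpow hpos.le hm'.ne']
  rw [hpow]
  field_simp

lemma hasDerivAt_deriv_Fm_profile (h : IsCompactPressure (m - 1) κ δ k T Q v) (hm : 1 < m)
    (hA : 0 < A) (hμ : 0 < μ) {ξ : ℝ} (hξ : ξ ∈ Ioo 0 (μ * T)) :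
    HasDerivAt (deriv (Fm m (profileOfPressure m A μ Q)))
      (m * A / ((m - 1) * μ) * (profileOfPressure m A μ Q ξ / μ) *
        ((2 * κ + 2 + δ) - (m - 1) * (1 + κ) * (ξ / μ) * v (ξ / μ) / ((m - 1) * Q (ξ / μ))
          - pressureReaction κ δ k (ξ / μ) (Q (ξ / μ)))) ξ := by
  have hQ := h.pos _ (Ioo_subset_Ico_self (div_mem_Ioo hμ hξ))
  have hm' : 0 < m - 1 := by linarith
  have hv := (h.hasDerivAt_snd _ (div_mem_Ioo hμ hξ)).comp ξ ((hasDerivAt_id ξ).div_const μ)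
  have h2 := ((h.hasDerivAt_profile hA hμ hξ).mul hv).const_mul (m * A / ((m - 1) * μ))
  have hev : deriv (Fm m (profileOfPressure m A μ Q)) =ᶠ[𝓝 ξ] fun ξ =>
      m * A / ((m - 1) * μ) * (profileOfPressure m A μ Q ξ * v (ξ / μ)) := by
    filter_upwards [Ioo_mem_nhds hξ.1 hξ.2] with t ht
    exact (h.hasDerivAt_Fm_profile hm hA hμ ht).deriv
  refine (HasDerivAt.congr_of_eventuallyEq h2 hev).congr_deriv ?_
  simp only [Function.comp, id]
  field_simp
  ring

lemma continuousOn_profile {n : ℝ} (h : IsCompactPressure n κ δ k T Q v) (hm : 1 < m)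
    (hμ : 0 < μ) : ContinuousOn (profileOfPressure m A μ Q) (Ici 0) := by
  have hm' : 0 < m - 1 := by linarith
  refine ContinuousOn.rpow_const (continuousOn_const.mul (h.continuousOn.comp
    (by fun_prop) fun ξ hξ => div_nonneg hξ hμ.le)) fun ξ _ => Or.inr (by positivity)

lemma isProfile (h : IsCompactPressure (m - 1) κ δ k T Q v) (hm : 1 < m)
    (hA : 0 < A) (hμ : 0 < μ) (hD : 0 < D) (hκ : (m - 1) * κ = 1 - p) (hσ : σ = 2 * κ + δ)
    (hAμ : A * m * D = (m - 1) * μ ^ 2) (hkμ : k * A ^ κ = D * μ ^ σ) :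
    IsProfile m p σ ((σ + 2) / D) ((m - p) / D) (profileOfPressure m A μ Q) := by
  have hm' : 0 < m - 1 := by linarith
  have hm0 : 0 < m := by linarith
  refine ⟨h.continuousOn_profile hm hμ,
    fun ξ hξ => rpow_nonneg (h.scaled_nonneg hA hμ hξ) _, ?_, ?_⟩
  · rw [h.positivitySet_profile hm hA hμ]
    refine ContDiffOn.congr (f := fun ξ => (A * Q (ξ / μ)) ^ (m / (m - 1))) ?_
      fun ξ hξ => h.Fm_profile hA hμ hξ.1.le
    refine ContDiffOn.rpow_const_of_ne (contDiffOn_const.mul (h.contDiffOn.comp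
      (by fun_prop) fun ξ hξ => div_mem_Ioo hμ hξ))
      fun ξ hξ => (h.scaled_pos hA hμ (Ioo_subset_Ico_self hξ)).ne'
  · rw [h.positivitySet_profile hm hA hμ]
    intro ξ hξ
    have hpos := h.scaled_pos hA hμ (Ioo_subset_Ico_self hξ)
    have hQ := h.pos _ (Ioo_subset_Ico_self (div_mem_Ioo hμ hξ))
    have hf := h.profile_pos (m := m) hA hμ (Ioo_subset_Ico_self hξ)
    rw [(h.hasDerivAt_deriv_Fm_profile hm hA hμ hξ).deriv, (h.hasDerivAt_profile hA hμ hξ).deriv]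
    have hreact : ξ ^ σ * profileOfPressure m A μ Q ξ ^ p = profileOfPressure m A μ Q ξ / D *
        pressureReaction κ δ k (ξ / μ) (Q (ξ / μ)) := by
      have hfp : profileOfPressure m A μ Q ξ ^ p
          = profileOfPressure m A μ Q ξ * (A ^ κ * Q (ξ / μ) ^ κ)⁻¹ := by
        rw [← mul_rpow hA.le hQ.le]
        unfold profileOfPressure
        rw [← rpow_mul hpos.le, ← rpow_neg hpos.le, ← rpow_add hpos]
        congr 1
        field_simp
        linarith
      unfold pressureReaction
      rw [hfp, ← hσ, div_rpow hξ.1.le hμ.le, rpow_neg hQ.le]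
      have h1 : 0 < μ ^ σ := by positivity
      have h2 : 0 < A ^ κ := by positivity
      have h3 : 0 < Q (ξ / μ) ^ κ := by positivity
      field_simp
      linear_combination (-ξ ^ σ) * hkμ
    have hG : m * A / ((m - 1) * μ) = μ / D := by
      field_simp
      linarith
    rw [hreact, hG]
    have hmp : m - p = (m - 1) * (1 + κ) := by linarith
    rw [hmp, hσ]
    field_simp
    ring

lemma goodP1 {n : ℝ} (h : IsCompactPressure n κ δ k T Q v) (hA : 0 < A) (hμ : 0 < μ) :
    GoodP1 (profileOfPressure m A μ Q) := by
  have hT : 0 < μ * T := mul_pos hμ h.pos_end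
  refine ⟨h.profile_pos hA hμ ⟨le_rfl, hT⟩, ?_⟩
  have hpos := h.scaled_pos hA hμ ⟨le_rfl, hT⟩
  have h0 : HasDerivWithinAt Q 0 (Ici 0) (0 / μ) := by
    rw [zero_div]; exact h.hasDerivWithinAt_zero
  have h1 : HasDerivWithinAt (fun ξ => A * Q (ξ / μ)) (A * (0 * (1 / μ))) (Ici 0) 0 :=
    (h0.comp 0 ((hasDerivWithinAt_id 0 (Ici 0)).div_const μ)
      fun ξ hξ => div_nonneg hξ hμ.le).const_mul A
  refine (h1.rpow_const (p := 1 / (m - 1)) (Or.inl hpos.ne')).congr_deriv ?_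
  ring

lemma hasDerivWithinAt_scaled_end {n : ℝ} (h : IsCompactPressure n κ δ k T Q v) (hμ : 0 < μ) :
    HasDerivWithinAt (fun ξ => A * Q (ξ / μ)) (-(A * (n * (1 + κ) * T / μ))) (Iic (μ * T))
      (μ * T) := by
  have h0 : HasDerivWithinAt Q (-(n * (1 + κ) * T)) (Iic T) (μ * T / μ) := by
    rw [mul_div_cancel_left₀ _ hμ.ne']; exact h.hasDerivWithinAt_end
  have hdiv : HasDerivWithinAt (fun ξ : ℝ => ξ / μ) (1 / μ) (Iic (μ * T)) (μ * T) :=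
    (hasDerivWithinAt_id _ _).div_const μ
  have hmaps : MapsTo (fun ξ : ℝ => ξ / μ) (Iic (μ * T)) (Iic T) :=
    fun ξ hξ => (div_le_iff₀' hμ).2 hξ
  have hcomp : HasDerivWithinAt (fun ξ : ℝ => Q (ξ / μ)) (-(n * (1 + κ) * T) * (1 / μ))
      (Iic (μ * T)) (μ * T) :=
    HasDerivWithinAt.comp (h₂ := Q) (h := fun ξ : ℝ => ξ / μ) (μ * T) h0 hdiv hmaps
  have heq : A * (-(n * (1 + κ) * T) * (1 / μ)) = -(A * (n * (1 + κ) * T / μ)) := by ring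
  rw [← heq]
  exact hcomp.const_mul A

lemma hasInterface {n : ℝ} (h : IsCompactPressure n κ δ k T Q v) (hm : 1 < m) (hA : 0 < A)
    (hμ : 0 < μ) : HasInterface m (profileOfPressure m A μ Q) (μ * T) := by
  have hm' : 0 < m - 1 := by linarith
  have hT : 0 < μ * T := mul_pos hμ h.pos_end
  have hend : A * Q (μ * T / μ) = 0 := by
    rw [mul_div_cancel_left₀ _ hμ.ne', h.eq_zero T le_rfl, mul_zero]
  refine ⟨hT, h.profile_eq_zero hm hμ le_rfl, ?_, μ * T, hT, fun ξ hξ =>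
    h.profile_pos hA hμ ⟨by linarith [hξ.1], hξ.2⟩⟩
  have hexp : 1 < m / (m - 1) := by rw [lt_div_iff₀ hm']; linarith
  have hleft : HasDerivWithinAt (Fm m (profileOfPressure m A μ Q)) 0 (Iic (μ * T)) (μ * T) := by
    have h1 := (h.hasDerivWithinAt_scaled_end (A := A) hμ).rpow_const (p := m / (m - 1))
      (Or.inr hexp.le)
    simp only [hend, zero_rpow (sub_pos.2 hexp).ne', mul_zero] at h1
    refine h1.congr_of_eventuallyEq ?_ (h.Fm_profile hA hμ hT.le)
    filter_upwards [mem_nhdsWithin_of_mem_nhds (Ioi_mem_nhds hT)] with ξ hξ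
    exact h.Fm_profile hA hμ (le_of_lt hξ)
  have hright : HasDerivWithinAt (Fm m (profileOfPressure m A μ Q)) 0 (Ici (μ * T)) (μ * T) := by
    have hzero : ∀ ξ ∈ Ici (μ * T), Fm m (profileOfPressure m A μ Q) ξ = 0 := fun ξ hξ => by
      unfold Fm
      rw [h.profile_eq_zero hm hμ hξ, zero_rpow (by linarith)]
    exact (hasDerivWithinAt_const _ _ (0 : ℝ)).congr hzero (hzero _ (mem_Ici.2 le_rfl))
  have := hleft.union hright
  rwa [Iic_union_Ici, hasDerivWithinAt_univ] at this

lemma typeI {n : ℝ} (h : IsCompactPressure n κ δ k T Q v) (hn : 0 < n) (hκ : 0 < κ)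
    (hA : 0 < A) (hμ : 0 < μ) : TypeI m (profileOfPressure m A μ Q) (μ * T) := by
  have hT := h.pos_end
  have hend : A * Q (μ * T / μ) = 0 := by
    rw [mul_div_cancel_left₀ _ hμ.ne', h.eq_zero T le_rfl, mul_zero]
  have hL : 0 < A * (n * (1 + κ) * T / μ) := by positivity
  refine ⟨(A * (n * (1 + κ) * T / μ)) ^ (1 / (m - 1)), by positivity, ?_⟩
  have h1 := (hasDerivWithinAt_iff_tendsto_slope' (s := Iio (μ * T)) self_notMem_Iio).1
    ((h.hasDerivWithinAt_scaled_end (A := A) hμ).mono Iio_subset_Iic_self)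
  have h2 := (h1.neg.rpow_const (p := 1 / (m - 1)) (Or.inl (by simpa using hL.ne')))
  rw [neg_neg] at h2
  refine h2.congr' ?_
  filter_upwards [Ioo_mem_nhdsLT (mul_pos hμ hT)] with ξ hξ
  have hd : 0 < μ * T - ξ := by linarith [hξ.2]
  rw [slope_def_field, hend, sub_zero, ← div_neg, neg_sub,
    div_rpow (h.scaled_nonneg hA hμ hξ.1.le) hd.le, rpow_neg hd.le, ← div_eq_mul_inv]
  rfl

end

end IsCompactPressure

/-- for `σ` close to its lower limit there exists a good profile
satisfying (P1) with an interface of Type I. -/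
theorem existence_P1_typeI_for_small_sigma (m p : ℝ)
    (hm : 1 < m) (hp0 : 0 < p) (hp1 : p < 1) (hmp : 2 < m + p) :
    ∃ σ₀ : ℝ, 2 * (1 - p) / (m - 1) < σ₀ ∧
      ∀ σ : ℝ, 2 * (1 - p) / (m - 1) < σ → σ < σ₀ →
        ∃ f : ℝ → ℝ, ∃ ξ₀ : ℝ,
          IsProfile m p σ ((σ + 2) / (σ * (m - 1) + 2 * (p - 1)))
            ((m - p) / (σ * (m - 1) + 2 * (p - 1))) f ∧
          GoodP1 f ∧ (∀ ξ ∈ Set.Ioo 0 ξ₀, 0 < f ξ) ∧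
          HasInterface m f ξ₀ ∧ TypeI m f ξ₀ := by
  have hm' : 0 < m - 1 := by linarith
  have hm0 : 0 < m := by linarith
  set κ := (1 - p) / (m - 1) with hκdef
  have hκ : 0 < κ := div_pos (by linarith) hm'
  have hκ1 : κ < 1 := by rw [hκdef, div_lt_one hm']; linarith
  have hmκ : (m - 1) * κ = 1 - p := by rw [hκdef]; field_simp
  obtain ⟨δ₀, hδ₀, hex⟩ := exists_isCompactPressure hm' hκ hκ1
  have hlow : 2 * (1 - p) / (m - 1) = 2 * κ := by rw [hκdef]; ring
  rw [hlow]
  refine ⟨2 * κ + δ₀, by linarith, fun σ hσ hσ₀ => ?_⟩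
  set δ := σ - 2 * κ with hδdef
  have hδ : 0 < δ := by linarith
  obtain ⟨k, hk, T, Q, v, h⟩ := hex δ hδ (by linarith)
  have hD : σ * (m - 1) + 2 * (p - 1) = (m - 1) * δ := by rw [hδdef]; linarith
  have hD0 : 0 < (m - 1) * δ := by positivity
  rw [hD]
  set D := (m - 1) * δ
  set μ := (k * ((m - 1) / (m * D)) ^ κ / D) ^ δ⁻¹ with hμdef
  have hμ : 0 < μ := by positivity
  have hμδ : μ ^ δ = k * ((m - 1) / (m * D)) ^ κ / D := rpow_inv_rpow (by positivity) hδ.ne'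
  set A := (m - 1) / (m * D) * μ ^ 2 with hAdef
  have hA : 0 < A := by positivity
  have hσ' : σ = 2 * κ + δ := by linarith
  have hkμ : k * A ^ κ = D * μ ^ σ := by
    rw [hAdef, mul_rpow (by positivity) (by positivity), ← rpow_natCast_mul hμ.le, hσ',
      rpow_add hμ, hμδ]
    push_cast
    field_simp
  exact ⟨profileOfPressure m A μ Q, μ * T,
    h.isProfile hm hA hμ hD0 hmκ hσ' (by rw [hAdef]; field_simp) hkμ,
    h.goodP1 hA hμ, fun ξ hξ => h.profile_pos hA hμ (Ioo_subset_Ico_self hξ),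
    h.hasInterface hm hA hμ, h.typeI hm' hκ hA hμ⟩
end

section
/- Let m>1, 0<p<1 with m+p>2, σ>2(1−p)/(m−1). There exists a solution f of the profile ODE, positive on some interval (0,δ), such that f(ξ)ξ^{−2/(m−1)} → ((m−1)/(2m(m+1)))^{1/(m−1)} as ξ→0⁺ (so f(0)=0); moreover this solution is unique, in the sense that any two solutions with this asymptotic behavior coincide on a right-neighborhood of 0. -/
open Real Filter Set Topology

/-- The profile equation in the variables `y = ξ ^ (-(a + 1)) w / K ^ m` and
`P = ξ ^ (-a) (w' + β ξ f) / K ^ m`, where `w = f ^ m`. -/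
def SolvesReduced (a b c e θ μ ν : ℝ) (y P : ℝ → ℝ) (δ : ℝ) : Prop :=
  ∀ ξ ∈ Ioo 0 δ, 0 < y ξ ∧
    HasDerivAt y ((P ξ - b * y ξ ^ μ - (a + 1) * y ξ) / ξ) ξ ∧
    HasDerivAt P ((c * y ξ ^ μ - e * ξ ^ θ * y ξ ^ ν - a * P ξ) / ξ) ξ

theorem rpow_strict_approx_near_one (μ : ℝ) {ε : ℝ} (hε : 0 < ε) :
    ∃ r, 0 < r ∧ r < 1 ∧ ∀ x ∈ Icc (1 - r) (1 + r), ∀ y ∈ Icc (1 - r) (1 + r),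
      |x ^ μ - y ^ μ - μ * (x - y)| ≤ ε * |x - y| := by
  have h : HasStrictDerivAt (fun x : ℝ => x ^ μ) (μ * 1 ^ (μ - 1)) 1 :=
    Real.hasStrictDerivAt_rpow_const_of_ne one_ne_zero μ
  have h2 := h.isLittleO.def hε
  rw [nhds_prod_eq] at h2
  obtain ⟨r, hr, h3⟩ := (Metric.nhds_basis_closedBall.prod_self.eventually_iff).1 h2
  refine ⟨min r (1 / 2), by positivity, by
    have := min_le_right r (1 / 2); linarith, fun x hx y hy => ?_⟩
  have mem : ∀ z ∈ Icc (1 - min r (1 / 2)) (1 + min r (1 / 2)), z ∈ Metric.closedBall 1 r := fun z hz => by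
    have := min_le_left r (1 / 2)
    rw [Real.closedBall_eq_Icc]
    exact ⟨by linarith [hz.1], by linarith [hz.2]⟩
  have := h3 (mk_mem_prod (mem x hx) (mem y hy))
  simpa [mul_comm μ] using this

theorem le_of_euler_deriv_add_le {l M C δ : ℝ} (hl : 0 < l) {G R : ℝ → ℝ}
    (hG : ∀ x ∈ Ioo 0 δ, HasDerivAt G ((R x - l * G x) / x) x)
    (hR : ∀ x ∈ Ioo 0 δ, R x ≤ M)
    (hC : ∀ η ∈ Ioo 0 δ, ∃ x ∈ Ioo 0 η, |G x| ≤ C) :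
    ∀ x ∈ Ioo 0 δ, G x ≤ M / l := by
  intro x hx
  have hd : ∀ z ∈ Ioo 0 δ, HasDerivAt (fun z => z ^ l * (G z - M / l))
      (z ^ (l - 1) * (R z - M)) z := fun z hz => by
    have hz0 : z ≠ 0 := hz.1.ne'
    have h1 := (Real.hasDerivAt_rpow_const (p := l) (Or.inl hz0)).mul
      ((hG z hz).sub_const (M / l))
    refine h1.congr_deriv ?_
    rw [Real.rpow_sub_one hz0]
    field_simp
    ring
  have hanti : AntitoneOn (fun z => z ^ l * (G z - M / l)) (Ioo 0 δ) := by
    refine antitoneOn_of_deriv_nonpos (convex_Ioo 0 δ)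
      (fun z hz => (hd z hz).continuousAt.continuousWithinAt) (fun z hz => ?_) fun z hz => ?_
    · rw [interior_Ioo] at hz
      exact (hd z hz).differentiableAt.differentiableWithinAt
    · rw [interior_Ioo] at hz
      rw [(hd z hz).deriv]
      exact mul_nonpos_of_nonneg_of_nonpos (Real.rpow_nonneg hz.1.le _)
        (by linarith [hR z hz])
  have hlim : Tendsto (fun η : ℝ => η ^ l * (C + |M / l|)) (𝓝[>] 0) (𝓝 0) := by
    have : Tendsto (fun η : ℝ => η ^ l * (C + |M / l|)) (𝓝 0) (𝓝 (0 ^ l * (C + |M / l|))) :=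
      ((Real.continuous_rpow_const hl.le).tendsto 0).mul_const _
    rw [Real.zero_rpow hl.ne', zero_mul] at this
    exact this.mono_left nhdsWithin_le_nhds
  have hle : x ^ l * (G x - M / l) ≤ 0 := by
    refine ge_of_tendsto hlim ?_
    filter_upwards [Ioo_mem_nhdsGT hx.1] with η hη
    obtain ⟨z, hz, hzC⟩ := hC η ⟨hη.1, hη.2.trans hx.2⟩
    have h1 := hanti ⟨hz.1, hz.2.trans (hη.2.trans hx.2)⟩ hx (hz.2.trans hη.2).le
    refine h1.trans ?_
    have h2 : G z - M / l ≤ C + |M / l| := by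
      linarith [le_abs_self (G z), neg_abs_le (M / l)]
    have h3 : 0 ≤ C + |M / l| := by linarith [abs_nonneg (G z), abs_nonneg (M / l)]
    calc z ^ l * (G z - M / l) ≤ z ^ l * (C + |M / l|) :=
          mul_le_mul_of_nonneg_left h2 (Real.rpow_nonneg hz.1.le _)
      _ ≤ η ^ l * (C + |M / l|) :=
          mul_le_mul_of_nonneg_right (Real.rpow_le_rpow hz.1.le hz.2.le hl.le) h3
  have := nonpos_of_mul_nonpos_right hle (Real.rpow_pos_of_pos hx.1 l)
  linarith

theorem abs_le_of_abs_euler_deriv_add_le {l M C δ : ℝ} (hl : 0 < l) {G R : ℝ → ℝ}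
    (hG : ∀ x ∈ Ioo 0 δ, HasDerivAt G ((R x - l * G x) / x) x)
    (hR : ∀ x ∈ Ioo 0 δ, |R x| ≤ M)
    (hC : ∀ η ∈ Ioo 0 δ, ∃ x ∈ Ioo 0 η, |G x| ≤ C) :
    ∀ x ∈ Ioo 0 δ, |G x| ≤ M / l := by
  intro x hx
  refine abs_le'.2 ⟨le_of_euler_deriv_add_le hl hG (fun z hz => (abs_le'.1 (hR z hz)).1) hC x hx,
    le_of_euler_deriv_add_le (G := fun z => -G z) (R := fun z => -R z) hl (fun z hz => ?_)
      (fun z hz => (abs_le'.1 (hR z hz)).2) (by simpa using hC) x hx⟩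
  exact (hG z hz).neg.congr_deriv (by ring)

theorem exists_abs_mul_deriv_le {d d' : ℝ → ℝ} {M δ η : ℝ}
    (hd : ∀ x ∈ Ioo 0 δ, HasDerivAt d (d' x) x) (hM : ∀ x ∈ Ioo 0 δ, |d x| ≤ M)
    (hη : η ∈ Ioo 0 δ) : ∃ x ∈ Ioo 0 η, |x * d' x| ≤ 4 * M := by
  have hlt : η / 2 < η := by linarith [hη.1]
  have hsub : ∀ x ∈ Icc (η / 2) η, x ∈ Ioo 0 δ := fun x hx =>
    ⟨by linarith [hη.1, hx.1], by linarith [hη.2, hx.2]⟩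
  obtain ⟨x, hx, hxe⟩ := exists_hasDerivAt_eq_slope d d' hlt
    (fun x hx => (hd x (hsub x hx)).continuousAt.continuousWithinAt)
    (fun x hx => hd x (hsub x (Ioo_subset_Icc_self hx)))
  have hx0 : 0 < x := by linarith [hη.1, hx.1]
  refine ⟨x, ⟨hx0, hx.2⟩, ?_⟩
  have h1 := hM η hη
  have h2 := hM (η / 2) (hsub _ ⟨le_rfl, hlt.le⟩)
  have h3 : |d η - d (η / 2)| ≤ 2 * M := (abs_sub _ _).trans (by linarith)
  rw [hxe, abs_mul, abs_of_pos hx0, abs_div, show η - η / 2 = η / 2 by ring,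
    abs_of_pos (show 0 < η / 2 by linarith [hη.1]), mul_div_assoc', div_le_iff₀ (by linarith [hη.1])]
  nlinarith [hx.2, abs_nonneg (d η - d (η / 2)), hη.1]

/-- The smallness constants that make the reduced system contractive near `y = 1`. -/
theorem exists_contraction_constants {a b c e θ μ ν : ℝ} (ha : 0 < a) (hb : 0 ≤ b)
    (hc : c = a * (a + 1 + b)) (hθ : 0 < θ) (hμ0 : 0 < μ) (hμ1 : μ < 1) (hν0 : 0 < ν)
    (hν1 : ν < 1) :
    ∃ ε r δ ρ : ℝ, 0 < ε ∧ 0 < r ∧ r < 1 ∧ 0 < δ ∧ 0 ≤ ρ ∧ ρ < 1 ∧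
      (c * (μ + ε) + ε) / a + b * ε ≤ ρ * (a + 1 + b * μ) ∧
      e * δ ^ θ * 2 ≤ ε ∧
      (∀ x ∈ Icc (1 - r) (1 + r), ∀ y ∈ Icc (1 - r) (1 + r),
        |x ^ μ - y ^ μ - μ * (x - y)| ≤ ε * |x - y|) ∧
      (∀ x ∈ Icc (1 - r) (1 + r), ∀ y ∈ Icc (1 - r) (1 + r), |x ^ ν - y ^ ν| ≤ 2 * |x - y|) := by
  have hQ : 0 < a + 1 + b + 1 / a + b := by positivity
  obtain ⟨ε, hεd⟩ : ∃ ε, ε = (a + 1) * (1 - μ) / (2 * (a + 1 + b + 1 / a + b)) := ⟨_, rfl⟩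
  have hε : 0 < ε := by
    rw [hεd]; exact div_pos (mul_pos (by linarith) (by linarith)) (by linarith)
  have hΛ : 0 < a + 1 + b * μ := by positivity
  have hc0 : 0 < c := by rw [hc]; positivity
  obtain ⟨r₁, h1, h1', H1⟩ := rpow_strict_approx_near_one μ hε
  obtain ⟨r₂, h2, h2', H2⟩ := rpow_strict_approx_near_one ν (sub_pos.2 hν1)
  have hδ : ∃ δ : ℝ, 0 < δ ∧ e * δ ^ θ * 2 ≤ ε := by
    have : Tendsto (fun δ : ℝ => e * δ ^ θ * 2) (𝓝 0) (𝓝 (e * 0 ^ θ * 2)) :=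
      (((Real.continuous_rpow_const hθ.le).tendsto 0).const_mul _).mul_const _
    rw [Real.zero_rpow hθ.ne', mul_zero, zero_mul] at this
    have h := (this.mono_left (nhdsWithin_le_nhds (s := Ioi 0))).eventually
      (eventually_le_nhds hε)
    obtain ⟨δ, h, h'⟩ := (h.and self_mem_nhdsWithin).exists
    exact ⟨δ, h', h⟩
  obtain ⟨δ, hδ0, hδ⟩ := hδ
  refine ⟨ε, min r₁ r₂, δ, ((c * (μ + ε) + ε) / a + b * ε) / (a + 1 + b * μ), hε, lt_min h1 h2,
    (min_le_left _ _).trans_lt h1', hδ0, by positivity, ?_, ?_, hδ, ?_, ?_⟩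
  · rw [div_lt_one hΛ]
    have e1 : (c * (μ + ε) + ε) / a + b * ε
        = (a + 1 + b) * μ + ε * (a + 1 + b + 1 / a + b) := by
      rw [hc]; field_simp; ring
    have e2 : ε * (a + 1 + b + 1 / a + b) = (a + 1) * (1 - μ) / 2 := by
      rw [hεd]; field_simp
    rw [e1, e2]
    nlinarith
  · rw [div_mul_cancel₀ _ hΛ.ne']
  · have := min_le_left r₁ r₂
    exact fun x hx y hy => H1 x ⟨by linarith [hx.1], by linarith [hx.2]⟩ y
      ⟨by linarith [hy.1], by linarith [hy.2]⟩
  · have := min_le_right r₁ r₂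
    intro x hx y hy
    have h := H2 x ⟨by linarith [hx.1], by linarith [hx.2]⟩ y
      ⟨by linarith [hy.1], by linarith [hy.2]⟩
    have h' : |x ^ ν - y ^ ν| ≤ |x ^ ν - y ^ ν - ν * (x - y)| + |ν * (x - y)| := by
      simpa using abs_add_le (x ^ ν - y ^ ν - ν * (x - y)) (ν * (x - y))
    rw [abs_mul, abs_of_pos hν0] at h'
    nlinarith [abs_nonneg (x - y)]

theorem abs_rpow_sub_le_of_approx {μ ε x y : ℝ} (hμ : 0 < μ)
    (h : |x ^ μ - y ^ μ - μ * (x - y)| ≤ ε * |x - y|) :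
    |x ^ μ - y ^ μ| ≤ (μ + ε) * |x - y| := by
  have h' : |x ^ μ - y ^ μ| ≤ |x ^ μ - y ^ μ - μ * (x - y)| + |μ * (x - y)| := by
    simpa using abs_add_le (x ^ μ - y ^ μ - μ * (x - y)) (μ * (x - y))
  rw [abs_mul, abs_of_pos hμ] at h'
  linarith

theorem SolvesReduced.eventually_unique {a b c e θ μ ν : ℝ} (ha : 0 < a) (hb : 0 ≤ b)
    (he : 0 ≤ e) (hc : c = a * (a + 1 + b)) (hθ : 0 < θ) (hμ0 : 0 < μ) (hμ1 : μ < 1)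
    (hν0 : 0 < ν) (hν1 : ν < 1) {y P z Q : ℝ → ℝ} {δ₁ δ₂ : ℝ} (hδ₁ : 0 < δ₁) (hδ₂ : 0 < δ₂)
    (hy : SolvesReduced a b c e θ μ ν y P δ₁) (hz : SolvesReduced a b c e θ μ ν z Q δ₂)
    (hy1 : Tendsto y (𝓝[>] 0) (𝓝 1)) (hz1 : Tendsto z (𝓝[>] 0) (𝓝 1)) :
    ∃ δ > 0, ∀ ξ ∈ Ioo 0 δ, y ξ = z ξ := by
  obtain ⟨ε, r, δ₀, ρ, hε, hr, hr1, hδ₀, hρ0, hρ1, hρ, hδε, H1, H2⟩ :=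
    exists_contraction_constants (e := e) ha hb hc hθ hμ0 hμ1 hν0 hν1
  have hc0 : 0 < c := by rw [hc]; positivity
  have hΛ : 0 < a + 1 + b * μ := by positivity
  have hI : Icc (1 - r) (1 + r) ∈ 𝓝 (1 : ℝ) := Icc_mem_nhds (by linarith) (by linarith)
  obtain ⟨δ₃, hδ₃, h3⟩ := mem_nhdsGT_iff_exists_Ioo_subset.1
    ((hy1.eventually_mem hI).and (hz1.eventually_mem hI))
  have hδ₃ : 0 < δ₃ := hδ₃
  obtain ⟨δ, hδd⟩ : ∃ δ, δ = min (min δ₁ δ₂) (min δ₀ δ₃) := ⟨_, rfl⟩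
  have hδ : 0 < δ := by rw [hδd]; positivity
  have hm1 : ∀ x ∈ Ioo 0 δ, x ∈ Ioo 0 δ₁ ∧ x ∈ Ioo 0 δ₂ ∧ x < δ₀ ∧ x ∈ Ioo 0 δ₃ := by
    intro x hx
    have := hx.2
    rw [hδd] at this
    simp only [lt_min_iff] at this
    exact ⟨⟨hx.1, this.1.1⟩, ⟨hx.1, this.1.2⟩, this.2.1, ⟨hx.1, this.2.2⟩⟩
  have hmu : ∀ x ∈ Ioo 0 δ, |y x ^ μ - z x ^ μ - μ * (y x - z x)| ≤ ε * |y x - z x| :=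
    fun x hx => H1 _ (h3 (hm1 x hx).2.2.2).1 _ (h3 (hm1 x hx).2.2.2).2
  have hnu : ∀ x ∈ Ioo 0 δ, |y x ^ ν - z x ^ ν| ≤ 2 * |y x - z x| :=
    fun x hx => H2 _ (h3 (hm1 x hx).2.2.2).1 _ (h3 (hm1 x hx).2.2.2).2
  have hd : ∀ x ∈ Ioo 0 δ, HasDerivAt (fun x => y x - z x)
      (((P x - Q x - b * (y x ^ μ - z x ^ μ - μ * (y x - z x)))
        - (a + 1 + b * μ) * (y x - z x)) / x) x := fun x hx =>
    ((hy x (hm1 x hx).1).2.1.sub (hz x (hm1 x hx).2.1).2.1).congr_deriv (by ring)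
  have hD : ∀ x ∈ Ioo 0 δ, HasDerivAt (fun x => P x - Q x)
      (((c * (y x ^ μ - z x ^ μ) - e * x ^ θ * (y x ^ ν - z x ^ ν))
        - a * (P x - Q x)) / x) x := fun x hx =>
    ((hy x (hm1 x hx).1).2.2.sub (hz x (hm1 x hx).2.1).2.2).congr_deriv (by ring)
  have step : ∀ M, (∀ x ∈ Ioo 0 δ, |y x - z x| ≤ M) → ∀ x ∈ Ioo 0 δ, |y x - z x| ≤ ρ * M := by
    intro M hM
    have hM0 : 0 ≤ M := (abs_nonneg _).trans (hM (δ / 2) ⟨by linarith, by linarith⟩)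
    have hPQ : ∀ x ∈ Ioo 0 δ, |P x - Q x| ≤ (c * (μ + ε) + ε) * M / a := by
      refine abs_le_of_abs_euler_deriv_add_le
        (C := 4 * M + (a + 1 + b * μ) * M + b * (ε * M)) ha hD (fun x hx => ?_) fun η hη => ?_
      · have h1 := abs_rpow_sub_le_of_approx hμ0 (hmu x hx)
        have h2 := hnu x hx
        have h4 := hM x hx
        have hx0 : 0 ≤ x ^ θ := Real.rpow_nonneg hx.1.le _
        have h5 : x ^ θ ≤ δ₀ ^ θ := Real.rpow_le_rpow hx.1.le (hm1 x hx).2.2.1.le hθ.le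
        have h6 : e * x ^ θ * 2 ≤ ε := le_trans (by gcongr) hδε
        calc _ ≤ |c * (y x ^ μ - z x ^ μ)| + |e * x ^ θ * (y x ^ ν - z x ^ ν)| := abs_sub _ _
          _ = c * |y x ^ μ - z x ^ μ| + e * x ^ θ * |y x ^ ν - z x ^ ν| := by
            rw [abs_mul, abs_mul, abs_of_pos hc0, abs_of_nonneg (mul_nonneg he hx0)]
          _ ≤ c * ((μ + ε) * M) + e * x ^ θ * (2 * M) := by
            gcongr
            · exact h1.trans (by gcongr)
            · exact h2.trans (by gcongr)
          _ = c * ((μ + ε) * M) + e * x ^ θ * 2 * M := by ring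
          _ ≤ c * ((μ + ε) * M) + ε * M := by gcongr
          _ = _ := by ring
      · obtain ⟨x, hx, hx4⟩ := exists_abs_mul_deriv_le hd hM hη
        have hxδ : x ∈ Ioo 0 δ := ⟨hx.1, hx.2.trans hη.2⟩
        refine ⟨x, hx, ?_⟩
        rw [mul_div_cancel₀ _ hx.1.ne'] at hx4
        have h1 : |(a + 1 + b * μ) * (y x - z x)| ≤ (a + 1 + b * μ) * M := by
          rw [abs_mul, abs_of_pos hΛ]; gcongr; exact hM x hxδ
        have h2 : |b * (y x ^ μ - z x ^ μ - μ * (y x - z x))| ≤ b * (ε * M) := by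
          rw [abs_mul, abs_of_nonneg hb]
          gcongr
          exact (hmu x hxδ).trans (by gcongr; exact hM x hxδ)
        rw [abs_le] at *
        constructor <;> linarith [hx4.1, hx4.2, h1.1, h1.2, h2.1, h2.2]
    intro x hx
    refine (abs_le_of_abs_euler_deriv_add_le (C := M)
      (M := (c * (μ + ε) + ε) * M / a + b * (ε * M)) hΛ hd (fun x hx => ?_) (fun η hη => ?_)
      x hx).trans ?_
    · refine (abs_sub _ _).trans (add_le_add (hPQ x hx) ?_)
      rw [abs_mul, abs_of_nonneg hb]
      gcongr
      exact (hmu x hx).trans (by gcongr; exact hM x hx)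
    · exact ⟨η / 2, ⟨by linarith [hη.1], by linarith [hη.1]⟩,
        hM _ ⟨by linarith [hη.1], by linarith [hη.1, hη.2]⟩⟩
    · rw [div_le_iff₀ hΛ]
      calc _ = ((c * (μ + ε) + ε) / a + b * ε) * M := by ring
        _ ≤ ρ * (a + 1 + b * μ) * M := by gcongr
        _ = _ := by ring
  have iter : ∀ n : ℕ, ∀ x ∈ Ioo 0 δ, |y x - z x| ≤ ρ ^ n * (2 * r) := by
    intro n
    induction n with
    | zero =>
      intro x hx
      obtain ⟨h1, h2⟩ := h3 (hm1 x hx).2.2.2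
      rw [pow_zero, one_mul, abs_le]
      exact ⟨by linarith [h1.1, h2.2], by linarith [h1.2, h2.1]⟩
    | succ n ih =>
      intro x hx
      exact (step _ ih x hx).trans_eq (by ring)
  refine ⟨δ, hδ, fun x hx => ?_⟩
  have hlim : Tendsto (fun n : ℕ => ρ ^ n * (2 * r)) atTop (𝓝 0) := by
    simpa using (tendsto_pow_atTop_nhds_zero_of_lt_one hρ0 hρ1).mul_const (2 * r)
  exact sub_eq_zero.1 (abs_nonpos_iff.1 (ge_of_tendsto' hlim fun n => iter n x hx))

/-- The bounded solution `G` of the Euler equation `x G' + l G = h` on the half line. -/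
noncomputable def eulerAverage (l : ℝ) (h : ℝ → ℝ) (x : ℝ) : ℝ :=
  ∫ r in (0 : ℝ)..1, r ^ (l - 1) * h (r * x)

section eulerAverage
variable {l : ℝ} {h g : ℝ → ℝ}

theorem intervalIntegrable_rpow_mul (hl : 0 < l) (hh : Continuous h) (u v : ℝ) :
    IntervalIntegrable (fun r => r ^ (l - 1) * h r) MeasureTheory.volume u v :=
  (intervalIntegral.intervalIntegrable_rpow' (by linarith)).mul_continuousOn hh.continuousOn

theorem integral_rpow_sub_one (hl : 0 < l) : ∫ r in (0 : ℝ)..1, r ^ (l - 1) = 1 / l := by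
  rw [integral_rpow (Or.inl (by linarith))]
  simp [Real.zero_rpow hl.ne']

theorem eulerAverage_zero (hl : 0 < l) : eulerAverage l h 0 = h 0 / l := by
  simp only [eulerAverage, mul_zero]
  rw [intervalIntegral.integral_mul_const, integral_rpow_sub_one hl]
  ring

theorem abs_eulerAverage_sub_le (hl : 0 < l) (hh : Continuous h) (hg : Continuous g) {M : ℝ}
    (hM : ∀ x, |h x - g x| ≤ M) (x : ℝ) :
    |eulerAverage l h x - eulerAverage l g x| ≤ M / l := by
  rw [eulerAverage, eulerAverage, ← intervalIntegral.integral_sub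
    (intervalIntegrable_rpow_mul hl (by fun_prop) 0 1)
    (intervalIntegrable_rpow_mul hl (by fun_prop) 0 1)]
  rw [← Real.norm_eq_abs]
  refine (intervalIntegral.norm_integral_le_of_norm_le (g := fun r => r ^ (l - 1) * M)
    zero_le_one (.of_forall fun r hr => ?_)
    (intervalIntegrable_rpow_mul hl continuous_const 0 1)).trans_eq ?_
  · rw [← mul_sub, Real.norm_eq_abs, abs_mul, abs_of_nonneg (Real.rpow_nonneg hr.1.le _)]
    exact mul_le_mul_of_nonneg_left (hM _) (Real.rpow_nonneg hr.1.le _)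
  · rw [intervalIntegral.integral_mul_const, integral_rpow_sub_one hl]
    ring

theorem abs_eulerAverage_le (hl : 0 < l) (hh : Continuous h) {M : ℝ} (hM : ∀ x, |h x| ≤ M)
    (x : ℝ) : |eulerAverage l h x| ≤ M / l := by
  simpa [eulerAverage] using
    abs_eulerAverage_sub_le hl hh (continuous_const (y := (0 : ℝ))) (by simpa using hM) x

theorem continuous_eulerAverage (hl : 0 < l) (hh : Continuous h) {M : ℝ} (hM : ∀ x, |h x| ≤ M) :
    Continuous (eulerAverage l h) := by
  refine intervalIntegral.continuous_of_dominated_interval (bound := fun r => r ^ (l - 1) * M)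
    (fun x => ?_) (fun x => .of_forall fun r hr => ?_)
    (intervalIntegrable_rpow_mul hl continuous_const 0 1) (.of_forall fun r _ => by fun_prop)
  · have := (intervalIntegrable_rpow_mul hl (h := fun r => h (r * x)) (by fun_prop) 0 1)
    rw [uIoc_of_le zero_le_one]
    exact this.1.aestronglyMeasurable
  · rw [uIoc_of_le zero_le_one] at hr
    rw [Real.norm_eq_abs, abs_mul, abs_of_nonneg (Real.rpow_nonneg hr.1.le _)]
    exact mul_le_mul_of_nonneg_left (hM _) (Real.rpow_nonneg hr.1.le _)

theorem eulerAverage_eq {x : ℝ} (hx : 0 < x) :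
    eulerAverage l h x = x ^ (-l) * ∫ s in (0 : ℝ)..x, s ^ (l - 1) * h s := by
  have h1 := intervalIntegral.mul_integral_comp_mul_right (a := 0) (b := 1)
    (f := fun s => s ^ (l - 1) * h s) x
  rw [zero_mul, one_mul] at h1
  rw [← h1, ← intervalIntegral.integral_const_mul, ← intervalIntegral.integral_const_mul]
  refine intervalIntegral.integral_congr fun r hr => ?_
  rw [uIcc_of_le zero_le_one] at hr
  rw [Real.mul_rpow hr.1 hx.le, Real.rpow_sub_one hx.ne', Real.rpow_neg hx.le]
  have := (Real.rpow_pos_of_pos hx l).ne'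
  field_simp

theorem hasDerivAt_eulerAverage (hl : 0 < l) (hh : Continuous h) {x : ℝ} (hx : 0 < x) :
    HasDerivAt (eulerAverage l h) ((h x - l * eulerAverage l h x) / x) x := by
  have hint : HasDerivAt (fun u => ∫ s in (0 : ℝ)..u, s ^ (l - 1) * h s)
      (x ^ (l - 1) * h x) x := by
    refine intervalIntegral.integral_hasDerivAt_right (intervalIntegrable_rpow_mul hl hh 0 x)
      ?_ ?_
    · exact (by fun_prop : Measurable fun s : ℝ => s ^ (l - 1) * h s).stronglyMeasurable
        |>.stronglyMeasurableAtFilter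
    · exact (Real.continuousAt_rpow_const _ _ (Or.inl hx.ne')).mul hh.continuousAt
  have hd := (Real.hasDerivAt_rpow_const (p := -l) (Or.inl hx.ne')).mul hint
  have heq : eulerAverage l h =ᶠ[𝓝 x]
      fun x => x ^ (-l) * ∫ s in (0 : ℝ)..x, s ^ (l - 1) * h s := by
    filter_upwards [lt_mem_nhds hx] with z hz using eulerAverage_eq hz
  refine (hd.congr_of_eventuallyEq heq).congr_deriv ?_
  rw [eulerAverage_eq hx, Real.rpow_sub_one hx.ne', Real.rpow_sub_one hx.ne',
    Real.rpow_neg hx.le]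
  have := (Real.rpow_pos_of_pos hx l).ne'
  field_simp
  ring

end eulerAverage

theorem abs_clip_sub_le (r x y : ℝ) :
    |max (-r) (min r x) - max (-r) (min r y)| ≤ |x - y| := by
  have h1 := abs_max_sub_max_le_max (-r) (min r x) (-r) (min r y)
  have h2 := abs_min_sub_min_le_max r x r y
  simp only [sub_self, abs_zero] at h1 h2
  rw [max_eq_right (abs_nonneg (min r x - min r y))] at h1
  rw [max_eq_right (abs_nonneg (x - y))] at h2
  exact h1.trans h2

theorem exists_solvesReduced {a b c e θ μ ν : ℝ} (ha : 0 < a) (hb : 0 ≤ b)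
    (he : 0 ≤ e) (hc : c = a * (a + 1 + b)) (hθ : 0 < θ) (hμ0 : 0 < μ) (hμ1 : μ < 1)
    (hν0 : 0 < ν) (hν1 : ν < 1) :
    ∃ δ > 0, ∃ y P : ℝ → ℝ, SolvesReduced a b c e θ μ ν y P δ ∧ Tendsto y (𝓝[>] 0) (𝓝 1) := by
  obtain ⟨ε, r, δ₀, ρ, hε, hr, hr1, hδ₀, hρ0, hρ1, hρ, hδε, H1, H2⟩ :=
    exists_contraction_constants (e := e) ha hb hc hθ hμ0 hμ1 hν0 hν1
  have hc0 : 0 < c := by rw [hc]; positivity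
  have hΛ : 0 < a + 1 + b * μ := by positivity
  let cl : ℝ → ℝ := fun x => max (-r) (min r x)
  have hcl : Continuous cl := by fun_prop
  have hclr : ∀ x, |cl x| ≤ r := fun x =>
    abs_le.2 ⟨le_max_left _ _, max_le (by linarith) (min_le_left _ _)⟩
  have hclI : ∀ x, 1 + cl x ∈ Icc (1 - r) (1 + r) := fun x => by
    have := abs_le.1 (hclr x)
    exact ⟨by linarith [this.1], by linarith [this.2]⟩
  have hcl_id : ∀ x, |x| ≤ r → cl x = x := fun x hx => by
    have := abs_le.1 hx
    simp only [cl]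
    rw [min_eq_right this.2, max_eq_right this.1]
  have hcl0 : cl 0 = 0 := hcl_id 0 (by simpa using hr.le)
  have hclpos : ∀ x, 1 + cl x ≠ 0 := fun x => by linarith [(hclI x).1] |> ne_of_gt
  let V : ℝ → ℝ := fun x => (1 + cl x) ^ μ
  let U : ℝ → ℝ := fun x => (1 + cl x) ^ ν
  let q : ℝ → ℝ := fun x => V x - 1 - μ * cl x
  let τ : ℝ → ℝ := fun ξ => min |ξ| δ₀ ^ θ
  have hVc : Continuous V := (continuous_const.add hcl).rpow_const fun x => Or.inl (hclpos x)
  have hUc : Continuous U := (continuous_const.add hcl).rpow_const fun x => Or.inl (hclpos x)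
  have hqc : Continuous q := by fun_prop
  have hτc : Continuous τ := (by fun_prop : Continuous fun ξ : ℝ => min |ξ| δ₀).rpow_const
    fun x => Or.inr hθ.le
  have hτ0 : ∀ ξ, 0 ≤ τ ξ := fun ξ => Real.rpow_nonneg (le_min (abs_nonneg _) hδ₀.le) _
  have hτ : ∀ ξ, e * τ ξ * 2 ≤ ε := fun ξ => by
    have : τ ξ ≤ δ₀ ^ θ :=
      Real.rpow_le_rpow (le_min (abs_nonneg _) hδ₀.le) (min_le_right _ _) hθ.le
    exact le_trans (by gcongr) hδε
  have hqL : ∀ x y, |q x - q y| ≤ ε * |x - y| := fun x y => by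
    have h := H1 _ (hclI x) _ (hclI y)
    have h2 := abs_clip_sub_le r x y
    rw [add_sub_add_left_eq_sub] at h
    calc |q x - q y| = |(1 + cl x) ^ μ - (1 + cl y) ^ μ - μ * (cl x - cl y)| := by
          congr 1; simp only [q, V]; ring
      _ ≤ _ := h.trans (by gcongr)
  have hVL : ∀ x y, |V x - V y| ≤ (μ + ε) * |x - y| := fun x y => by
    have h := abs_rpow_sub_le_of_approx hμ0 (H1 _ (hclI x) _ (hclI y))
    rw [add_sub_add_left_eq_sub] at h
    exact h.trans (mul_le_mul_of_nonneg_left (abs_clip_sub_le r x y) (by positivity))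
  have hUL : ∀ x y, |U x - U y| ≤ 2 * |x - y| := fun x y => by
    have h := H2 _ (hclI x) _ (hclI y)
    rw [add_sub_add_left_eq_sub] at h
    exact h.trans (mul_le_mul_of_nonneg_left (abs_clip_sub_le r x y) (by positivity))
  have hV0 : V 0 = 1 := by simp [V, hcl0]
  have hU0 : U 0 = 1 := by simp [U, hcl0]
  have hq0 : q 0 = 0 := by simp [q, hV0, hcl0]
  -- the source terms of the two Euler equations
  let R : (ℝ → ℝ) → ℝ → ℝ := fun ψ ξ => c * V (ψ ξ) - e * τ ξ * U (ψ ξ)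
  let S : (ℝ → ℝ) → ℝ → ℝ := fun ψ ξ => eulerAverage a (R ψ) ξ - (a + 1 + b) - b * q (ψ ξ)
  have hRc : ∀ ψ, Continuous ψ → Continuous (R ψ) := fun ψ hψ => by fun_prop
  have hRL : ∀ (ψ φ : ℝ → ℝ) (M : ℝ), 0 ≤ M → (∀ x, |ψ x - φ x| ≤ M) →
      ∀ x, |R ψ x - R φ x| ≤ (c * (μ + ε) + ε) * M := fun ψ φ M hM0 hM x => by
    calc |R ψ x - R φ x| = |c * (V (ψ x) - V (φ x)) - e * τ x * (U (ψ x) - U (φ x))| := by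
          congr 1; simp only [R]; ring
      _ ≤ |c * (V (ψ x) - V (φ x))| + |e * τ x * (U (ψ x) - U (φ x))| := abs_sub _ _
      _ = c * |V (ψ x) - V (φ x)| + e * τ x * |U (ψ x) - U (φ x)| := by
        rw [abs_mul, abs_mul, abs_of_pos hc0, abs_of_nonneg (mul_nonneg he (hτ0 x))]
      _ ≤ c * ((μ + ε) * M) + e * τ x * (2 * M) := by
        have := hτ0 x
        gcongr
        · exact (hVL _ _).trans (by gcongr; exact hM x)
        · exact (hUL _ _).trans (by gcongr; exact hM x)
      _ = c * ((μ + ε) * M) + e * τ x * 2 * M := by ring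
      _ ≤ c * ((μ + ε) * M) + ε * M := by gcongr; exact hτ x
      _ = _ := by ring
  have hRb : ∀ (ψ : ℝ → ℝ) (M : ℝ), (∀ x, |ψ x| ≤ M) → ∃ M', ∀ x, |R ψ x| ≤ M' :=
    fun ψ M hM => by
      have hM0 : 0 ≤ M := (abs_nonneg _).trans (hM 0)
      refine ⟨(c * (μ + ε) + ε) * M + (c + ε), fun x => ?_⟩
      have h1 := hRL ψ (fun _ => 0) M hM0 (by simpa using hM) x
      have h2 : |R (fun _ => 0) x| ≤ c + ε := by
        simp only [R, hV0, hU0, mul_one]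
        refine (abs_sub _ _).trans ?_
        have h3 := mul_nonneg he (hτ0 x)
        rw [abs_of_pos hc0, abs_of_nonneg h3]
        linarith [hτ x]
      have := abs_add_le (R ψ x - R (fun _ => 0) x) (R (fun _ => 0) x)
      rw [sub_add_cancel] at this
      linarith
  have hSc : ∀ (ψ : ℝ → ℝ) (M : ℝ), Continuous ψ → (∀ x, |ψ x| ≤ M) → Continuous (S ψ) :=
    fun ψ M hψ hM => by
      obtain ⟨M', hM'⟩ := hRb ψ M hM
      have := continuous_eulerAverage ha (hRc ψ hψ) hM'
      fun_prop
  have hSL : ∀ (ψ φ : ℝ → ℝ) (M : ℝ), Continuous ψ → Continuous φ → 0 ≤ M →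
      (∀ x, |ψ x - φ x| ≤ M) → ∀ x, |S ψ x - S φ x| ≤ ρ * (a + 1 + b * μ) * M :=
    fun ψ φ M hψ hφ hM0 hM x => by
    have h1 := abs_eulerAverage_sub_le ha (hRc ψ hψ) (hRc φ hφ) (hRL ψ φ M hM0 hM) x
    calc |S ψ x - S φ x| = |eulerAverage a (R ψ) x - eulerAverage a (R φ) x
          - b * (q (ψ x) - q (φ x))| := by congr 1; simp only [S]; ring
      _ ≤ (c * (μ + ε) + ε) * M / a + b * (ε * M) := by
        refine (abs_sub _ _).trans (add_le_add h1 ?_)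
        rw [abs_mul, abs_of_nonneg hb]
        gcongr
        exact (hqL _ _).trans (by gcongr; exact hM x)
      _ = ((c * (μ + ε) + ε) / a + b * ε) * M := by ring
      _ ≤ _ := by gcongr
  have hSb : ∀ (ψ : ℝ → ℝ) (M : ℝ), Continuous ψ → (∀ x, |ψ x| ≤ M) → ∃ M', ∀ x, |S ψ x| ≤ M' :=
    fun ψ M hψ hM => by
      obtain ⟨M', hM'⟩ := hRb ψ M hM
      refine ⟨M' / a + (a + 1 + b) + b * (ε * M), fun x => ?_⟩
      have h1 := abs_eulerAverage_le ha (hRc ψ hψ) hM' x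
      have h2 : |b * q (ψ x)| ≤ b * (ε * M) := by
        rw [abs_mul, abs_of_nonneg hb]
        have := hqL (ψ x) 0
        rw [hq0, sub_zero, sub_zero] at this
        gcongr
        exact this.trans (by gcongr; exact hM x)
      rw [abs_le] at *
      constructor <;> simp only [S] <;> linarith [h1.1, h1.2, h2.1, h2.2]
  have hψb : ∀ (ψ : BoundedContinuousFunction ℝ ℝ) x, |ψ x| ≤ ‖ψ‖ := fun ψ x => ψ.norm_coe_le_norm x
  have hT : ∀ ψ : BoundedContinuousFunction ℝ ℝ, ∃ φ : BoundedContinuousFunction ℝ ℝ,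
      ∀ x, φ x = eulerAverage (a + 1 + b * μ) (S ψ) x := fun ψ => by
    have hc := hSc ψ _ ψ.continuous (hψb ψ)
    obtain ⟨M', hM'⟩ := hSb ψ _ ψ.continuous (hψb ψ)
    exact ⟨.ofNormedAddCommGroup _ (continuous_eulerAverage hΛ hc hM') _
      (abs_eulerAverage_le hΛ hc hM'), fun x => rfl⟩
  choose T hT using hT
  have hcontr : ContractingWith ⟨ρ, hρ0⟩ T := by
    refine ⟨by exact_mod_cast hρ1, LipschitzWith.of_dist_le_mul fun ψ φ => ?_⟩
    have hρd : 0 ≤ ρ * dist ψ φ := mul_nonneg hρ0 dist_nonneg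
    refine (BoundedContinuousFunction.dist_le hρd).2 fun x => ?_
    rw [hT, hT, Real.dist_eq]
    refine (abs_eulerAverage_sub_le hΛ (hSc ψ _ ψ.continuous (hψb ψ))
      (hSc φ _ φ.continuous (hψb φ)) (hSL ψ φ (dist ψ φ) ψ.continuous φ.continuous dist_nonneg
      fun x => ?_) x).trans_eq ?_
    · rw [← Real.dist_eq]; exact BoundedContinuousFunction.dist_coe_le_dist x
    · field_simp
  obtain ⟨ψ, hψ⟩ : ∃ ψ, T ψ = ψ := ⟨_, hcontr.fixedPoint_isFixedPt⟩
  have hfix : ∀ x, ψ x = eulerAverage (a + 1 + b * μ) (S ψ) x := fun x => by rw [← hT, hψ]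
  have hψ0 : ψ 0 = 0 := by
    have h1 := hfix 0
    have hτz : τ 0 = 0 := by
      simp only [τ, abs_zero]
      rw [min_eq_left hδ₀.le, Real.zero_rpow hθ.ne']
    have h2 : S ψ 0 = (c / a) * (V (ψ 0) - V 0) - b * (q (ψ 0) - q 0) := by
      simp only [S]
      rw [eulerAverage_zero ha]
      simp only [R, hτz, hV0, hq0, hc]
      field_simp
      ring
    rw [eulerAverage_zero hΛ, eq_div_iff hΛ.ne', h2] at h1
    have h3 := hVL (ψ 0) 0
    have h4 := hqL (ψ 0) 0
    rw [sub_zero] at h3 h4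
    have h5 : |ψ 0| * (a + 1 + b * μ) ≤ ((c * (μ + ε) + ε) / a + b * ε) * |ψ 0| := by
      calc |ψ 0| * (a + 1 + b * μ) = |ψ 0 * (a + 1 + b * μ)| := by rw [abs_mul, abs_of_pos hΛ]
        _ ≤ |c / a * (V (ψ 0) - V 0)| + |b * (q (ψ 0) - q 0)| := by rw [h1]; exact abs_sub _ _
        _ = c / a * |V (ψ 0) - V 0| + b * |q (ψ 0) - q 0| := by
          rw [abs_mul, abs_mul, abs_of_nonneg hb, abs_of_pos (div_pos hc0 ha)]
        _ ≤ c / a * ((μ + ε) * |ψ 0|) + b * (ε * |ψ 0|) := by gcongr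
        _ = ((c * (μ + ε) + 0) / a + b * ε) * |ψ 0| := by ring
        _ ≤ _ := by gcongr
    have h6 := h5.trans (mul_le_mul_of_nonneg_right hρ (abs_nonneg _))
    have h7 : (1 - ρ) * (a + 1 + b * μ) * |ψ 0| ≤ 0 := by linarith
    exact abs_nonpos_iff.1 (nonpos_of_mul_nonpos_right h7 (mul_pos (by linarith) hΛ))
  have hsmall : ∀ᶠ x in 𝓝 (0 : ℝ), |ψ x| ≤ r := by
    have : Tendsto (fun x => |ψ x|) (𝓝 0) (𝓝 |ψ 0|) := ψ.continuous.abs.tendsto 0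
    rw [hψ0, abs_zero] at this
    exact this.eventually (eventually_le_nhds hr)
  obtain ⟨δ₁, hδ₁, hball⟩ := Metric.eventually_nhds_iff.1 hsmall
  refine ⟨min δ₀ δ₁, lt_min hδ₀ hδ₁, fun x => 1 + ψ x, eulerAverage a (R ψ), ?_, ?_⟩
  · intro x hx
    have hx1 : x < δ₀ := hx.2.trans_le (min_le_left _ _)
    have hxr : |ψ x| ≤ r := hball (by
      rw [Real.dist_eq, sub_zero, abs_of_pos hx.1]; exact hx.2.trans_le (min_le_right _ _))
    have hclx : cl (ψ x) = ψ x := hcl_id _ hxr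
    refine ⟨by linarith [(abs_le.1 hxr).1], ?_, ?_⟩
    · have h := hasDerivAt_eulerAverage hΛ (hSc ψ _ ψ.continuous (hψb ψ)) hx.1
      have heq : (fun x => ψ x) = eulerAverage (a + 1 + b * μ) (S ψ) := funext hfix
      rw [← heq] at h
      refine (h.const_add 1).congr_deriv ?_
      simp only [S, q, V, hclx]
      ring
    · refine (hasDerivAt_eulerAverage ha (hRc ψ ψ.continuous) hx.1).congr_deriv ?_
      simp only [R, V, U, τ, hclx]
      rw [abs_of_pos hx.1, min_eq_left hx1.le]
  · have : Tendsto (fun x => 1 + ψ x) (𝓝 0) (𝓝 (1 + ψ 0)) :=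
      (continuous_const.add ψ.continuous).tendsto 0
    rw [hψ0, add_zero] at this
    exact this.mono_left nhdsWithin_le_nhds

theorem SolvesReduced.contDiffOn {a b c e θ μ ν : ℝ} {y P : ℝ → ℝ} {δ : ℝ}
    (h : SolvesReduced a b c e θ μ ν y P δ) : ContDiffOn ℝ 2 y (Ioo 0 δ) := by
  have hξ : ∀ ξ ∈ Ioo 0 δ, ξ ≠ 0 := fun ξ hξ => hξ.1.ne'
  have hy0 : ∀ ξ ∈ Ioo 0 δ, y ξ ≠ 0 := fun ξ hξ => (h ξ hξ).1.ne'
  have hyd : DifferentiableOn ℝ y (Ioo 0 δ) := fun ξ hξ =>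
    (h ξ hξ).2.1.differentiableAt.differentiableWithinAt
  have hPd : DifferentiableOn ℝ P (Ioo 0 δ) := fun ξ hξ =>
    (h ξ hξ).2.2.differentiableAt.differentiableWithinAt
  have lift : ∀ n : ℕ, ContDiffOn ℝ n y (Ioo 0 δ) → ContDiffOn ℝ n P (Ioo 0 δ) →
      ContDiffOn ℝ (n + 1) y (Ioo 0 δ) ∧ ContDiffOn ℝ (n + 1) P (Ioo 0 δ) := fun n hy hP => by
    refine ⟨(contDiffOn_succ_iff_deriv_of_isOpen isOpen_Ioo).2 ⟨hyd, by simp, ?_⟩,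
      (contDiffOn_succ_iff_deriv_of_isOpen isOpen_Ioo).2 ⟨hPd, by simp, ?_⟩⟩
    · refine ContDiffOn.congr ?_ fun ξ hξ => (h ξ hξ).2.1.deriv
      exact ((hP.sub (contDiffOn_const.mul (hy.rpow_const_of_ne hy0))).sub
        (contDiffOn_const.mul hy)).div contDiffOn_id hξ
    · refine ContDiffOn.congr ?_ fun ξ hξ => (h ξ hξ).2.2.deriv
      exact (((contDiffOn_const.mul (hy.rpow_const_of_ne hy0)).sub
        ((contDiffOn_const.mul (contDiffOn_id.rpow_const_of_ne hξ)).mul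
          (hy.rpow_const_of_ne hy0))).sub (contDiffOn_const.mul hP)).div contDiffOn_id hξ
  obtain ⟨h1, h2⟩ := lift 0 (by simpa using hyd.continuousOn) (by simpa using hPd.continuousOn)
  have := (lift 1 (by simpa using h1) (by simpa using h2)).1
  convert this using 1
  norm_num

section changeOfVariables
variable {m p σ α β k κ K a b c e θ : ℝ}

theorem SolvesReduced.isSolution (hm : 1 < m) (hκ : 0 < κ) (hK : 0 < K) (hKm : K ^ m = K * κ)
    (hk : k * m = k + 2) (ha : a = k + 1) (hb : b * κ = β) (hc : c * κ = α + β)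
    (he : e * κ * K = K ^ p) (hθ : θ = σ + k * p - k) {y P : ℝ → ℝ} {δ : ℝ}
    (h : SolvesReduced a b c e θ (1 / m) (p / m) y P δ) :
    (∀ ξ ∈ Ioo 0 δ, 0 < K * ξ ^ k * y ξ ^ (1 / m)) ∧
      ContDiffOn ℝ 2 (Fm m fun ξ => K * ξ ^ k * y ξ ^ (1 / m)) (Ioo 0 δ) ∧
      SolvesODE m p σ α β (fun ξ => K * ξ ^ k * y ξ ^ (1 / m)) (Ioo 0 δ) := by
  have hm0 : m ≠ 0 := by linarith
  obtain ⟨f, hf⟩ : ∃ f : ℝ → ℝ, f = fun ξ => K * ξ ^ k * y ξ ^ (1 / m) := ⟨_, rfl⟩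
  have hfx : ∀ ξ, f ξ = K * ξ ^ k * y ξ ^ (1 / m) := fun ξ => by rw [hf]
  rw [← hf]
  have hpos : ∀ ξ ∈ Ioo 0 δ, 0 < K * ξ ^ k * y ξ ^ (1 / m) := fun ξ hξ =>
    mul_pos (mul_pos hK (Real.rpow_pos_of_pos hξ.1 _)) (Real.rpow_pos_of_pos (h ξ hξ).1 _)
  have hFm : ∀ ξ ∈ Ioo 0 δ, Fm m f ξ = K * κ * ξ ^ (k + 2) * y ξ := fun ξ hξ => by
    have hy := (h ξ hξ).1.le
    have hxk := Real.rpow_nonneg hξ.1.le k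
    rw [Fm, hfx, Real.mul_rpow (by positivity) (by positivity), Real.mul_rpow hK.le hxk, hKm,
      ← Real.rpow_mul hξ.1.le, hk, ← Real.rpow_mul hy, one_div_mul_cancel hm0, Real.rpow_one]
  have hdf : ∀ ξ ∈ Ioo 0 δ, DifferentiableAt ℝ f ξ := fun ξ hξ => by
    rw [hf]
    exact ((Real.differentiableAt_rpow_const_of_ne k hξ.1.ne').const_mul K).mul
      ((h ξ hξ).2.1.differentiableAt.rpow_const (Or.inl (h ξ hξ).1.ne'))
  have hF1 : ∀ ξ ∈ Ioo 0 δ, deriv (Fm m f) ξ = K * κ * ξ ^ (k + 1) * P ξ - β * ξ * f ξ :=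
    fun ξ hξ => by
      have hx := hξ.1
      have hev : Fm m f =ᶠ[𝓝 ξ] fun ξ => K * κ * ξ ^ (k + 2) * y ξ := by
        filter_upwards [isOpen_Ioo.mem_nhds hξ] with z hz using hFm z hz
      have hd := ((Real.hasDerivAt_rpow_const (p := k + 2) (Or.inl hx.ne')).const_mul
        (K * κ)).mul (h ξ hξ).2.1
      rw [hev.deriv_eq]
      refine hd.deriv.trans ?_
      rw [hfx, ← hb, ha, show k + 2 - 1 = k + 1 by ring, show k + 2 = k + 1 + 1 by ring,
        Real.rpow_add_one hx.ne' (k + 1), Real.rpow_add_one hx.ne' k]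
      field_simp
      ring
  refine ⟨by simpa only [hfx] using hpos, ?_, fun ξ hξ => ?_⟩
  · refine ContDiffOn.congr ?_ hFm
    exact (contDiffOn_const.mul (contDiffOn_id.rpow_const_of_ne fun ξ hξ => hξ.1.ne')).mul
      h.contDiffOn
  · have hx := hξ.1
    have hev : deriv (Fm m f) =ᶠ[𝓝 ξ] fun ξ => K * κ * ξ ^ (k + 1) * P ξ - β * ξ * f ξ := by
      filter_upwards [isOpen_Ioo.mem_nhds hξ] with z hz using hF1 z hz
    have hd := (((Real.hasDerivAt_rpow_const (p := k + 1) (Or.inl hx.ne')).const_mul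
        (K * κ)).mul (h ξ hξ).2.2).sub
      (((hasDerivAt_id ξ).const_mul β).mul (hdf ξ hξ).hasDerivAt)
    have h2 := hev.deriv_eq.trans hd.deriv
    have hy := (h ξ hξ).1.le
    have hxk := Real.rpow_nonneg hx.le k
    have hfp : ξ ^ σ * f ξ ^ p = e * κ * K * (ξ ^ k * ξ ^ θ) * y ξ ^ (p / m) := by
      rw [hfx, Real.mul_rpow (by positivity) (by positivity), Real.mul_rpow hK.le hxk, he,
        ← Real.rpow_mul hx.le, ← Real.rpow_mul hy, ← Real.rpow_add hx,
        show k + θ = σ + k * p by rw [hθ]; ring, Real.rpow_add hx, one_div_mul_eq_div]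
      ring
    have hcf : α * f ξ = (c * κ - β) * (K * ξ ^ k * y ξ ^ (1 / m)) := by rw [hc, hfx]; ring
    rw [h2, hfp, hcf, ha, show k + 1 - 1 = k by ring, Real.rpow_add_one hx.ne']
    simp only [id]
    rw [hfx ξ]
    field_simp
    ring

theorem solvesReduced_of_isSolution (hm : 1 < m) (hκ : 0 < κ) (hK : 0 < K)
    (hKm : K ^ m = K * κ) (hk : k * m = k + 2) (ha : a = k + 1) (hb : b * κ = β)
    (hc : c * κ = α + β) (he : e * κ * K = K ^ p) (hθ : θ = σ + k * p - k) {f : ℝ → ℝ} {δ : ℝ}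
    (hpos : ∀ ξ ∈ Ioo 0 δ, 0 < f ξ) (hcd : ContDiffOn ℝ 2 (Fm m f) (Ioo 0 δ))
    (hode : SolvesODE m p σ α β f (Ioo 0 δ)) :
    SolvesReduced a b c e θ (1 / m) (p / m) (fun ξ => (f ξ * ξ ^ (-k) / K) ^ m)
      (fun ξ => (deriv (Fm m f) ξ + β * ξ * f ξ) * ξ ^ (-(k + 1)) / (K * κ)) δ := by
  have hm0 : m ≠ 0 := by linarith
  have hcd' := (contDiffOn_succ_iff_deriv_of_isOpen (n := 1) isOpen_Ioo).1
    (by rwa [one_add_one_eq_two])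
  have hF : ∀ ξ ∈ Ioo 0 δ, DifferentiableAt ℝ (Fm m f) ξ := fun ξ hξ =>
    (hcd'.1 ξ hξ).differentiableAt (isOpen_Ioo.mem_nhds hξ)
  have hF' : ∀ ξ ∈ Ioo 0 δ, DifferentiableAt ℝ (deriv (Fm m f)) ξ := fun ξ hξ =>
    (hcd'.2.2.differentiableOn (by norm_num) ξ hξ).differentiableAt (isOpen_Ioo.mem_nhds hξ)
  have hf : ∀ ξ ∈ Ioo 0 δ, DifferentiableAt ℝ f ξ := fun ξ hξ => by
    have hev : f =ᶠ[𝓝 ξ] fun ξ => Fm m f ξ ^ (1 / m) := by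
      filter_upwards [isOpen_Ioo.mem_nhds hξ] with z hz
      rw [Fm, ← Real.rpow_mul (hpos z hz).le, mul_one_div_cancel hm0, Real.rpow_one]
    exact ((hF ξ hξ).rpow_const
      (Or.inl (Real.rpow_pos_of_pos (hpos ξ hξ) m).ne')).congr_of_eventuallyEq hev
  have hyF : ∀ ξ ∈ Ioo 0 δ,
      (f ξ * ξ ^ (-k) / K) ^ m = Fm m f ξ * ξ ^ (-(k + 2)) / (K * κ) := fun ξ hξ => by
    have h1 := (hpos ξ hξ).le
    have h2 := Real.rpow_nonneg hξ.1.le (-k)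
    rw [Real.div_rpow (by positivity) hK.le, Real.mul_rpow h1 h2, hKm, ← Real.rpow_mul hξ.1.le,
      neg_mul, hk, Fm]
  intro ξ hξ
  have hx := hξ.1
  have hxk : 0 < ξ ^ k := Real.rpow_pos_of_pos hx k
  have hq : 0 < f ξ * ξ ^ (-k) / K :=
    div_pos (mul_pos (hpos ξ hξ) (Real.rpow_pos_of_pos hx _)) hK
  have hV : ((f ξ * ξ ^ (-k) / K) ^ m) ^ (1 / m) = f ξ * ξ ^ (-k) / K := by
    rw [← Real.rpow_mul hq.le, mul_one_div_cancel hm0, Real.rpow_one]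
  have hU : e * ξ ^ θ * ((f ξ * ξ ^ (-k) / K) ^ m) ^ (p / m)
      = ξ ^ σ * f ξ ^ p / ξ ^ k / (K * κ) := by
    have h2 := Real.rpow_nonneg hξ.1.le (-k)
    have h1 := (hpos ξ hξ).le
    have hKp := (Real.rpow_pos_of_pos hK p).ne'
    have hxkp := (Real.rpow_pos_of_pos hx (k * p)).ne'
    have he' : e = K ^ p / (κ * K) := by rw [← he]; field_simp
    rw [← Real.rpow_mul hq.le, mul_div_cancel₀ _ hm0, Real.div_rpow (by positivity) hK.le,
      Real.mul_rpow h1 h2, ← Real.rpow_mul hx.le, neg_mul, hθ, Real.rpow_sub hx,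
      Real.rpow_add hx, Real.rpow_neg hx.le, he']
    field_simp
  refine ⟨Real.rpow_pos_of_pos hq m, ?_, ?_⟩
  · have hev : (fun ξ => (f ξ * ξ ^ (-k) / K) ^ m)
        =ᶠ[𝓝 ξ] fun ξ => Fm m f ξ * ξ ^ (-(k + 2)) / (K * κ) := by
      filter_upwards [isOpen_Ioo.mem_nhds hξ] with z hz using hyF z hz
    have hd := ((hF ξ hξ).hasDerivAt.mul
      (Real.hasDerivAt_rpow_const (p := -(k + 2)) (Or.inl hx.ne'))).div_const (K * κ)
    refine (hd.congr_of_eventuallyEq hev).congr_deriv ?_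
    beta_reduce
    rw [hV, hyF ξ hξ, ha, ← hb, Real.rpow_sub_one hx.ne', Real.rpow_neg hx.le,
      Real.rpow_neg hx.le, Real.rpow_neg hx.le, show k + 2 = k + 1 + 1 by ring,
      Real.rpow_add_one hx.ne' (k + 1), Real.rpow_add_one hx.ne' k]
    field_simp
    ring
  · have hd := (((hF' ξ hξ).hasDerivAt.add
      (((hasDerivAt_id ξ).const_mul β).mul (hf ξ hξ).hasDerivAt)).mul
      (Real.hasDerivAt_rpow_const (p := -(k + 1)) (Or.inl hx.ne'))).div_const (K * κ)
    refine hd.congr_deriv ?_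
    have hode' : deriv (deriv (Fm m f)) ξ
        = (c * κ - β) * f ξ - β * ξ * deriv f ξ - ξ ^ σ * f ξ ^ p := by
      rw [hc]; linarith [hode ξ hξ]
    beta_reduce
    rw [hV, hU, hode', ha, Real.rpow_sub_one hx.ne', Real.rpow_neg hx.le, Real.rpow_neg hx.le,
      Real.rpow_add_one hx.ne']
    simp only [id, Pi.add_apply, Pi.mul_apply]
    field_simp
    ring

end changeOfVariables

/-- existence, and local uniqueness near `0`, of a positive
solution of the profile ODE with `f(ξ) ξ^{-2/(m-1)} → ((m-1)/(2m(m+1)))^{1/(m-1)}`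
as `ξ → 0⁺`. -/
theorem existence_uniqueness_P2_quadratic_behavior (m p σ α β : ℝ)
    (hm : 1 < m) (hp0 : 0 < p) (hp1 : p < 1) (hmp : 2 < m + p)
    (hσ : 2 * (1 - p) / (m - 1) < σ)
    (hα : α = (σ + 2) / (σ * (m - 1) + 2 * (p - 1)))
    (hβ : β = (m - p) / (σ * (m - 1) + 2 * (p - 1))) :
    (∃ f : ℝ → ℝ, ∃ δ > 0, (∀ ξ ∈ Set.Ioo 0 δ, 0 < f ξ) ∧
      ContDiffOn ℝ 2 (Fm m f) (Set.Ioo 0 δ) ∧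
      SolvesODE m p σ α β f (Set.Ioo 0 δ) ∧
      Filter.Tendsto (fun ξ => f ξ * ξ ^ (-(2 / (m - 1))))
        (nhdsWithin 0 (Set.Ioi 0))
        (nhds (((m - 1) / (2 * m * (m + 1))) ^ (1 / (m - 1))))) ∧
    (∀ f g : ℝ → ℝ, ∀ δf δg : ℝ, 0 < δf → 0 < δg →
      (∀ ξ ∈ Set.Ioo 0 δf, 0 < f ξ) →
      ContDiffOn ℝ 2 (Fm m f) (Set.Ioo 0 δf) →
      SolvesODE m p σ α β f (Set.Ioo 0 δf) →
      Filter.Tendsto (fun ξ => f ξ * ξ ^ (-(2 / (m - 1))))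
        (nhdsWithin 0 (Set.Ioi 0))
        (nhds (((m - 1) / (2 * m * (m + 1))) ^ (1 / (m - 1)))) →
      (∀ ξ ∈ Set.Ioo 0 δg, 0 < g ξ) →
      ContDiffOn ℝ 2 (Fm m g) (Set.Ioo 0 δg) →
      SolvesODE m p σ α β g (Set.Ioo 0 δg) →
      Filter.Tendsto (fun ξ => g ξ * ξ ^ (-(2 / (m - 1))))
        (nhdsWithin 0 (Set.Ioi 0))
        (nhds (((m - 1) / (2 * m * (m + 1))) ^ (1 / (m - 1)))) →
      ∃ ε > 0, ∀ ξ ∈ Set.Ioo 0 ε, f ξ = g ξ) := by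
  have hm1 : 0 < m - 1 := by linarith
  have hden : 0 < σ * (m - 1) + 2 * (p - 1) := by
    rw [div_lt_iff₀ hm1] at hσ; linarith
  obtain ⟨κ, hκd⟩ : ∃ κ, κ = (m - 1) / (2 * m * (m + 1)) := ⟨_, rfl⟩
  obtain ⟨k, hkd⟩ : ∃ k, k = 2 / (m - 1) := ⟨_, rfl⟩
  obtain ⟨K, hKd⟩ : ∃ K, K = κ ^ (1 / (m - 1)) := ⟨_, rfl⟩
  rw [← hκd, ← hKd, ← hkd]
  have hκ : 0 < κ := by rw [hκd]; exact div_pos hm1 (by positivity)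
  have hK : 0 < K := by rw [hKd]; exact Real.rpow_pos_of_pos hκ _
  have hk0 : 0 < k := by rw [hkd]; positivity
  have hKm : K ^ m = K * κ := by
    have h1 : K ^ (m - 1) = κ := by
      rw [hKd, ← Real.rpow_mul hκ.le, one_div_mul_cancel hm1.ne', Real.rpow_one]
    rw [show m = m - 1 + 1 by ring, Real.rpow_add_one hK.ne', h1, mul_comm]
  have hk : k * m = k + 2 := by rw [hkd]; field_simp; ring
  have hβ0 : 0 < β := by rw [hβ]; exact div_pos (by linarith) hden
  have hb : β / κ * κ = β := div_mul_cancel₀ _ hκ.ne'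
  have hc : (α + β) / κ * κ = α + β := div_mul_cancel₀ _ hκ.ne'
  have he : K ^ p / (κ * K) * κ * K = K ^ p := by field_simp
  have he0 : 0 ≤ K ^ p / (κ * K) := by positivity
  have hb0 : 0 ≤ β / κ := by positivity
  have hθ0 : 0 < σ + k * p - k := by
    have : σ + k * p - k = σ - 2 * (1 - p) / (m - 1) := by rw [hkd]; ring
    linarith
  have hca : (α + β) / κ = (k + 1) * (k + 1 + 1 + β / κ) := by
    have hκ1 : κ * ((k + 1) * (k + 2)) = 1 / (m - 1) := by
      rw [hκd, hkd]; field_simp; ring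
    have hαβ : α - k * β = 1 / (m - 1) := by
      rw [hα, hβ, hkd]; field_simp; ring
    field_simp
    linarith
  have hμ1 : 1 / m < 1 := (div_lt_one (by linarith)).2 hm
  have hν1 : p / m < 1 := (div_lt_one (by linarith)).2 (by linarith)
  refine ⟨?_, fun f g δf δg hδf hδg hf0 hf2 hf hfl hg0 hg2 hg hgl => ?_⟩
  · obtain ⟨δ, hδ, y, P, hyP, hy1⟩ := exists_solvesReduced (a := k + 1) (by positivity) hb0 he0
      hca hθ0 (by positivity : 0 < 1 / m) hμ1 (by positivity : 0 < p / m) hν1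
    obtain ⟨h1, h2, h3⟩ := hyP.isSolution hm hκ hK hKm hk rfl hb hc he rfl
    refine ⟨_, δ, hδ, h1, h2, h3, ?_⟩
    have hlim : Tendsto (fun ξ => K * y ξ ^ (1 / m)) (𝓝[>] 0) (𝓝 K) := by
      simpa using (hy1.rpow_const (p := 1 / m) (Or.inl one_ne_zero)).const_mul K
    refine hlim.congr' ?_
    filter_upwards [self_mem_nhdsWithin] with ξ hξ
    have := (Real.rpow_pos_of_pos hξ k).ne'
    rw [Real.rpow_neg (le_of_lt hξ)]
    field_simp
  · have lim : ∀ h : ℝ → ℝ, Tendsto (fun ξ => h ξ * ξ ^ (-k)) (𝓝[>] 0) (𝓝 K) →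
        Tendsto (fun ξ => (h ξ * ξ ^ (-k) / K) ^ m) (𝓝[>] 0) (𝓝 1) := fun h hh => by
      have := (hh.div_const K).rpow_const (p := m) (Or.inr (by linarith))
      rwa [div_self hK.ne', Real.one_rpow] at this
    obtain ⟨δ, hδ, huniq⟩ := SolvesReduced.eventually_unique (by positivity) hb0 he0
      hca hθ0 (by positivity : 0 < 1 / m) hμ1 (by positivity : 0 < p / m) hν1 hδf hδg
      (solvesReduced_of_isSolution hm hκ hK hKm hk rfl hb hc he rfl hf0 hf2 hf)
      (solvesReduced_of_isSolution hm hκ hK hKm hk rfl hb hc he rfl hg0 hg2 hg)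
      (lim f hfl) (lim g hgl)
    refine ⟨min δ (min δf δg), by positivity, fun ξ hξ => ?_⟩
    obtain ⟨hξ0, hξ1⟩ := hξ
    simp only [lt_min_iff] at hξ1
    have hx := Real.rpow_pos_of_pos hξ0 (-k)
    have hf := hf0 ξ ⟨hξ0, hξ1.2.1⟩
    have hg := hg0 ξ ⟨hξ0, hξ1.2.2⟩
    have := (Real.rpow_left_inj (by positivity) (by positivity) (by linarith)).1
      (huniq ξ ⟨hξ0, hξ1.1⟩)
    rw [div_left_inj' hK.ne'] at this
    exact mul_right_cancel₀ hx.ne' this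
end

section
/- Let m>1, 0<p<1, σ>2(1−p)/(m−1), α=(σ+2)/(σ(m−1)+2(p−1)), β=(m−p)/(σ(m−1)+2(p−1)), and T>0. Let f:[0,∞)→[0,∞) be continuous with f(ξ)ξ^{−(σ+2)/(m−p)} → K for some K>0 as ξ→0⁺, and define u(x,t)=(T−t)^{−α} f(x(T−t)^{β}) for x≥0 and t∈(0,T). Then u(0,t)=0 for all t∈(0,T), and for every fixed x>0, u(x,t) → K·x^{(σ+2)/(m−p)} (a finite limit) as t→T⁻; if moreover sup f = ∞ or f attains a positive value a>0, then sup_{x≥0} u(x,t) → ∞ as t→T⁻ (blow-up occurs only at space infinity). -/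
open Real Filter Set Topology

/-- for a profile with `f(ξ) ξ^{-(σ+2)/(m-p)} → K > 0` as
`ξ → 0⁺`, the self-similar solution `u(x,t) = (T-t)^{-α} f(x(T-t)^β)` vanishes
at `x = 0`, stays bounded (with finite limit `K x^{(σ+2)/(m-p)}`) at every
fixed `x > 0` as `t → T⁻`, and, provided `f` is unbounded or attains a
positive value, its spatial supremum blows up as `t → T⁻`: blow-up occurs only
at space infinity. -/
theorem blowup_only_at_space_infinity (m p σ α β T : ℝ)
    (hm : 1 < m) (hp0 : 0 < p) (hp1 : p < 1)
    (hσ : 2 * (1 - p) / (m - 1) < σ)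
    (hα : α = (σ + 2) / (σ * (m - 1) + 2 * (p - 1)))
    (hβ : β = (m - p) / (σ * (m - 1) + 2 * (p - 1)))
    (hT : 0 < T)
    (f : ℝ → ℝ) (hcont : ContinuousOn f (Set.Ici 0))
    (hnonneg : ∀ ξ ∈ Set.Ici (0 : ℝ), 0 ≤ f ξ)
    (K : ℝ) (hK : 0 < K)
    (hasym : Filter.Tendsto (fun ξ => f ξ * ξ ^ (-((σ + 2) / (m - p))))
      (nhdsWithin 0 (Set.Ioi 0)) (nhds K)) :
    (∀ t ∈ Set.Ioo 0 T, (T - t) ^ (-α) * f (0 * (T - t) ^ β) = 0) ∧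
    (∀ x : ℝ, 0 < x →
      Filter.Tendsto (fun t => (T - t) ^ (-α) * f (x * (T - t) ^ β))
        (nhdsWithin T (Set.Iio T)) (nhds (K * x ^ ((σ + 2) / (m - p))))) ∧
    ((¬ BddAbove (f '' Set.Ici 0) ∨ ∃ ξ ≥ (0 : ℝ), 0 < f ξ) →
      ∀ M : ℝ, ∀ᶠ t in nhdsWithin T (Set.Iio T),
        ∃ x ≥ (0 : ℝ), M < (T - t) ^ (-α) * f (x * (T - t) ^ β)) := by
  have hσ0 : 0 < σ := lt_trans (div_pos (by linarith) (by linarith)) hσ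
  have hmp : 0 < m - p := by linarith
  have hD : 0 < σ * (m - 1) + 2 * (p - 1) := by
    rw [div_lt_iff₀ (by linarith)] at hσ
    linarith
  have hα0 : 0 < α := hα ▸ div_pos (by linarith) hD
  have hβ0 : 0 < β := hβ ▸ div_pos hmp hD
  set γ := (σ + 2) / (m - p) with hγ
  have hγ0 : 0 < γ := div_pos (by linarith) hmp
  have hαβ : α = β * γ := by
    rw [hα, hβ, hγ]
    field_simp
  have hf0 : f 0 = 0 := by
    have h1 : Tendsto f (𝓝[>] 0) (𝓝 (f 0)) :=
      (hcont 0 self_mem_Ici).mono_left (nhdsWithin_mono _ Ioi_subset_Ici_self)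
    have h2 : Tendsto (fun ξ : ℝ => ξ ^ γ) (𝓝[>] 0) (𝓝 0) := by
      have h := (Real.continuousAt_rpow_const 0 γ (Or.inr hγ0.le)).tendsto
      rw [Real.zero_rpow hγ0.ne'] at h
      exact h.mono_left nhdsWithin_le_nhds
    have h3 := hasym.mul h2
    rw [mul_zero] at h3
    refine tendsto_nhds_unique h1 (h3.congr' ?_)
    filter_upwards [self_mem_nhdsWithin] with ξ hξ
    rw [mul_assoc, ← Real.rpow_add hξ, neg_add_cancel, Real.rpow_zero, mul_one]
  have hsub : Tendsto (fun t => T - t) (𝓝[<] T) (𝓝[>] 0) := by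
    refine tendsto_nhdsWithin_iff.2 ⟨?_, ?_⟩
    · have h : Tendsto (fun t => T - t) (𝓝 T) (𝓝 (T - T)) :=
        (continuous_const.sub continuous_id).tendsto T
      rw [sub_self] at h
      exact h.mono_left nhdsWithin_le_nhds
    · filter_upwards [self_mem_nhdsWithin] with t ht
      exact sub_pos.2 (mem_Iio.1 ht)
  refine ⟨fun t _ => by rw [zero_mul, hf0, mul_zero], fun x hx => ?_, fun h M => ?_⟩
  · have harg : Tendsto (fun s : ℝ => x * s ^ β) (𝓝[>] 0) (𝓝[>] 0) := by
      refine tendsto_nhdsWithin_iff.2 ⟨?_, ?_⟩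
      · have h := (Real.continuousAt_rpow_const 0 β (Or.inr hβ0.le)).tendsto.const_mul x
        rw [Real.zero_rpow hβ0.ne', mul_zero] at h
        exact h.mono_left nhdsWithin_le_nhds
      · filter_upwards [self_mem_nhdsWithin] with s hs
        exact mul_pos hx (Real.rpow_pos_of_pos hs _)
    have hlim := ((hasym.comp harg).mul_const (x ^ γ)).comp hsub
    refine hlim.congr' ?_
    filter_upwards [self_mem_nhdsWithin] with t ht
    have hs : 0 < T - t := sub_pos.2 ht
    have hx1 : x ^ (-γ) * x ^ γ = 1 := by
      rw [← Real.rpow_add hx, neg_add_cancel, Real.rpow_zero]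
    simp only [Function.comp_apply]
    rw [Real.mul_rpow hx.le (Real.rpow_nonneg hs.le _), ← Real.rpow_mul hs.le, mul_neg, ← hαβ]
    linear_combination (f (x * (T - t) ^ β) * (T - t) ^ (-α)) * hx1
  · obtain ⟨ξ, hξ, hfξ⟩ : ∃ ξ ≥ (0 : ℝ), 0 < f ξ := by
      rcases h with h | h
      · by_contra! hle
        exact h ⟨0, by rintro _ ⟨ξ, hξ, rfl⟩; exact hle ξ hξ⟩
      · exact h
    have hlim := ((tendsto_rpow_neg_nhdsGT_zero (neg_lt_zero.2 hα0)).comp hsub).atTop_mul_const hfξ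
    filter_upwards [hlim.eventually_gt_atTop M, self_mem_nhdsWithin] with t hM ht
    have hs : 0 < T - t := sub_pos.2 ht
    refine ⟨ξ * (T - t) ^ (-β), mul_nonneg hξ (Real.rpow_nonneg hs.le _), ?_⟩
    rwa [mul_assoc, ← Real.rpow_add hs, neg_add_cancel, Real.rpow_zero, mul_one]
end
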